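/- Let ω₀ = dx₁∧dy₁ + dx₂∧dy₂ be the standard symplectic form on ℝ⁴ ≅ ℂ², and let J be a real-analytic almost complex structure on ℝ⁴ adapted to ω₀. Then every compact real-analytic hypersurface M ⊂ ℝ⁴ is of finite type for J: there exists k ∈ ℕ such that for every p ∈ M and every regular J-holomorphic disk γ with γ(0) = p, the function ρ∘γ does not vanish to order ≥ k+1 at 0. -/

import Mathlib

noncomputable section

open Set

abbrev E4 : Type := EuclideanSpace ℝ (Fin 4)
abbrev E2 : Type := ℝ × ℝ

/-- The standard complex structure `J₀` on `ℝ²`: `J₀(x,y) = (-y,x)`. -/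
def J0 : E2 →L[ℝ] E2 :=
  (-(ContinuousLinearMap.snd ℝ ℝ ℝ)).prod (ContinuousLinearMap.fst ℝ ℝ ℝ)

/-- A real-analytic almost complex structure on `ℝ⁴`. -/
def IsAlmostComplex (J : E4 → E4 →L[ℝ] E4) : Prop :=
  (∀ p, AnalyticAt ℝ J p) ∧ ∀ p, (J p).comp (J p) = - ContinuousLinearMap.id ℝ E4

/-- A `J`-holomorphic disk: a smooth map on an open neighborhood `V` of `0` in `ℝ²`
satisfying `du ∘ J₀ = J(u) ∘ du` on `V`. -/
def IsJHolDisk (J : E4 → E4 →L[ℝ] E4) (V : Set E2) (u : E2 → E4) : Prop :=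
  IsOpen V ∧ (0 : E2) ∈ V ∧ ContDiffOn ℝ (⊤ : ℕ∞) u V ∧
    ∀ z ∈ V, (fderiv ℝ u z).comp J0 = (J (u z)).comp (fderiv ℝ u z)

/-- `u` is regular on `V` if its differential does not vanish on `V`. -/
def IsRegularOn (u : E2 → E4) (V : Set E2) : Prop := ∀ z ∈ V, fderiv ℝ u z ≠ 0

/-- `f` vanishes to order at least `k` at `0`: all derivatives of order `< k` vanish at `0`. -/
def VanishesToOrder (f : E2 → ℝ) (k : ℕ) : Prop :=
  ∀ i < k, iteratedFDeriv ℝ i f 0 = 0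

/-- The standard symplectic form `ω₀ = dx₁∧dy₁ + dx₂∧dy₂` on `ℝ⁴`, with coordinates
`(x₁, y₁, x₂, y₂)`. -/
def omega0 (v w : E4) : ℝ := v 0 * w 1 - v 1 * w 0 + v 2 * w 3 - v 3 * w 2

/-- `J` is adapted to `ω₀`: `ω₀` is `J`-invariant and `ω₀(·, J·)` is positive. -/
def IsAdapted (J : E4 → E4 →L[ℝ] E4) : Prop :=
  (∀ p v w, omega0 (J p v) (J p w) = omega0 v w) ∧
    ∀ p v, v ≠ 0 → 0 < omega0 v (J p v)

/-- A real-analytic hypersurface `M = {ρ = 0}` in an open set `Ω ⊆ ℝ⁴`. -/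
def IsHypersurface (ρ : E4 → ℝ) (Ω : Set E4) : Prop :=
  IsOpen Ω ∧ (∀ x ∈ Ω, AnalyticAt ℝ ρ x) ∧ ∀ ζ ∈ Ω, ρ ζ = 0 → fderiv ℝ ρ ζ ≠ 0

section
open Filter Topology MeasureTheory
open scoped ContDiff

theorem no_retr {E : Type*} [NormedAddCommGroup E] [InnerProductSpace ℝ E] [FiniteDimensional ℝ E]
    (r : E → E) (hr : ContDiff ℝ 1 r) (R : ℝ) (hR : 0 < R) (h1 : ∀ x, ‖r x‖ = R)
    (h2 : ∀ x, ‖x‖ = R → r x = x) : False := by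
  let _ : MeasurableSpace E := borel E
  have : BorelSpace E := ⟨rfl⟩
  let μ : Measure E := Measure.addHaar
  set g : E → E := fun x => r x - x with hg
  have gC : ContDiff ℝ 1 g := hr.sub contDiff_id
  have gD : ∀ x, DifferentiableAt ℝ g x := fun x => gC.differentiable (by norm_num) x
  have cD : Continuous (fderiv ℝ g) := gC.continuous_fderiv (by norm_num)
  obtain ⟨L0, hL0⟩ := (isCompact_closedBall (0:E) R).exists_bound_of_continuousOn cD.continuousOn
  obtain ⟨L, hL, hLp⟩ : ∃ L : ℝ, (∀ x ∈ Metric.closedBall (0:E) R, ‖fderiv ℝ g x‖ ≤ L) ∧ 0 < L :=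
    ⟨max L0 1, fun x hx => (hL0 x hx).trans (le_max_left _ _), by positivity⟩
  have lip : ∀ x y, ‖x‖ ≤ R → ‖y‖ ≤ R → ‖g x - g y‖ ≤ L * ‖x - y‖ := fun x y hx hy =>
    (convex_closedBall (0:E) R).norm_image_sub_le_of_norm_fderiv_le (fun x _ => gD x) hL
      (by simpa using hy) (by simpa using hx)
  have gs : ∀ x, ‖x‖ = R → g x = 0 := fun x hx => by simp [hg, h2 x hx]
  classical
  set G : E → E := fun x => if ‖x‖ ≤ R then g x else 0 with hG
  have lip1 : ∀ x y, ‖x‖ ≤ R → ¬ ‖y‖ ≤ R → ‖g x‖ ≤ 2 * L * ‖x - y‖ := by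
    intro x y hx hy
    push Not at hy
    have hy0 : 0 < ‖y‖ := hR.trans hy
    have hz : ‖(R / ‖y‖) • y‖ = R := by
      rw [norm_smul, Real.norm_of_nonneg (by positivity), div_mul_cancel₀ _ hy0.ne']
    have h3 := lip x _ hx hz.le
    rw [gs _ hz, sub_zero] at h3
    have h4 : ‖y - (R / ‖y‖) • y‖ ≤ ‖x - y‖ := by
      have : y - (R / ‖y‖) • y = (1 - R / ‖y‖) • y := by rw [sub_smul, one_smul]
      rw [this, norm_smul, Real.norm_of_nonneg (by rw [sub_nonneg, div_le_one hy0]; exact hy.le),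
        sub_mul, one_mul, div_mul_cancel₀ _ hy0.ne']
      have := norm_sub_norm_le y x
      rw [norm_sub_rev] at this
      linarith
    have h5 : ‖x - (R / ‖y‖) • y‖ ≤ ‖x - y‖ + ‖y - (R / ‖y‖) • y‖ := norm_sub_le_norm_sub_add_norm_sub _ _ _
    calc ‖g x‖ ≤ L * ‖x - (R / ‖y‖) • y‖ := h3
      _ ≤ L * (2 * ‖x - y‖) := by gcongr; linarith
      _ = _ := by ring
  have lipG : ∀ x y, ‖G x - G y‖ ≤ 2 * L * ‖x - y‖ := by
    intro x y
    simp only [hG]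
    split_ifs with hx hy hy
    · refine (lip x y hx hy).trans ?_
      gcongr; linarith
    · simpa using lip1 x y hx hy
    · simpa [norm_sub_rev] using lip1 y x hy hx
    · simp; positivity
  have key : ∀ᶠ t in 𝓝 (0:ℝ), ∀ x ∈ Metric.closedBall (0:E) R,
      0 < (ContinuousLinearMap.id ℝ E + t • fderiv ℝ g x).det := by
    refine (isCompact_closedBall (0:E) R).eventually_forall_of_forall_eventually fun y _ => ?_
    have hc : Continuous fun z : ℝ × E => (ContinuousLinearMap.id ℝ E + z.1 • fderiv ℝ g z.2).det :=
      ContinuousLinearMap.continuous_det.comp (by fun_prop)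
    refine hc.continuousAt.eventually (lt_mem_nhds ?_)
    simp [ContinuousLinearMap.det]
  obtain ⟨ε, hε, hkey⟩ := Metric.eventually_nhds_iff.1 key
  set B := Metric.closedBall (0:E) R
  have vol : ∀ t : ℝ, 0 < t → t < ε → t < 1 / (2 * L) →
      ∫ x in B, (ContinuousLinearMap.id ℝ E + t • fderiv ℝ g x).det ∂μ = μ.real B := by
    intro t ht hte htL
    have htL' : t * (2 * L) < 1 := by rwa [lt_div_iff₀ (by positivity)] at htL
    have inj : ∀ x y, x + t • G x = y + t • G y → x = y := by
      intro x y hxy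
      by_contra hne
      have h3 : x - y = t • (G y - G x) := by
        rw [smul_sub, sub_eq_sub_iff_add_eq_add, hxy, add_comm]
      have h4 : ‖x - y‖ ≤ t * (2 * L * ‖x - y‖) := by
        conv_lhs => rw [h3, norm_smul, Real.norm_of_nonneg ht.le]
        gcongr
        rw [norm_sub_rev x y]; exact lipG _ _
      have : 0 < ‖x - y‖ := norm_pos_iff.2 (sub_ne_zero.2 hne)
      nlinarith
    have surj : ∀ y, ∃ x, x + t • G x = y := by
      intro y
      have : ContractingWith (Real.toNNReal (t * (2 * L))) (fun x => y - t • G x) := by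
        refine ⟨by rw [← NNReal.coe_lt_coe, Real.coe_toNNReal _ (by positivity)]; exact_mod_cast htL', LipschitzWith.of_dist_le_mul fun a b => ?_⟩
        rw [dist_eq_norm, dist_eq_norm, sub_sub_sub_cancel_left, ← smul_sub, norm_smul,
          Real.norm_of_nonneg ht.le, Real.coe_toNNReal _ (by positivity), mul_assoc, norm_sub_rev a b]
        gcongr
        exact lipG _ _
      obtain ⟨x, hx, -⟩ := this.exists_fixedPoint y (edist_ne_top _ _)
      exact ⟨x, by have : y - t • G x = x := hx
                   rw [← eq_sub_iff_add_eq]; exact this.symm⟩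
    have img : (fun x => x + t • g x) '' B = B := by
      ext y
      constructor
      · rintro ⟨x, hx, rfl⟩
        by_contra hy
        have hx' : ‖x‖ ≤ R := by simpa [B] using hx
        have hy' : ¬ ‖x + t • g x‖ ≤ R := by simpa [B] using hy
        have h5 : x = x + t • g x := inj _ _ (by simp only [hG, if_pos hx', if_neg hy', smul_zero, add_zero])
        exact hy' (h5 ▸ hx')
      · intro hy
        obtain ⟨x, hx⟩ := surj y
        have hx' : ‖x‖ ≤ R := by
          by_contra hx'
          simp only [hG, if_neg hx', smul_zero, add_zero] at hx
          subst hx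
          exact hx' (by simpa [B] using hy)
        exact ⟨x, by simpa [B] using hx', by simpa only [hG, if_pos hx'] using hx⟩
    have h6 := integral_image_eq_integral_abs_det_fderiv_smul (F := ℝ) μ
      (Metric.isClosed_closedBall (x := (0:E)) (ε := R)).measurableSet (f := fun x => x + t • g x)
      (f' := fun x => ContinuousLinearMap.id ℝ E + t • fderiv ℝ g x)
      (fun x _ => ((hasFDerivAt_id x).add ((gD x).hasFDerivAt.const_smul t)).hasFDerivWithinAt)
      (fun x hx y hy hxy => inj x y (by
        have hx' : ‖x‖ ≤ R := by simpa [B] using hx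
        have hy' : ‖y‖ ≤ R := by simpa [B] using hy
        simpa only [hG, if_pos hx', if_pos hy'] using hxy)) (fun _ => 1)
    change ∫ x in (fun x => x + t • g x) '' B, (1:ℝ) ∂μ = _ at h6
    rw [img] at h6
    rw [setIntegral_const, smul_eq_mul, mul_one] at h6
    rw [h6]
    refine setIntegral_congr_fun Metric.isClosed_closedBall.measurableSet fun x hx => ?_
    have := hkey (y := t) (by simpa [abs_of_pos ht] using hte) x hx
    simp [abs_of_pos this]
  let n := Module.finrank ℝ E
  set δ := min ε (1 / (2 * L)) with hδ
  have hδp : 0 < δ := by positivity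
  let v : ℕ → ℝ := fun i => δ / (i + 2)
  have vinj : InjOn v (Finset.range (n + 1) : Set ℕ) := by
    intro i _ j _ hij
    have hi : (0:ℝ) < i + 2 := by positivity
    have hj : (0:ℝ) < j + 2 := by positivity
    simp only [v] at hij
    rw [div_eq_div_iff hi.ne' hj.ne', mul_right_inj' hδp.ne'] at hij
    have : (i:ℝ) = j := by linarith
    exact_mod_cast this
  have vlt : ∀ i, 0 < v i ∧ v i < δ := fun i => ⟨by positivity, by
    simp only [v]; rw [div_lt_iff₀ (by positivity)]; nlinarith [(Nat.cast_nonneg i : (0:ℝ) ≤ i)]⟩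
  let b := (Module.finBasis ℝ E)
  have hint : ∀ A : E →L[ℝ] E, ∀ t : ℝ, (ContinuousLinearMap.id ℝ E + t • A).det =
      ∑ i ∈ Finset.range (n + 1), (Lagrange.basis (Finset.range (n + 1)) v i).eval t *
        (ContinuousLinearMap.id ℝ E + v i • A).det := by
    intro A t
    let M := LinearMap.toMatrix b b (A : E →ₗ[ℝ] E)
    let p : Polynomial ℝ := Matrix.det ((Polynomial.X : Polynomial ℝ) • M.map Polynomial.C +
      (1 : Matrix _ _ ℝ).map Polynomial.C)
    have hp : ∀ s, p.eval s = (ContinuousLinearMap.id ℝ E + s • A).det := by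
      intro s
      simp only [p, ContinuousLinearMap.det]
      rw [← LinearMap.det_toMatrix b, ← Polynomial.coe_evalRingHom, RingHom.map_det]
      congr 1
      ext i j
      have e1 : LinearMap.toMatrix b b ((ContinuousLinearMap.id ℝ E + s • A : E →L[ℝ] E) : E →ₗ[ℝ] E) = 1 + s • M := by
        rw [← LinearMap.toMatrix_id b]
        simp only [M, ← map_smul, ← map_add]
        rfl
      rw [e1, RingHom.mapMatrix_apply, Matrix.map_apply, Matrix.add_apply, Matrix.smul_apply, Matrix.map_apply,
        Matrix.map_apply, Matrix.add_apply, Matrix.smul_apply]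
      simp [add_comm]
      exact mul_comm _ _
    have hdeg : p.degree < (Finset.range (n + 1)).card := by
      refine lt_of_le_of_lt Polynomial.degree_le_natDegree ?_
      rw [Finset.card_range]
      have := Polynomial.natDegree_det_X_add_C_le M 1
      rw [Fintype.card_fin] at this
      exact_mod_cast Nat.lt_succ_of_le this
    have h7 := Lagrange.eq_interpolate vinj hdeg
    rw [Lagrange.interpolate_apply] at h7
    rw [← hp t]
    conv_lhs => rw [h7]
    rw [Polynomial.eval_finsetSum]
    refine Finset.sum_congr rfl fun i _ => ?_
    rw [Polynomial.eval_mul, Polynomial.eval_C, hp, mul_comm]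
  have hI1 : ∫ x in B, (ContinuousLinearMap.id ℝ E + (1:ℝ) • fderiv ℝ g x).det ∂μ = μ.real B := by
    simp_rw [hint _ 1]
    rw [integral_finsetSum]
    · simp_rw [integral_const_mul]
      have : ∀ i ∈ Finset.range (n + 1), (Lagrange.basis (Finset.range (n + 1)) v i).eval 1 *
          ∫ x in B, (ContinuousLinearMap.id ℝ E + v i • fderiv ℝ g x).det ∂μ =
          (Lagrange.basis (Finset.range (n + 1)) v i).eval 1 * μ.real B := by
        intro i _
        rw [vol (v i) (vlt i).1 ((vlt i).2.trans_le (min_le_left _ _)) ((vlt i).2.trans_le (min_le_right _ _))]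
      rw [Finset.sum_congr rfl this, ← Finset.sum_mul, ← Polynomial.eval_finsetSum,
        Lagrange.sum_basis vinj ⟨0, by simp⟩]
      simp
    · intro i _
      have hc : Continuous fun x => (ContinuousLinearMap.id ℝ E + v i • fderiv ℝ g x).det :=
        ContinuousLinearMap.continuous_det.comp (by fun_prop)
      exact Integrable.const_mul (hc.continuousOn.integrableOn_compact (isCompact_closedBall _ _)) _
  have hzero : ∀ x, (ContinuousLinearMap.id ℝ E + (1:ℝ) • fderiv ℝ g x).det = 0 := by
    intro x
    have hrd : HasFDerivAt r (ContinuousLinearMap.id ℝ E + (1:ℝ) • fderiv ℝ g x) x := by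
      have := (hasFDerivAt_id x).add (gD x).hasFDerivAt
      simpa [hg, one_smul, Function.comp_def, Pi.add_def] using this
    set A := ContinuousLinearMap.id ℝ E + (1:ℝ) • fderiv ℝ g x
    have hort : ∀ y, inner ℝ (r x) (A y) = 0 := by
      intro y
      have h8 := (hrd.inner ℝ hrd)
      have h9 : (fun t => inner ℝ (r t) (r t)) = fun _ => R ^ 2 := by
        ext t; rw [real_inner_self_eq_norm_sq, h1]
      rw [h9] at h8
      have := congrArg (fun l : E →L[ℝ] ℝ => l y) (h8.unique (hasFDerivAt_const _ _))
      simp [fderivInnerCLM_apply, real_inner_comm] at this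
      linarith
    by_contra hdet
    have hu : IsUnit (LinearMap.det (A : E →ₗ[ℝ] E)) := isUnit_iff_ne_zero.2 hdet
    have hs : Function.Surjective (A : E →ₗ[ℝ] E) :=
      (LinearEquiv.ofIsUnitDet (f := (A : E →ₗ[ℝ] E)) (v := b) (v' := b) (by rwa [LinearMap.det_toMatrix])).surjective
    obtain ⟨y, hy⟩ := hs (r x)
    have h10 := hort y
    have hy' : A y = r x := hy
    rw [hy', real_inner_self_eq_norm_sq, h1] at h10
    nlinarith
  simp_rw [hzero] at hI1
  have : 0 < μ.real B := by
    refine ENNReal.toReal_pos ?_ (isCompact_closedBall _ _).measure_lt_top.ne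
    exact (Metric.measure_closedBall_pos μ _ hR).ne'
  simp at hI1
  linarith

theorem brouwer {E : Type*} [NormedAddCommGroup E] [InnerProductSpace ℝ E] [FiniteDimensional ℝ E]
    (f : E → E) (hf : Continuous f) (R : ℝ) (hR : 0 < R) (h : ∀ x, ‖x‖ ≤ R → ‖f x‖ ≤ R) :
    ∃ x, ‖x‖ ≤ R ∧ f x = x := by
  set pr : E → E := fun x => (R / max R ‖x‖) • x with hpr
  have hm : ∀ x : E, 0 < max R ‖x‖ := fun x => lt_max_of_lt_left hR
  have prc : Continuous pr := by
    refine Continuous.smul (continuous_const.div (by fun_prop) fun x => (hm x).ne') continuous_id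
  have prn : ∀ x, ‖pr x‖ ≤ R := by
    intro x
    rw [hpr, norm_smul, Real.norm_of_nonneg (div_nonneg hR.le (hm x).le), div_mul_eq_mul_div, div_le_iff₀ (hm x)]
    gcongr; exact le_max_right _ _
  have pri : ∀ x, ‖x‖ ≤ R → pr x = x := by
    intro x hx
    simp [hpr, max_eq_left hx, hR.ne']
  set F : E → E := fun x => f (pr x) with hF
  have Fc : Continuous F := hf.comp prc
  have Fn : ∀ x, ‖F x‖ ≤ R := fun x => h _ (prn x)
  have approx : ∀ ε : ℝ, 0 < ε → ε < 1 → ∃ x, ‖x‖ ≤ R + 1 ∧ ‖x - F x‖ ≤ ε := by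
    intro ε hε hε1
    obtain ⟨g, gC, hg, -⟩ := Fc.exists_contDiff_approx 1 (ε := fun _ => ε) continuous_const (fun _ => hε)
    let χ : ContDiffBump (0:E) := ⟨R + 1, R + 2, by linarith, by linarith⟩
    by_contra hcon
    push Not at hcon
    have gn : ∀ x, ‖g x‖ ≤ R + ε := fun x => by
      have h1 := hg x
      rw [dist_eq_norm] at h1
      have h2 := norm_le_norm_add_norm_sub (F x) (g x)
      rw [norm_sub_rev] at h2
      linarith [Fn x]
    have hne : ∀ x, x - χ x • g x ≠ 0 := by
      intro x hx
      have hx1 : x = χ x • g x := sub_eq_zero.1 hx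
      have hxn : ‖x‖ ≤ R + 1 := by
        rw [hx1, norm_smul, Real.norm_of_nonneg χ.nonneg]
        nlinarith [χ.le_one (x := x), χ.nonneg (x := x), gn x, norm_nonneg (g x)]
      have h1 : χ x = 1 := χ.one_of_mem_closedBall (by simpa [χ] using hxn)
      rw [h1, one_smul] at hx1
      have h3 := hcon x hxn
      conv at h3 => rhs; rw [hx1]
      have h4 := hg x
      rw [dist_eq_norm] at h4
      rw [← hx1] at h3
      rw [← hx1] at h4
      linarith
    have hC : ContDiff ℝ 1 fun x => x - χ x • g x := contDiff_id.sub (χ.contDiff.smul gC)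
    refine no_retr (fun x => ((R + 2) / ‖x - χ x • g x‖) • (x - χ x • g x)) ?_ (R + 2) (by linarith) ?_ ?_
    · exact (contDiff_const.div (hC.norm ℝ hne) fun x => norm_ne_zero_iff.2 (hne x)).smul hC
    · intro x
      rw [norm_smul, Real.norm_of_nonneg (by positivity), div_mul_cancel₀ _ (norm_ne_zero_iff.2 (hne x))]
    · intro x hx
      have h1 : χ x = 0 := χ.zero_of_le_dist (by simp [χ, hx])
      simp only [h1, zero_smul, sub_zero, hx]
      rw [div_self (by linarith), one_smul]
  obtain ⟨x, hxB, hmin⟩ := (isCompact_closedBall (0:E) (R + 1)).exists_isMinOn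
    ⟨0, by simp; linarith⟩ (f := fun x => ‖x - F x‖) (by fun_prop)
  have hx0 : ‖x - F x‖ ≤ 0 := by
    refine le_of_forall_pos_le_add fun ε hε => ?_
    obtain ⟨y, hy, hy2⟩ := approx (min ε (1/2)) (by positivity) ((min_le_right _ _).trans_lt (by norm_num))
    have := hmin (a := y) (by simpa using hy)
    have h3 : ‖x - F x‖ ≤ ‖y - F y‖ := this
    linarith [min_le_left ε (1/2)]
  have hx1 : x = F x := by rw [← sub_eq_zero, ← norm_le_zero_iff]; exact hx0
  have hx2 : ‖x‖ ≤ R := by rw [hx1]; exact Fn x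
  refine ⟨x, hx2, ?_⟩
  conv_rhs => rw [hx1]
  rw [hF]
  simp only [pri x hx2]

theorem ii_swap {E : Type*} [NormedAddCommGroup E] [NormedSpace ℝ E] (f : ℝ → ℝ → E) (a b c d : ℝ)
    (hab : a ≤ b) (hcd : c ≤ d)
    (hf : ContinuousOn (Function.uncurry f) (Icc a b ×ˢ Icc c d)) :
    ∫ x in a..b, ∫ y in c..d, f x y = ∫ y in c..d, ∫ x in a..b, f x y := by
  simp only [intervalIntegral.integral_of_le hab, intervalIntegral.integral_of_le hcd]
  apply integral_integral_swap
  rw [Measure.prod_restrict]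
  exact (hf.integrableOn_compact (isCompact_Icc.prod isCompact_Icc)).mono_set
    (prod_mono Ioc_subset_Icc_self Ioc_subset_Icc_self)

theorem cont_cm (z : ℂ) : Continuous fun p : ℝ × ℝ => circleMap z p.1 p.2 := by
  unfold circleMap; fun_prop

theorem cm_mem {z : ℂ} {t s θ : ℝ} (h0 : 0 ≤ t) (h : t ≤ s) :
    circleMap z t θ ∈ Metric.closedBall z s := by
  simp [circleMap, abs_of_nonneg h0, h]

theorem cm_cont_on {E : Type*} [TopologicalSpace E] {f : ℂ → E} {z : ℂ} {s : ℝ}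
    (hf : ContinuousOn f (Metric.closedBall z s)) (A : Set ℝ) :
    ContinuousOn (fun p : ℝ × ℝ => f (circleMap z p.1 p.2)) (Icc 0 s ×ˢ A) :=
  hf.comp (cont_cm z).continuousOn fun _ hp => cm_mem hp.1.1 hp.1.2

theorem ii_cont {E : Type*} [NormedAddCommGroup E] [NormedSpace ℝ E] (f : ℝ → ℝ → E) (a b c d : ℝ)
    (hcd : c ≤ d)
    (hf : ContinuousOn (Function.uncurry f) (Icc a b ×ˢ Icc c d)) :
    ContinuousOn (fun x => ∫ y in c..d, f x y) (Icc a b) := by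
  by_cases hab : a ≤ b
  swap
  · rw [Icc_eq_empty hab]; exact continuousOn_empty _
  have h1 : Continuous (Function.uncurry fun x y => f (projIcc a b hab x) (projIcc c d hcd y)) :=
    hf.comp_continuous (f := fun p : ℝ × ℝ => ((projIcc a b hab p.1 : ℝ), (projIcc c d hcd p.2 : ℝ)))
      (by fun_prop) fun p => ⟨Subtype.coe_prop _, Subtype.coe_prop _⟩
  refine (intervalIntegral.continuous_parametric_intervalIntegral_of_continuous'
    (μ := volume) h1 c d).continuousOn.congr
    fun x hx => ?_
  apply intervalIntegral.integral_congr
  intro y hy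
  rw [uIcc_of_le hcd] at hy
  simp [projIcc_of_mem hab hx, projIcc_of_mem hcd hy]

theorem polar_bridge (f : ℂ → ℝ) (z : ℂ) (s : ℝ) (hs : 0 ≤ s)
    (hf : ContinuousOn f (Metric.closedBall z s)) :
    ∫ y in Metric.closedBall z s, f y =
      ∫ t in (0:ℝ)..s, t * ∫ θ in (-Real.pi)..Real.pi, f (circleMap z t θ) := by
  have hpi := Real.pi_pos
  rw [← integral_indicator measurableSet_closedBall,
    ← integral_add_right_eq_self _ z, ← Complex.integral_comp_polarCoord_symm]
  have h1 : ∀ p ∈ polarCoord.target, p.1 • (Metric.closedBall z s).indicator f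
      (Complex.polarCoord.symm p + z) = (Iic s ×ˢ univ).indicator
        (fun p : ℝ × ℝ => p.1 * f (circleMap z p.1 p.2)) p := by
    rintro ⟨t, θ⟩ hp
    simp only [polarCoord_target, mem_prod, mem_Ioi, mem_Ioo] at hp
    have e : Complex.polarCoord.symm (t, θ) + z = circleMap z t θ := by
      rw [Complex.polarCoord_symm_apply, circleMap, Complex.exp_mul_I]; simp; ring
    rw [e]
    by_cases h : t ≤ s
    · rw [indicator_of_mem (cm_mem hp.1.le h), indicator_of_mem (by simp [h])]; simp
    · rw [indicator_of_notMem, indicator_of_notMem (by simpa using h)]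
      · simp
      · simp [circleMap, abs_of_pos hp.1]; linarith
  rw [setIntegral_congr_fun (by rw [polarCoord_target]; measurability) h1,
    setIntegral_indicator (by measurability), polarCoord_target, prod_inter_prod, inter_univ,
    Ioi_inter_Iic, Measure.volume_eq_prod, setIntegral_prod, intervalIntegral.integral_of_le hs]
  · congr 1; ext t
    rw [integral_const_mul, intervalIntegral.integral_of_le (by linarith), integral_Ioc_eq_integral_Ioo]
  · refine (ContinuousOn.integrableOn_compact (isCompact_Icc.prod isCompact_Icc)
      (continuousOn_fst.mul (cm_cont_on hf (Icc (-Real.pi) Real.pi)))).mono_set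
      (prod_mono Ioc_subset_Icc_self Ioo_subset_Icc_self)

theorem hd_e (p : ℝ × ℝ) : HasFDerivAt (fun p : ℝ × ℝ => Complex.exp (p.2 * Complex.I))
    ((ContinuousLinearMap.snd ℝ ℝ ℝ).smulRight (Complex.exp (p.2 * Complex.I) * Complex.I)) p := by
  have h := ((Complex.ofRealCLM.comp (ContinuousLinearMap.snd ℝ ℝ ℝ)).hasFDerivAt (x := p)).mul_const
    Complex.I |>.cexp
  refine h.congr_fderiv ?_
  ext <;> simp

theorem hd_cm (z : ℂ) (p : ℝ × ℝ) : HasFDerivAt (fun p : ℝ × ℝ => circleMap z p.1 p.2)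
    ((ContinuousLinearMap.fst ℝ ℝ ℝ).smulRight (Complex.exp (p.2 * Complex.I)) +
     (ContinuousLinearMap.snd ℝ ℝ ℝ).smulRight (p.1 * Complex.exp (p.2 * Complex.I) * Complex.I)) p := by
  have h := (((Complex.ofRealCLM.comp (ContinuousLinearMap.fst ℝ ℝ ℝ)).hasFDerivAt (x := p)).mul
    (hd_e p)).const_add z
  refine h.congr_fderiv ?_
  ext <;> simp [mul_assoc]

theorem clm_C (A : ℂ →L[ℝ] ℂ) (v : ℂ) : A v = v.re * A 1 + v.im * A Complex.I := by
  conv_lhs => rw [show v = v.re • (1:ℂ) + v.im • Complex.I by simp [Complex.re_add_im]]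
  rw [map_add, map_smul, map_smul]; simp

theorem rot_det (A B : ℂ →L[ℝ] ℂ) (θ : ℝ) :
    A (Complex.exp (θ * Complex.I)) * B (Complex.exp (θ * Complex.I) * Complex.I) -
    A (Complex.exp (θ * Complex.I) * Complex.I) * B (Complex.exp (θ * Complex.I)) =
    A 1 * B Complex.I - A Complex.I * B 1 := by
  rw [clm_C A (_ * _), clm_C B (_ * _), clm_C A (Complex.exp _), clm_C B (Complex.exp _)]
  simp only [Complex.mul_re, Complex.mul_im, Complex.I_re, Complex.I_im, Complex.exp_ofReal_mul_I_re,
    Complex.exp_ofReal_mul_I_im]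
  have h : ((Real.sin θ : ℝ) : ℂ) ^ 2 + ((Real.cos θ : ℝ) : ℂ) ^ 2 = 1 := by
    exact_mod_cast Real.sin_sq_add_cos_sq θ
  push_cast at h ⊢
  linear_combination (A 1 * B Complex.I - A Complex.I * B 1) * h

theorem green_polar (F H : ℂ → ℂ) (z : ℂ) (s : ℝ) (hs : 0 ≤ s)
    (hF : ∀ y ∈ Metric.closedBall z s, ContDiffAt ℝ 2 F y)
    (hH : ∀ y ∈ Metric.closedBall z s, ContDiffAt ℝ 2 H y) :
    ∫ t in (0:ℝ)..s, ∫ θ in (-Real.pi)..Real.pi, (t:ℂ) *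
      (fderiv ℝ F (circleMap z t θ) 1 * fderiv ℝ H (circleMap z t θ) Complex.I -
       fderiv ℝ F (circleMap z t θ) Complex.I * fderiv ℝ H (circleMap z t θ) 1) =
    ∫ θ in (-Real.pi)..Real.pi, F (circleMap z s θ) *
      fderiv ℝ H (circleMap z s θ) (s * Complex.exp (θ * Complex.I) * Complex.I) := by
  have hpi := Real.pi_pos
  set c : ℝ × ℝ → ℂ := fun p => circleMap z p.1 p.2 with hc
  set e : ℝ × ℝ → ℂ := fun p => Complex.exp (p.2 * Complex.I) with he
  set f : ℝ × ℝ → ℂ := fun p => F (c p) * fderiv ℝ H (c p) (p.1 * e p * Complex.I) with hf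
  set g : ℝ × ℝ → ℂ := fun p => - (F (c p) * fderiv ℝ H (c p) (e p)) with hg
  have hcF : ContinuousOn F (Metric.closedBall z s) := fun y hy => (hF y hy).continuousAt.continuousWithinAt
  have hcDF : ContinuousOn (fderiv ℝ F) (Metric.closedBall z s) := fun y hy =>
    ((hF y hy).fderiv_right (m := 1) (by norm_num)).continuousAt.continuousWithinAt
  have hcDH : ContinuousOn (fderiv ℝ H) (Metric.closedBall z s) := fun y hy =>
    ((hH y hy).fderiv_right (m := 1) (by norm_num)).continuousAt.continuousWithinAt
  have mem : ∀ p ∈ Icc 0 s ×ˢ Icc (-Real.pi) Real.pi, c p ∈ Metric.closedBall z s :=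
    fun p hp => cm_mem hp.1.1 hp.1.2
  have hec : Continuous e := by rw [he]; fun_prop
  have dF : ∀ p ∈ Icc 0 s ×ˢ Icc (-Real.pi) Real.pi, HasFDerivAt (fun p => F (c p)) _ p := fun p hp =>
    ((hF _ (mem p hp)).differentiableAt (by norm_num)).hasFDerivAt.comp p (hd_cm z p)
  have dDH : ∀ p ∈ Icc 0 s ×ˢ Icc (-Real.pi) Real.pi, HasFDerivAt (fun p => fderiv ℝ H (c p)) _ p := fun p hp =>
    (((hH _ (mem p hp)).fderiv_right (m := 1) (by norm_num)).differentiableAt (by norm_num)).hasFDerivAt.comp p (hd_cm z p)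
  have dte : ∀ p, HasFDerivAt (fun p : ℝ × ℝ => (p.1 : ℂ) * e p * Complex.I) _ p := fun p =>
    ((((Complex.ofRealCLM.comp (ContinuousLinearMap.fst ℝ ℝ ℝ)).hasFDerivAt (x := p)).mul
    (hd_e p))).mul_const Complex.I
  have df : ∀ p ∈ Icc 0 s ×ˢ Icc (-Real.pi) Real.pi, HasFDerivAt f _ p := fun p hp =>
    (dF p hp).mul ((dDH p hp).clm_apply (dte p))
  have dg : ∀ p ∈ Icc 0 s ×ˢ Icc (-Real.pi) Real.pi, HasFDerivAt g _ p := fun p hp =>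
    ((dF p hp).mul ((dDH p hp).clm_apply (hd_e p))).neg
  have key : ∀ p ∈ Icc 0 s ×ˢ Icc (-Real.pi) Real.pi, fderiv ℝ f p (1, 0) + fderiv ℝ g p (0, 1) =
      (p.1:ℂ) * (fderiv ℝ F (c p) 1 * fderiv ℝ H (c p) Complex.I -
       fderiv ℝ F (c p) Complex.I * fderiv ℝ H (c p) 1) := by
    intro p hp
    have hsym := ((hH _ (mem p hp)).isSymmSndFDerivAt (by simp)).eq (e p) ((p.1:ℂ) * (e p * Complex.I))
    have sm : ∀ (A : ℂ →L[ℝ] ℂ) (v : ℂ), A ((p.1:ℂ) * v) = p.1 * A v := fun A v => by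
      rw [← Complex.real_smul, map_smul, Complex.real_smul]
    rw [(df p hp).fderiv, (dg p hp).fderiv, ← rot_det _ _ p.2]
    simp [mul_assoc]
    rw [hsym, mul_comm Complex.I, sm, sm (fderiv ℝ F _)]
    ring
  have K := integral2_divergence_prod_of_hasFDerivAt f g (fderiv ℝ f) (fderiv ℝ g) 0 (-Real.pi) s Real.pi
  rw [uIcc_of_le hs, uIcc_of_le (by linarith), min_eq_left hs, min_eq_left (by linarith),
    max_eq_right hs, max_eq_right (by linarith)] at K
  have sub : Ioo 0 s ×ˢ Ioo (-Real.pi) Real.pi ⊆ Icc 0 s ×ˢ Icc (-Real.pi) Real.pi :=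
    prod_mono Ioo_subset_Icc_self Ioo_subset_Icc_self
  specialize K (fun p hp => (df p hp).continuousAt.continuousWithinAt)
    (fun p hp => (dg p hp).continuousAt.continuousWithinAt)
    (fun p hp => (df p (sub hp)).differentiableAt.hasFDerivAt)
    (fun p hp => (dg p (sub hp)).differentiableAt.hasFDerivAt)
    (by
      refine (ContinuousOn.integrableOn_compact (isCompact_Icc.prod isCompact_Icc) ?_)
      refine ContinuousOn.congr ?_ key
      have h1 := hcDF.comp (cont_cm z).continuousOn mem
      have h2 := hcDH.comp (cont_cm z).continuousOn mem
      refine ContinuousOn.mul (by fun_prop) (((h1.clm_apply continuousOn_const).mul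
        (h2.clm_apply continuousOn_const)).sub ((h1.clm_apply continuousOn_const).mul
        (h2.clm_apply continuousOn_const))))
  have e1 : ∀ x : ℝ, g (x, Real.pi) = g (x, -Real.pi) := by
    intro x
    have : Complex.exp ((Real.pi : ℂ) * Complex.I) = Complex.exp (((-Real.pi : ℝ) : ℂ) * Complex.I) := by
      push_cast
      rw [neg_mul, Complex.exp_neg, Complex.exp_pi_mul_I]; norm_num
    simp only [hg, hc, he, circleMap, this]
  have e2 : ∀ y : ℝ, f (0, y) = 0 := by intro y; simp [hf]
  simp only [e1, e2, sub_self, zero_add, intervalIntegral.integral_zero, sub_zero] at K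
  rw [← K]
  apply intervalIntegral.integral_congr
  intro t ht
  apply intervalIntegral.integral_congr
  intro θ hθ
  rw [uIcc_of_le hs] at ht
  rw [uIcc_of_le (by linarith)] at hθ
  exact (key (t, θ) ⟨ht, hθ⟩).symm

theorem ii_cs (h : ℝ → ℝ) (a b : ℝ) (hab : a ≤ b) (hh : ContinuousOn h (Icc a b)) :
    (∫ x in a..b, h x) ^ 2 ≤ (b - a) * ∫ x in a..b, h x ^ 2 := by
  rcases hab.eq_or_lt with rfl | hab'
  · simp
  have hi : IntervalIntegrable h volume a b := hh.intervalIntegrable_of_Icc hab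
  have hi2 : IntervalIntegrable (fun x => h x ^ 2) volume a b := (hh.pow 2).intervalIntegrable_of_Icc hab
  set m := (∫ x in a..b, h x) with hm
  have h0 : 0 ≤ ∫ x in a..b, ((b - a) * h x - m) ^ 2 :=
    intervalIntegral.integral_nonneg hab fun x _ => sq_nonneg _
  have e : ∀ x, ((b - a) * h x - m) ^ 2 = (b - a) ^ 2 * h x ^ 2 - 2 * (b - a) * m * h x + m ^ 2 := by
    intro x; ring
  simp only [e] at h0
  rw [intervalIntegral.integral_add ((hi2.const_mul _).sub (hi.const_mul _)) (by simp),
    intervalIntegral.integral_sub (hi2.const_mul _) (hi.const_mul _),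
    intervalIntegral.integral_const_mul, intervalIntegral.integral_const_mul, ← hm] at h0
  simp only [intervalIntegral.integral_const, smul_eq_mul] at h0
  have : 0 < b - a := by linarith
  by_contra hc
  push Not at hc
  nlinarith

def dz {E : Type*} [NormedAddCommGroup E] [NormedSpace ℂ E] (A : ℂ →L[ℝ] E) : E :=
  (1/2 : ℂ) • (A 1 - Complex.I • A Complex.I)
def db {E : Type*} [NormedAddCommGroup E] [NormedSpace ℂ E] (A : ℂ →L[ℝ] E) : E :=
  (1/2 : ℂ) • (A 1 + Complex.I • A Complex.I)

theorem dz_db {E : Type*} [NormedAddCommGroup E] [NormedSpace ℂ E] (A : ℂ →L[ℝ] E) (v : ℂ) :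
    A v = v • dz A + (starRingEnd ℂ v) • db A := by
  have h : A v = (v.re : ℂ) • A 1 + (v.im : ℂ) • A Complex.I := by
    conv_lhs => rw [show v = v.re • (1:ℂ) + v.im • Complex.I by simp [Complex.re_add_im]]
    rw [map_add, map_smul, map_smul, Complex.coe_smul, Complex.coe_smul]
  have e1 : v = v.re + v.im * Complex.I := (Complex.re_add_im v).symm
  have e2 : (starRingEnd ℂ v) = v.re - v.im * Complex.I := by
    apply Complex.ext <;> simp
  have key : ∀ (a b : ℂ) (X Y : E), a • X + b • Y = (a + b * Complex.I) • (1/2 : ℂ) • (X - Complex.I • Y) +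
      (a - b * Complex.I) • (1/2 : ℂ) • (X + Complex.I • Y) := by
    intro a b X Y
    match_scalars
    · ring
    · linear_combination b * Complex.I_sq
  rw [h, e2, key, ← e1]; rfl

theorem dz_cont {X E : Type*} [TopologicalSpace X] [NormedAddCommGroup E] [NormedSpace ℂ E] {A : X → ℂ →L[ℝ] E}
    {S : Set X} (hA : ContinuousOn A S) : ContinuousOn (fun x => dz (A x)) S ∧ ContinuousOn (fun x => db (A x)) S := by
  have h1 := hA.clm_apply (continuousOn_const (c := (1:ℂ)))
  have h2 := hA.clm_apply (continuousOn_const (c := Complex.I))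
  simp only [dz, db]
  exact ⟨(h1.sub (h2.const_smul Complex.I)).const_smul _, (h1.add (h2.const_smul Complex.I)).const_smul _⟩

theorem norm_le_dz_db {E : Type*} [NormedAddCommGroup E] [NormedSpace ℂ E] (A : ℂ →L[ℝ] E) (v : ℂ) :
    ‖A v‖ ≤ ‖v‖ * (‖dz A‖ + ‖db A‖) := by
  rw [dz_db]
  refine (norm_add_le _ _).trans ?_
  simp [norm_smul, mul_add]

theorem hasDeriv_circ {E : Type*} [NormedAddCommGroup E] [NormedSpace ℝ E] {f : ℂ → E} {z : ℂ} {s θ : ℝ}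
    (hf : DifferentiableAt ℝ f (circleMap z s θ)) :
    HasDerivAt (fun θ => f (circleMap z s θ))
      (fderiv ℝ f (circleMap z s θ) (s * Complex.exp (θ * Complex.I) * Complex.I)) θ := by
  have := hf.hasFDerivAt.comp_hasDerivAt θ (hasDerivAt_circleMap z s θ)
  simpa [circleMap, Function.comp_def] using this

theorem hasDeriv_rad {E : Type*} [NormedAddCommGroup E] [NormedSpace ℝ E] {f : ℂ → E} {z : ℂ} {s θ : ℝ}
    (hf : DifferentiableAt ℝ f (circleMap z s θ)) :
    HasDerivAt (fun s => f (circleMap z s θ))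
      (fderiv ℝ f (circleMap z s θ) (Complex.exp (θ * Complex.I))) s := by
  have h : HasDerivAt (fun s : ℝ => circleMap z s θ) (Complex.exp (θ * Complex.I)) s := by
    have := ((Complex.ofRealCLM.hasDerivAt (x := s)).mul_const (Complex.exp (θ * Complex.I))).const_add z
    simpa [circleMap] using this
  exact hf.hasFDerivAt.comp_hasDerivAt s h

theorem cm_pi (z : ℂ) (s : ℝ) : circleMap z s Real.pi = circleMap z s (-Real.pi) := by
  simp only [circleMap]
  push_cast
  rw [neg_mul, Complex.exp_neg, Complex.exp_pi_mul_I]; norm_num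

theorem energy1 (f : ℂ → ℂ) (hf : ContDiff ℝ 2 f) (z : ℂ) (s : ℝ) (hs : 0 ≤ s) :
    ∫ t in (0:ℝ)..s, t * ∫ θ in (-Real.pi)..Real.pi,
      (‖dz (fderiv ℝ f (circleMap z t θ))‖ ^ 2 - ‖db (fderiv ℝ f (circleMap z t θ))‖ ^ 2) ≤
    2 * Real.pi * s ^ 2 * ∫ θ in (-Real.pi)..Real.pi,
      (‖dz (fderiv ℝ f (circleMap z s θ))‖ ^ 2 + ‖db (fderiv ℝ f (circleMap z s θ))‖ ^ 2) := by
  have hpi := Real.pi_pos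
  have hpi' : -Real.pi ≤ Real.pi := by linarith
  have hD : Continuous (fderiv ℝ f) := hf.continuous_fderiv (by norm_num)
  have hd : Differentiable ℝ f := hf.differentiable (by norm_num)
  have hconj : ContDiff ℝ 2 (fun y => (starRingEnd ℂ) (f y)) := Complex.conjCLE.contDiff.comp hf
  have G := green_polar (fun y => (starRingEnd ℂ) (f y)) f z s hs (fun y _ => hconj.contDiffAt)
    (fun y _ => hf.contDiffAt)
  have hcj : ∀ y v, fderiv ℝ (fun y => (starRingEnd ℂ) (f y)) y v = (starRingEnd ℂ) (fderiv ℝ f y v) := by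
    intro y v
    have := (Complex.conjCLE.toContinuousLinearMap.hasFDerivAt.comp y (hd y).hasFDerivAt).fderiv
    exact congrArg (fun L : ℂ →L[ℝ] ℂ => L v) this
  simp only [hcj] at G
  set φ' : ℝ → ℂ := fun θ => fderiv ℝ f (circleMap z s θ) (s * Complex.exp (θ * Complex.I) * Complex.I) with hφ'
  set φ : ℝ → ℂ := fun θ => f (circleMap z s θ) with hφ
  have hder : ∀ θ, HasDerivAt φ (φ' θ) θ := fun θ => hasDeriv_circ (hd _)
  have hφc : Continuous φ := hd.continuous.comp (continuous_circleMap z s)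
  have hφ'c : Continuous φ' := by
    have := hD.comp (continuous_circleMap z s)
    exact this.clm_apply (by fun_prop)
  have hint0 : ∀ a b, ∫ θ in a..b, φ' θ = φ b - φ a := fun a b =>
    intervalIntegral.integral_eq_sub_of_hasDerivAt (fun x _ => hder x) (hφ'c.intervalIntegrable _ _)
  set Ln := ∫ θ in (-Real.pi)..Real.pi, ‖φ' θ‖ with hLn
  have hosc : ∀ θ ∈ Icc (-Real.pi) Real.pi, ‖φ θ - φ (-Real.pi)‖ ≤ Ln := by
    intro θ hθ
    rw [← hint0]
    refine (intervalIntegral.norm_integral_le_integral_norm hθ.1).trans ?_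
    exact intervalIntegral.integral_mono_interval le_rfl hθ.1 hθ.2
      (Eventually.of_forall fun x => norm_nonneg _) (hφ'c.norm.intervalIntegrable _ _)
  have hb : ‖∫ θ in (-Real.pi)..Real.pi, (starRingEnd ℂ) (φ θ) * φ' θ‖ ≤ Ln ^ 2 := by
    have e : ∫ θ in (-Real.pi)..Real.pi, (starRingEnd ℂ) (φ θ) * φ' θ =
        ∫ θ in (-Real.pi)..Real.pi, (starRingEnd ℂ) (φ θ - φ (-Real.pi)) * φ' θ := by
      simp only [map_sub, sub_mul]
      rw [intervalIntegral.integral_sub, intervalIntegral.integral_const_mul, hint0]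
      · simp [hφ, cm_pi]
      · exact ((Complex.continuous_conj.comp hφc).mul hφ'c).intervalIntegrable _ _
      · exact (continuous_const.mul hφ'c).intervalIntegrable _ _
    rw [e]
    refine (intervalIntegral.norm_integral_le_integral_norm hpi').trans ?_
    have : ∫ θ in (-Real.pi)..Real.pi, Ln * ‖φ' θ‖ = Ln ^ 2 := by
      rw [intervalIntegral.integral_const_mul, ← hLn]; ring
    rw [← this]
    refine intervalIntegral.integral_mono_on hpi' ?_ ((continuous_const.mul hφ'c.norm).intervalIntegrable _ _) ?_
    · exact (((Complex.continuous_conj.comp (hφc.sub continuous_const)).mul hφ'c).norm).intervalIntegrable _ _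
    · intro θ hθ
      rw [norm_mul, RCLike.norm_conj]
      exact mul_le_mul_of_nonneg_right (hosc θ hθ) (norm_nonneg _)
  have hL2 : Ln ^ 2 ≤ 2 * (2 * Real.pi * s ^ 2 * ∫ θ in (-Real.pi)..Real.pi,
      (‖dz (fderiv ℝ f (circleMap z s θ))‖ ^ 2 + ‖db (fderiv ℝ f (circleMap z s θ))‖ ^ 2)) := by
    refine (ii_cs _ _ _ hpi' hφ'c.norm.continuousOn).trans ?_
    rw [← intervalIntegral.integral_const_mul, ← intervalIntegral.integral_const_mul,
      ← intervalIntegral.integral_const_mul]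
    have hDs := hD.comp (continuous_circleMap z s)
    refine intervalIntegral.integral_mono_on hpi' ?_ ?_ ?_
    · exact (continuous_const.mul (hφ'c.norm.pow 2)).intervalIntegrable _ _
    · refine Continuous.intervalIntegrable ?_ _ _
      have hh := dz_cont hDs.continuousOn (S := univ)
      rw [← continuousOn_univ]
      exact continuousOn_const.mul (continuousOn_const.mul ((hh.1.norm.pow 2).add (hh.2.norm.pow 2)))
    · intro θ hθ
      have h1 := norm_le_dz_db (fderiv ℝ f (circleMap z s θ)) (s * Complex.exp (θ * Complex.I) * Complex.I)
      simp only [norm_mul, Complex.norm_exp_ofReal_mul_I, Complex.norm_I, mul_one, Complex.norm_real, Real.norm_eq_abs, abs_of_nonneg hs] at h1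
      change ‖φ' θ‖ ≤ _ at h1
      have h2 : ‖φ' θ‖ ^ 2 ≤ (s * (‖dz (fderiv ℝ f (circleMap z s θ))‖ + ‖db (fderiv ℝ f (circleMap z s θ))‖)) ^ 2 :=
        pow_le_pow_left₀ (norm_nonneg _) h1 2
      have h3 : (‖dz (fderiv ℝ f (circleMap z s θ))‖ + ‖db (fderiv ℝ f (circleMap z s θ))‖) ^ 2 ≤
        2 * (‖dz (fderiv ℝ f (circleMap z s θ))‖ ^ 2 + ‖db (fderiv ℝ f (circleMap z s θ))‖ ^ 2) := add_sq_le
      rw [mul_pow] at h2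
      have h4 := mul_le_mul_of_nonneg_left h3 (sq_nonneg s)
      have := mul_le_mul_of_nonneg_left (h2.trans h4) (by linarith : 0 ≤ 2 * Real.pi)
      linarith
  have hL : ∫ t in (0:ℝ)..s, t * ∫ θ in (-Real.pi)..Real.pi,
      (‖dz (fderiv ℝ f (circleMap z t θ))‖ ^ 2 - ‖db (fderiv ℝ f (circleMap z t θ))‖ ^ 2) =
      (1/2) * (∫ θ in (-Real.pi)..Real.pi, (starRingEnd ℂ) (φ θ) * φ' θ).im := by
    rw [← G]
    have hDc : Continuous fun p : ℝ × ℝ => fderiv ℝ f (circleMap z p.1 p.2) := hD.comp (cont_cm z)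
    have h1 := hDc.clm_apply (continuous_const (y := (1:ℂ)))
    have h2 := hDc.clm_apply (continuous_const (y := Complex.I))
    have hc : Continuous fun p : ℝ × ℝ => (p.1 : ℂ) *
      ((starRingEnd ℂ) (fderiv ℝ f (circleMap z p.1 p.2) 1) * fderiv ℝ f (circleMap z p.1 p.2) Complex.I -
       (starRingEnd ℂ) (fderiv ℝ f (circleMap z p.1 p.2) Complex.I) * fderiv ℝ f (circleMap z p.1 p.2) 1) :=
      (Complex.continuous_ofReal.comp continuous_fst).mul (((Complex.continuous_conj.comp h1).mul h2).sub
        ((Complex.continuous_conj.comp h2).mul h1))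
    have hI := intervalIntegral.continuous_parametric_intervalIntegral_of_continuous' (μ := volume)
      (f := fun a b : ℝ => (a : ℂ) *
      ((starRingEnd ℂ) (fderiv ℝ f (circleMap z a b) 1) * fderiv ℝ f (circleMap z a b) Complex.I -
       (starRingEnd ℂ) (fderiv ℝ f (circleMap z a b) Complex.I) * fderiv ℝ f (circleMap z a b) 1))
      hc (-Real.pi) Real.pi
    have := Complex.imCLM.intervalIntegral_comp_comm (μ := volume) (hI.intervalIntegrable 0 s)
    simp only [Complex.imCLM_apply] at this
    rw [← this, ← intervalIntegral.integral_const_mul]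
    congr 1; ext t
    have := Complex.imCLM.intervalIntegral_comp_comm (μ := volume) ((hc.comp (Continuous.prodMk_right t)).intervalIntegrable (-Real.pi) Real.pi)
    simp only [Complex.imCLM_apply, Function.comp_def] at this
    rw [← this, ← intervalIntegral.integral_const_mul, ← intervalIntegral.integral_const_mul]
    congr 1; ext θ
    generalize fderiv ℝ f (circleMap z t θ) = A
    simp only [dz, db, ← Complex.normSq_eq_norm_sq, Complex.normSq_apply, smul_eq_mul]
    simp
    ring
  rw [hL]
  have h5 := (Complex.abs_im_le_norm _).trans hb
  have h6 := le_abs_self (∫ θ in (-Real.pi)..Real.pi, (starRingEnd ℂ) (φ θ) * φ' θ).im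
  linarith

def Pot (b : ℂ → ℝ) (z : ℂ) (s : ℝ) : ℝ :=
  ∫ t in (0:ℝ)..s, ∫ θ in (-Real.pi)..Real.pi, b (circleMap z t θ)

theorem circ_cont {f : ℂ → ℝ} {z : ℂ} {s : ℝ} (hf : ContinuousOn f (Metric.closedBall z s)) :
    ContinuousOn (fun t => ∫ θ in (-Real.pi)..Real.pi, f (circleMap z t θ)) (Icc 0 s) :=
  ii_cont _ 0 s _ _ (by linarith [Real.pi_pos]) (cm_cont_on hf _)

theorem circ_ii {E : Type*} [NormedAddCommGroup E] {f : ℂ → E} {z : ℂ} {s t : ℝ} (hf : ContinuousOn f (Metric.closedBall z s))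
    (h0 : 0 ≤ t) (hts : t ≤ s) :
    IntervalIntegrable (fun θ => f (circleMap z t θ)) volume (-Real.pi) Real.pi :=
  (hf.comp_continuous (continuous_circleMap z t) fun _ => cm_mem h0 hts).intervalIntegrable _ _

theorem Pot_mono {b : ℂ → ℝ} {z : ℂ} {s t : ℝ} (hb : ContinuousOn b (Metric.closedBall z s))
    (hb0 : ∀ y ∈ Metric.closedBall z s, 0 ≤ b y) (h0 : 0 ≤ t) (hts : t ≤ s) : Pot b z t ≤ Pot b z s := by
  have hpi := Real.pi_pos
  refine intervalIntegral.integral_mono_interval le_rfl h0 hts ?_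
    ((circ_cont hb).intervalIntegrable_of_Icc (h0.trans hts))
  refine (ae_restrict_iff' measurableSet_Ioc).2 (Eventually.of_forall fun τ hτ => ?_)
  exact intervalIntegral.integral_nonneg (by linarith) fun θ _ => hb0 _ (cm_mem hτ.1.le hτ.2)

theorem disc_mean {f : ℂ → ℝ} {z : ℂ} {s L B : ℝ} (hs : 0 ≤ s)
    (hf : ContinuousOn f (Metric.closedBall z s))
    (h : ∀ t ∈ Ioc 0 s, |(∫ θ in (-Real.pi)..Real.pi, f (circleMap z t θ)) - 2 * Real.pi * L| ≤ B) :
    |(∫ y in Metric.closedBall z s, f y) - Real.pi * s ^ 2 * L| ≤ s ^ 2 / 2 * B := by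
  rw [polar_bridge f z s hs hf]
  have hc := circ_cont hf
  have e1 : Real.pi * s ^ 2 * L = ∫ t in (0:ℝ)..s, t * (2 * Real.pi * L) := by
    rw [intervalIntegral.integral_mul_const, integral_id]; ring
  have e2 : s ^ 2 / 2 * B = ∫ t in (0:ℝ)..s, t * B := by
    rw [intervalIntegral.integral_mul_const, integral_id]; ring
  rw [e1, e2, ← intervalIntegral.integral_sub]
  · rw [← Real.norm_eq_abs]
    refine intervalIntegral.norm_integral_le_of_norm_le hs ?_ (Continuous.intervalIntegrable (by fun_prop) _ _)
    refine Eventually.of_forall fun t ht => ?_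
    rw [← mul_sub, norm_mul, Real.norm_eq_abs, Real.norm_eq_abs, abs_of_pos ht.1]
    exact mul_le_mul_of_nonneg_left (h t ht) ht.1.le
  · exact (continuousOn_id.mul hc).intervalIntegrable_of_Icc hs
  · exact Continuous.intervalIntegrable (by fun_prop) _ _

theorem grad_mean {E : Type*} [NormedAddCommGroup E] [NormedSpace ℝ E] [CompleteSpace E] {U : ℂ → E} (hU : ContDiff ℝ 1 U) {G : ℂ → ℝ}
    (hG : Continuous G) (hUG : ∀ y, ‖fderiv ℝ U y‖ ≤ G y) (z : ℂ) {s : ℝ} (hs : 0 ≤ s) :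
    ∫ y in Metric.closedBall z s, ‖U y - U z‖ ≤ s ^ 2 / 2 * Pot G z s := by
  have hpi := Real.pi_pos
  have hpi' : -Real.pi ≤ Real.pi := by linarith
  have hd := hU.differentiable (by norm_num)
  have hD := hU.continuous_fderiv (by norm_num)
  have hL : ContinuousOn (fun y => ‖U y - U z‖) (Metric.closedBall z s) := by
    have := hU.continuous; fun_prop
  have K := disc_mean (L := 0) (B := Pot G z s) hs hL (by
    intro t ht
    have h0 : 0 ≤ ∫ θ in (-Real.pi)..Real.pi, ‖U (circleMap z t θ) - U z‖ :=
      intervalIntegral.integral_nonneg hpi' fun _ _ => norm_nonneg _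
    rw [mul_zero, sub_zero, abs_of_nonneg h0]
    refine le_trans ?_ (Pot_mono hG.continuousOn (fun y _ => (norm_nonneg _).trans (hUG y)) ht.1.le ht.2)
    rw [Pot, ii_swap (fun t θ => G (circleMap z t θ)) _ _ _ _ ht.1.le hpi' (hG.comp (cont_cm z)).continuousOn]
    refine intervalIntegral.integral_mono_on hpi' (circ_ii hL ht.1.le ht.2) ?_ ?_
    · refine Continuous.intervalIntegrable ?_ _ _
      exact intervalIntegral.continuous_parametric_intervalIntegral_of_continuous' (μ := volume) (f := fun θ τ => G (circleMap z τ θ))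
        (hG.comp ((cont_cm z).comp continuous_swap)) 0 t
    · intro θ _
      have h1 : ∀ τ, HasDerivAt (fun s => U (circleMap z s θ)) _ τ := fun τ => hasDeriv_rad (hd _)
      have hcc : Continuous fun τ : ℝ => circleMap z τ θ := by unfold circleMap; fun_prop
      have h2 := intervalIntegral.integral_eq_sub_of_hasDerivAt (a := 0) (b := t) (fun x _ => h1 x)
        (((hD.comp hcc).clm_apply continuous_const).intervalIntegrable _ _)
      rw [show circleMap z 0 θ = z by simp [circleMap]] at h2
      rw [← h2]
      refine intervalIntegral.norm_integral_le_of_norm_le ht.1.le (Eventually.of_forall fun τ _ => ?_)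
        ((hG.comp hcc).intervalIntegrable _ _)
      refine (ContinuousLinearMap.le_opNorm _ _).trans ?_
      simpa using hUG _)
  rw [mul_zero, sub_zero] at K
  exact (le_abs_self _).trans K

theorem hasDeriv_lognorm {φ : ℝ → ℂ} {φ' : ℂ} {t : ℝ} (h : HasDerivAt φ φ' t) (h0 : φ t ≠ 0) :
    HasDerivAt (fun t => Real.log ‖φ t‖) ((φ t)⁻¹ * φ').re t := by
  have h1 := (h.norm_sq.log (by positivity)).const_mul (1/2 : ℝ)
  have e : (fun t => Real.log ‖φ t‖) = fun t => (1/2 : ℝ) * Real.log (‖φ t‖ ^ 2) := by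
    ext t; rw [Real.log_pow]; push_cast; ring
  rw [e]
  refine h1.congr_deriv ?_
  rw [Complex.inv_def, ← Complex.normSq_eq_norm_sq]
  have : Complex.normSq (φ t) ≠ 0 := by simpa using h0
  simp [Complex.inner]
  field_simp

theorem log_mean {w : ℂ → ℂ} {b : ℂ → ℝ} {z : ℂ} {s : ℝ} (hs : 0 ≤ s)
    (hw : ∀ y ∈ Metric.closedBall z s, ContDiffAt ℝ 2 w y)
    (hw0 : ∀ y ∈ Metric.closedBall z s, w y ≠ 0)
    (hb : ContinuousOn b (Metric.closedBall z s))
    (hwb : ∀ y ∈ Metric.closedBall z s, ‖db (fderiv ℝ w y)‖ ≤ ‖w y‖ * b y) :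
    |(∫ y in Metric.closedBall z s, Real.log ‖w y‖) - Real.pi * s ^ 2 * Real.log ‖w z‖| ≤
      s ^ 2 * Pot b z s := by
  have hpi := Real.pi_pos
  have hpi' : -Real.pi ≤ Real.pi := by linarith
  have hwc : ContinuousOn w (Metric.closedBall z s) := fun y hy => (hw y hy).continuousAt.continuousWithinAt
  have hcD : ContinuousOn (fderiv ℝ w) (Metric.closedBall z s) := fun y hy =>
    ((hw y hy).fderiv_right (m := 1) (by norm_num)).continuousAt.continuousWithinAt
  have hL : ContinuousOn (fun y => Real.log ‖w y‖) (Metric.closedBall z s) :=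
    hwc.norm.log fun y hy => by simpa using hw0 y hy
  have hb0 : ∀ y ∈ Metric.closedBall z s, 0 ≤ b y := fun y hy => by
    have := (norm_nonneg _).trans (hwb y hy)
    exact nonneg_of_mul_nonneg_right this (by simpa using hw0 y hy)
  set N : ℝ → ℝ → ℂ := fun t θ => (w (circleMap z t θ))⁻¹ *
    fderiv ℝ w (circleMap z t θ) (Complex.exp (θ * Complex.I)) with hN
  have hNc : ∀ t ≤ s, ContinuousOn (Function.uncurry N) (Icc 0 t ×ˢ Icc (-Real.pi) Real.pi) := fun t ht => by
    have sub := Metric.closedBall_subset_closedBall (x := z) ht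
    refine ContinuousOn.mul ((cm_cont_on (hwc.mono sub) _).inv₀ fun p hp => hw0 _ (sub (cm_mem hp.1.1 hp.1.2))) ?_
    exact (cm_cont_on (hcD.mono sub) _).clm_apply (by fun_prop)
  have hNb : ∀ t ∈ Ioc 0 s, ‖∫ θ in (-Real.pi)..Real.pi, N t θ‖ ≤
      2 * ∫ θ in (-Real.pi)..Real.pi, b (circleMap z t θ) := by
    intro t ht
    have sub := Metric.closedBall_subset_closedBall (x := z) ht.2
    have G := green_polar (fun y => (w y)⁻¹) w z t ht.1.le (fun y hy => (hw y (sub hy)).inv (hw0 y (sub hy)))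
      (fun y hy => hw y (sub hy))
    have hz : ∫ θ in (-Real.pi)..Real.pi, (w (circleMap z t θ))⁻¹ *
      fderiv ℝ w (circleMap z t θ) (t * Complex.exp (θ * Complex.I) * Complex.I) = 0 := by
      rw [← G]
      have : ∀ τ ∈ uIcc 0 t, (∫ θ in (-Real.pi)..Real.pi, (τ:ℂ) *
      (fderiv ℝ (fun y => (w y)⁻¹) (circleMap z τ θ) 1 * fderiv ℝ w (circleMap z τ θ) Complex.I -
       fderiv ℝ (fun y => (w y)⁻¹) (circleMap z τ θ) Complex.I * fderiv ℝ w (circleMap z τ θ) 1)) = 0 := by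
        intro τ hτ
        rw [uIcc_of_le ht.1.le] at hτ
        rw [← intervalIntegral.integral_zero (a := -Real.pi) (b := Real.pi) (μ := volume)]
        congr 1; ext θ
        have hm := sub (cm_mem (z := z) (θ := θ) hτ.1 hτ.2)
        have hfd : HasFDerivAt (fun y => (w y)⁻¹) _ _ := ((hasDerivAt_inv (hw0 _ hm)).hasFDerivAt.restrictScalars ℝ).comp _
          ((hw _ hm).differentiableAt (by norm_num)).hasFDerivAt
        rw [hfd.fderiv]
        simp
        right; ring
      rw [intervalIntegral.integral_congr this]; simp
    have hval : ∀ θ, N t θ = (w (circleMap z t θ))⁻¹ * (2 * (starRingEnd ℂ) (Complex.exp (θ * Complex.I)) *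
        db (fderiv ℝ w (circleMap z t θ))) + (1 / (Complex.I * t)) * ((w (circleMap z t θ))⁻¹ *
      fderiv ℝ w (circleMap z t θ) (t * Complex.exp (θ * Complex.I) * Complex.I)) := by
      intro θ
      have ht0 : (t : ℂ) ≠ 0 := by exact_mod_cast ht.1.ne'
      simp only [hN]
      rw [dz_db, dz_db (fderiv ℝ w (circleMap z t θ)) (t * Complex.exp (θ * Complex.I) * Complex.I)]
      simp only [smul_eq_mul, map_mul, Complex.conj_I, Complex.conj_ofReal]
      field_simp
      ring
    have hdb := (dz_cont hcD).2
    have hce : Continuous fun θ : ℝ => (starRingEnd ℂ) (Complex.exp (θ * Complex.I)) :=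
      Complex.continuous_conj.comp (by fun_prop)
    have hcw : Continuous fun θ : ℝ => w (circleMap z t θ) :=
      hwc.comp_continuous (continuous_circleMap z t) fun _ => cm_mem ht.1.le ht.2
    have hcdb : Continuous fun θ : ℝ => db (fderiv ℝ w (circleMap z t θ)) :=
      hdb.comp_continuous (continuous_circleMap z t) fun _ => cm_mem ht.1.le ht.2
    have hcd : Continuous fun θ : ℝ => (fderiv ℝ w (circleMap z t θ)) :=
      hcD.comp_continuous (continuous_circleMap z t) fun _ => cm_mem ht.1.le ht.2
    have hcwi := hcw.inv₀ fun θ => hw0 _ (cm_mem ht.1.le ht.2)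
    simp only [hval]
    rw [intervalIntegral.integral_add, intervalIntegral.integral_const_mul, hz, mul_zero, add_zero,
      ← intervalIntegral.integral_const_mul]
    · refine intervalIntegral.norm_integral_le_of_norm_le hpi' (Eventually.of_forall fun θ _ => ?_)
        ((circ_ii hb ht.1.le ht.2).const_mul 2)
      have hm := (cm_mem (z := z) (θ := θ) ht.1.le ht.2)
      have h1 := hwb _ hm
      have h2 : 0 < ‖w (circleMap z t θ)‖ := by simpa using hw0 _ hm
      rw [norm_mul, norm_mul, norm_mul, RCLike.norm_conj, Complex.norm_exp_ofReal_mul_I, norm_inv]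
      simp only [Complex.norm_ofNat, mul_one]
      rw [inv_mul_le_iff₀ h2]; linarith
    · exact (hcwi.mul ((continuous_const.mul hce).mul hcdb)).intervalIntegrable _ _
    · exact (continuous_const.mul (hcwi.mul (hcd.clm_apply (by fun_prop)))).intervalIntegrable _ _
  have K := disc_mean (f := fun y => Real.log ‖w y‖) (L := Real.log ‖w z‖) (B := 2 * Pot b z s) hs hL (by
    intro t ht
    have e1 : (∫ θ in (-Real.pi)..Real.pi, Real.log ‖w (circleMap z t θ)‖) - 2 * Real.pi * Real.log ‖w z‖ =
        ∫ θ in (-Real.pi)..Real.pi, ∫ τ in (0:ℝ)..t, (N τ θ).re := by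
      have : 2 * Real.pi * Real.log ‖w z‖ = ∫ θ in (-Real.pi)..Real.pi, Real.log ‖w z‖ := by
        simp; left; ring
      rw [this, ← intervalIntegral.integral_sub (circ_ii hL ht.1.le ht.2) (by simp)]
      apply intervalIntegral.integral_congr
      intro θ hθ
      rw [uIcc_of_le hpi'] at hθ
      have hh := intervalIntegral.integral_eq_sub_of_hasDerivAt (a := 0) (b := t)
        (f := fun τ => Real.log ‖w (circleMap z τ θ)‖) (f' := fun τ => (N τ θ).re) (fun τ hτ => by
          rw [uIcc_of_le ht.1.le] at hτ
          have hm := (cm_mem (z := z) (θ := θ) hτ.1 (hτ.2.trans ht.2))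
          exact hasDeriv_lognorm (hasDeriv_rad ((hw _ hm).differentiableAt (by norm_num))) (hw0 _ hm)) (by
          refine ContinuousOn.intervalIntegrable_of_Icc ht.1.le ?_
          exact Complex.continuous_re.comp_continuousOn ((hNc t ht.2).comp (f := fun τ : ℝ => (τ, θ)) (by fun_prop)
            fun τ hτ => ⟨hτ, hθ⟩))
      rw [show circleMap z 0 θ = z by simp [circleMap]] at hh
      exact hh.symm
    have hre : ContinuousOn (Function.uncurry fun τ θ => (N τ θ).re) (Icc 0 t ×ˢ Icc (-Real.pi) Real.pi) :=
      Complex.continuous_re.comp_continuousOn (hNc t ht.2)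
    rw [e1, ← ii_swap _ _ _ _ _ ht.1.le hpi' hre, ← Real.norm_eq_abs]
    refine le_trans ?_ (mul_le_mul_of_nonneg_left (Pot_mono hb hb0 ht.1.le ht.2) (by norm_num : (0:ℝ) ≤ 2))
    rw [Pot, ← intervalIntegral.integral_const_mul]
    refine intervalIntegral.norm_integral_le_of_norm_le ht.1.le (Eventually.of_forall fun τ hτ => ?_)
      (((circ_cont hb).mono (Icc_subset_Icc_right ht.2)).intervalIntegrable_of_Icc ht.1.le |>.const_mul 2)
    have hτs : τ ∈ Ioc 0 s := ⟨hτ.1, hτ.2.trans ht.2⟩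
    refine le_trans ?_ (hNb τ hτs)
    have hNi : IntervalIntegrable (fun θ => N τ θ) volume (-Real.pi) Real.pi := by
      refine ContinuousOn.intervalIntegrable_of_Icc hpi' ?_
      exact (hNc s le_rfl).comp (f := fun θ : ℝ => (τ, θ)) (by fun_prop) fun θ hθ => ⟨⟨hτ.1.le, hτs.2⟩, hθ⟩
    have := Complex.reCLM.intervalIntegral_comp_comm hNi
    simp only [Complex.reCLM_apply] at this
    rw [this]; exact Complex.abs_re_le_norm _)
  rw [show s ^ 2 / 2 * (2 * Pot b z s) = s ^ 2 * Pot b z s by ring] at K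
  exact K

theorem vol_cb (z : ℂ) {s : ℝ} (hs : 0 ≤ s) : volume.real (Metric.closedBall z s) = Real.pi * s ^ 2 := by
  rw [measureReal_def, Complex.volume_closedBall]
  simp [hs]; ring

theorem modulus {E : Type*} [NormedAddCommGroup E] [NormedSpace ℝ E] [CompleteSpace E] {U : ℂ → E}
    (hU : ContDiff ℝ 1 U) {G : ℂ → ℝ}
    (hG : Continuous G) (hUG : ∀ y, ‖fderiv ℝ U y‖ ≤ G y) (x y : ℂ) :
    ‖U x - U y‖ ≤ Pot G y ‖x - y‖ + Pot G x (2 * ‖x - y‖) := by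
  have hpi := Real.pi_gt_three
  rcases eq_or_ne x y with rfl | hxy
  · simp [Pot]
  set d := ‖x - y‖ with hd
  have hd0 : 0 < d := by rw [hd]; exact norm_pos_iff.2 (sub_ne_zero.2 hxy)
  have h1 := grad_mean hU hG hUG y hd0.le
  have h2 := grad_mean hU hG hUG x (by positivity : 0 ≤ 2 * d)
  have hUc := hU.continuous
  have hi : ∀ c p r, IntegrableOn (fun p => ‖U p - U c‖) (Metric.closedBall p r) := fun c p r =>
    (Continuous.continuousOn (by fun_prop)).integrableOn_compact (isCompact_closedBall _ _)
  have sub : Metric.closedBall y d ⊆ Metric.closedBall x (2 * d) := by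
    apply Metric.closedBall_subset_closedBall'
    rw [dist_comm, dist_eq_norm]; linarith
  have h3 : ∫ p in Metric.closedBall y d, ‖U p - U x‖ ≤ ∫ p in Metric.closedBall x (2 * d), ‖U p - U x‖ :=
    setIntegral_mono_set (hi _ _ _) (Eventually.of_forall fun _ => norm_nonneg _) sub.eventuallyLE
  have h4 : ∫ p in Metric.closedBall y d, ‖U x - U y‖ ≤ ∫ p in Metric.closedBall y d, (‖U p - U y‖ + ‖U p - U x‖) := by
    refine setIntegral_mono (continuousOn_const.integrableOn_compact (isCompact_closedBall _ _)) ((hi _ _ _).add (hi _ _ _)) fun p => ?_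
    have := norm_sub_le (U p - U y) (U p - U x)
    simpa using this
  rw [integral_add (hi _ _ _) (hi _ _ _), setIntegral_const, smul_eq_mul, vol_cb _ hd0.le] at h4
  have h5 : Real.pi * d ^ 2 * ‖U x - U y‖ ≤ d ^ 2 * (1 / 2 * Pot G y d + 2 * Pot G x (2 * d)) := by nlinarith
  have h6 : Real.pi * ‖U x - U y‖ ≤ 1 / 2 * Pot G y d + 2 * Pot G x (2 * d) := by
    have := le_of_mul_le_mul_left (a := d ^ 2) (b := Real.pi * ‖U x - U y‖)
      (c := 1 / 2 * Pot G y d + 2 * Pot G x (2 * d)) (by linarith) (by positivity)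
    exact this
  have hP : ∀ c r, 0 ≤ r → 0 ≤ Pot G c r := fun c r hr => by
    have := Pot_mono (z := c) hG.continuousOn (fun y _ => (norm_nonneg _).trans (hUG y)) le_rfl hr
    simpa [Pot] using this
  nlinarith [norm_nonneg (U x - U y), hP y d hd0.le, hP x (2 * d) (by positivity)]

theorem harnack {w : ℂ → ℂ} {b : ℂ → ℝ} {z z0 : ℂ} {s B : ℝ} (hs : 0 < s)
    (hz : ‖z - z0‖ ≤ s / 2)
    (hw : ∀ y ∈ Metric.closedBall z s, ContDiffAt ℝ 2 w y)
    (hw0 : ∀ y ∈ Metric.closedBall z s, w y ≠ 0)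
    (hw1 : ∀ y ∈ Metric.closedBall z s, ‖w y‖ ≤ 1)
    (hb : Continuous b)
    (hwb : ∀ y ∈ Metric.closedBall z s, ‖db (fderiv ℝ w y)‖ ≤ ‖w y‖ * b y)
    (hB1 : Pot b z s ≤ B) (hB2 : Pot b z0 (s / 2) ≤ B) (hB : 0 ≤ B) :
    Real.log ‖w z‖ ≤ 1 / 4 * Real.log ‖w z0‖ + B := by
  have hpi := Real.pi_gt_three
  have sub : Metric.closedBall z0 (s / 2) ⊆ Metric.closedBall z s := by
    apply Metric.closedBall_subset_closedBall'
    rw [dist_comm, dist_eq_norm]; linarith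
  have h1 := log_mean hs.le hw hw0 hb.continuousOn hwb
  have h2 := log_mean (z := z0) (s := s / 2) (by linarith) (fun y hy => hw y (sub hy)) (fun y hy => hw0 y (sub hy))
    hb.continuousOn (fun y hy => hwb y (sub hy))
  have hL : ContinuousOn (fun y => Real.log ‖w y‖) (Metric.closedBall z s) :=
    (ContinuousOn.norm fun y hy => (hw y hy).continuousAt.continuousWithinAt).log fun y hy => by simpa using hw0 y hy
  have hi := hL.integrableOn_compact (μ := volume) (isCompact_closedBall z s)
  have h3 := setIntegral_mono_set hi.neg ((ae_restrict_iff' measurableSet_closedBall).2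
    (Eventually.of_forall fun y hy => by
      simpa using Real.log_nonpos (norm_nonneg _) (hw1 y hy))) sub.eventuallyLE
  simp only [Pi.neg_apply, integral_neg] at h3
  have h1' := (abs_le.1 h1).1
  have h2' := (abs_le.1 h2).2
  have h5 : s ^ 2 * Pot b z s ≤ s ^ 2 * B := mul_le_mul_of_nonneg_left hB1 (by positivity)
  have h6 : (s/2) ^ 2 * Pot b z0 (s/2) ≤ (s/2) ^ 2 * B := mul_le_mul_of_nonneg_left hB2 (by positivity)
  have h7 : s ^ 2 * (Real.pi * (Real.log ‖w z‖ - 1 / 4 * Real.log ‖w z0‖)) ≤ s ^ 2 * (5 / 4 * B) := by linarith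
  have h8 := le_of_mul_le_mul_left h7 (by positivity)
  by_contra hc
  push Not at hc
  nlinarith

theorem ode_cmp {Y Y' : ℝ → ℝ} {a c s : ℝ} (ha : 0 ≤ a) (hc : 0 < c) (hY : ∀ t ∈ Ioc 0 s, HasDerivAt Y (Y' t) t)
    (h : ∀ t ∈ Ioc 0 s, Y t - a ≤ c * t * Y' t) {t : ℝ} (ht : t ∈ Ioc 0 s) :
    Y t ≤ a + (t / s) ^ (1 / c) * Y s := by
  have hs : 0 < s := ht.1.trans_le ht.2
  have hder : ∀ x ∈ Icc t s, HasDerivAt (fun x => (Y x - a) * x ^ (-(1 / c)))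
      (Y' x * x ^ (-(1 / c)) + (Y x - a) * (-(1 / c) * x ^ (-(1 / c) - 1))) x := fun x hx => by
    have hx0 : 0 < x := ht.1.trans_le hx.1
    exact ((hY x ⟨hx0, hx.2⟩).sub_const a).mul (Real.hasDerivAt_rpow_const (Or.inl hx0.ne'))
  have mono : MonotoneOn (fun x => (Y x - a) * x ^ (-(1 / c))) (Icc t s) := by
    refine monotoneOn_of_deriv_nonneg (convex_Icc _ _) (fun x hx => (hder x hx).continuousAt.continuousWithinAt)
      (fun x hx => (hder x (interior_subset hx)).differentiableAt.differentiableWithinAt) fun x hx => ?_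
    have hx := interior_subset hx
    have hx0 : 0 < x := ht.1.trans_le hx.1
    rw [(hder x hx).deriv, Real.rpow_sub_one hx0.ne']
    have h1 := h x ⟨hx0, hx.2⟩
    have h2 : 0 < x ^ (-(1 / c)) := Real.rpow_pos_of_pos hx0 _
    have : Y' x * x ^ (-(1 / c)) + (Y x - a) * (-(1 / c) * (x ^ (-(1 / c)) / x)) =
      x ^ (-(1 / c)) / (c * x) * (c * x * Y' x - (Y x - a)) := by field_simp; ring
    rw [this]
    exact mul_nonneg (by positivity) (by linarith)
  have h1 := mono ⟨le_rfl, ht.2⟩ ⟨ht.2, le_rfl⟩ ht.2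
  simp only at h1
  rw [Real.rpow_neg ht.1.le, Real.rpow_neg hs.le, ← div_eq_mul_inv, ← div_eq_mul_inv,
    div_le_div_iff₀ (Real.rpow_pos_of_pos ht.1 _) (Real.rpow_pos_of_pos hs _)] at h1
  rw [Real.div_rpow ht.1.le hs.le, ← sub_le_iff_le_add', div_mul_eq_mul_div, le_div_iff₀ (Real.rpow_pos_of_pos hs _)]
  have := Real.rpow_pos_of_pos ht.1 (1 / c)
  nlinarith

theorem pot_1d {φ Φ : ℝ → ℝ} (hφ : Continuous φ) (hΦ : Continuous Φ) {s C α : ℝ} (hα : 0 < α) (hs : 0 < s)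
    (h1 : ∀ t ∈ Ioc 0 s, φ t ^ 2 ≤ 2 * Real.pi * Φ t)
    (h2 : ∀ t ∈ Ioc 0 s, ∫ τ in (0:ℝ)..t, τ * Φ τ ≤ C * t ^ (2 * α)) :
    ∫ t in (0:ℝ)..s, φ t ≤ (C + Real.pi / α) * s ^ α := by
  have hpi := Real.pi_pos
  set Y : ℝ → ℝ := fun t => ∫ τ in (0:ℝ)..t, τ * Φ τ with hY
  have dY : ∀ t, HasDerivAt Y (t * Φ t) t := fun t =>
    (continuous_id.mul hΦ).integral_hasStrictDerivAt 0 t |>.hasDerivAt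
  have dφ : ∀ t, HasDerivAt (fun t => ∫ τ in (0:ℝ)..t, φ τ) (φ t) t := fun t =>
    hφ.integral_hasStrictDerivAt 0 t |>.hasDerivAt
  set h : ℝ → ℝ := fun t => 1 / 2 * (t ^ (-α) * Y t + C * t ^ α) + Real.pi / α * t ^ α - ∫ τ in (0:ℝ)..t, φ τ with hh
  have hder : ∀ t, 0 < t → HasDerivAt h (1 / 2 * ((-α * t ^ (-α - 1)) * Y t + t ^ (-α) * (t * Φ t) +
     C * (α * t ^ (α - 1))) + Real.pi / α * (α * t ^ (α - 1)) - φ t) t := fun t ht =>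
    ((((Real.hasDerivAt_rpow_const (Or.inl ht.ne')).mul (dY t)).add
      ((Real.hasDerivAt_rpow_const (Or.inl ht.ne')).const_mul C)).const_mul (1/2)).add
      ((Real.hasDerivAt_rpow_const (Or.inl ht.ne')).const_mul _) |>.sub (dφ t)
  have mono : MonotoneOn h (Ioc 0 s) := by
    refine monotoneOn_of_deriv_nonneg (convex_Ioc _ _) (fun x hx => (hder x hx.1).continuousAt.continuousWithinAt)
      (fun x hx => (hder x (interior_subset hx).1).differentiableAt.differentiableWithinAt) fun t hx => ?_
    have hx := interior_subset hx
    have ht := hx.1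
    rw [(hder t ht).deriv]
    have a1 := h1 t hx
    have a2 : Y t ≤ C * t ^ (2 * α) := h2 t hx
    have e1 : t ^ (2 * α) = t ^ α * t ^ α := by rw [two_mul, Real.rpow_add ht]
    rw [Real.rpow_sub_one ht.ne', Real.rpow_sub_one ht.ne', Real.rpow_neg ht.le]
    set T := t ^ α with hT
    have hT0 : 0 < T := Real.rpow_pos_of_pos ht _
    rw [e1] at a2
    have b1 : T⁻¹ * Y t ≤ C * T := by rw [inv_mul_le_iff₀ hT0]; linarith
    have b2 : φ t ≤ 1 / 2 * (T⁻¹ * (t * Φ t)) + Real.pi * (T / t) := by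
      have hx : 0 < T / t := by positivity
      have : 1 / 2 * (T⁻¹ * (t * Φ t)) = Φ t / (2 * (T / t)) := by field_simp
      rw [this]
      have : φ t ^ 2 / (4 * Real.pi * (T / t)) ≤ Φ t / (2 * (T / t)) := by
        rw [div_le_div_iff₀ (by positivity) (by positivity)]; nlinarith
      have : φ t ≤ φ t ^ 2 / (4 * Real.pi * (T / t)) + Real.pi * (T / t) := by
        rw [← sub_nonneg]
        have : φ t ^ 2 / (4 * Real.pi * (T / t)) + Real.pi * (T / t) - φ t =
          (φ t - 2 * Real.pi * (T / t)) ^ 2 / (4 * Real.pi * (T / t)) := by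
          field_simp; ring
        rw [this]; positivity
      linarith
    have b3 : α * (T⁻¹ / t) * Y t ≤ C * (α * (T / t)) := by
      calc α * (T⁻¹ / t) * Y t = α / t * (T⁻¹ * Y t) := by field_simp
        _ ≤ α / t * (C * T) := mul_le_mul_of_nonneg_left b1 (by positivity)
        _ = _ := by field_simp
    have b4 : Real.pi / α * (α * (T / t)) = Real.pi * (T / t) := by field_simp
    rw [b4]; linarith
  have hlim : Tendsto (fun t => - ∫ τ in (0:ℝ)..t, φ τ) (𝓝[>] 0) (𝓝 0) := by
    have := ((dφ 0).continuousAt.neg).tendsto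
    simp only [Pi.neg_apply, intervalIntegral.integral_same, neg_zero] at this
    exact this.mono_left nhdsWithin_le_nhds
  have hpos : 0 ≤ h s := by
    refine le_of_tendsto hlim ?_
    filter_upwards [Ioc_mem_nhdsGT hs] with t ht
    refine le_trans ?_ (mono ht ⟨hs, le_rfl⟩ ht.2)
    have hY0 : 0 ≤ Y t := intervalIntegral.integral_nonneg ht.1.le fun τ hτ => by
      rcases hτ.1.eq_or_lt with h | h
      · simp [← h]
      · have := h1 τ ⟨h, hτ.2.trans ht.2⟩
        have : 0 ≤ Φ τ := by
          by_contra hc; push Not at hc; nlinarith [sq_nonneg (φ τ)]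
        positivity
    have hC : 0 ≤ C * t ^ α := by
      have := hY0.trans (h2 t ht)
      have hp := Real.rpow_pos_of_pos ht.1 (2 * α)
      have := nonneg_of_mul_nonneg_left this hp
      have hp := Real.rpow_pos_of_pos ht.1 α
      positivity
    have : 0 ≤ t ^ (-α) * Y t := mul_nonneg (Real.rpow_nonneg ht.1.le _) hY0
    have : 0 ≤ Real.pi / α * t ^ α := mul_nonneg (by positivity) (Real.rpow_nonneg ht.1.le _)
    simp only [hh]; linarith
  have hfin : s ^ (-α) * Y s ≤ C * s ^ α := by
    have hp := Real.rpow_pos_of_pos hs α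
    rw [Real.rpow_neg hs.le, inv_mul_le_iff₀ hp]
    have := h2 s ⟨hs, le_rfl⟩
    rw [two_mul, Real.rpow_add hs] at this
    linarith
  simp only [hh] at hpos
  linarith

theorem pot_bound {G : ℂ → ℝ} (hG : Continuous G) {z : ℂ} {s C α : ℝ} (hα : 0 < α) (hs : 0 < s)
    (h2 : ∀ t ∈ Ioc 0 s, ∫ y in Metric.closedBall z t, G y ^ 2 ≤ C * t ^ (2 * α)) :
    Pot G z s ≤ (C + Real.pi / α) * s ^ α := by
  have hpi := Real.pi_pos
  have hc : ∀ f : ℂ → ℝ, Continuous f → Continuous fun t => ∫ θ in (-Real.pi)..Real.pi, f (circleMap z t θ) :=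
    fun f hf => intervalIntegral.continuous_parametric_intervalIntegral_of_continuous' (μ := volume)
      (f := fun t θ => f (circleMap z t θ)) (hf.comp (cont_cm z)) _ _
  refine pot_1d (hc G hG) (hc (fun y => G y ^ 2) (hG.pow 2)) hα hs (fun t _ => ?_) fun t ht => ?_
  · have := ii_cs (fun θ => G (circleMap z t θ)) (-Real.pi) Real.pi (by linarith)
      (hG.comp (continuous_circleMap z t)).continuousOn
    simpa [two_mul] using this
  · rw [← polar_bridge (fun y => G y ^ 2) z t ht.1.le (hG.pow 2).continuousOn]; exact h2 t ht

def Sq : Set ℂ := Icc (-(1/2)) (1/2) ×ℂ Icc (-(1/2)) (1/2)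
abbrev mu : Measure ℂ := volume.restrict Sq

theorem Sq_compact : IsCompact Sq := isCompact_Icc.reProdIm isCompact_Icc

theorem mu_int {E : Type*} [NormedAddCommGroup E] {f : ℂ → E} (hf : Continuous f) : Integrable f mu :=
  hf.continuousOn.integrableOn_compact Sq_compact

theorem sq_iter {E : Type*} [NormedAddCommGroup E] [NormedSpace ℝ E] {f : ℂ → E} (hf : Continuous f) :
    ∫ z, f z ∂mu = ∫ x in (-(1/2):ℝ)..(1/2), ∫ y in (-(1/2):ℝ)..(1/2), f (x + y * Complex.I) := by
  have e := (Complex.volume_preserving_equiv_real_prod.symm).setIntegral_preimage_emb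
    (Complex.measurableEquivRealProd.symm.measurableEmbedding) f Sq
  rw [← e]
  have e2 : Complex.measurableEquivRealProd.symm ⁻¹' Sq = Icc (-(1/2):ℝ) (1/2) ×ˢ Icc (-(1/2):ℝ) (1/2) := by
    ext p; simp only [Sq, mem_preimage, Complex.mem_reProdIm, mem_prod]; rfl
  rw [e2, Measure.volume_eq_prod, setIntegral_prod]
  · simp only [intervalIntegral.integral_of_le (by norm_num : (-(1/2):ℝ) ≤ 1/2), integral_Icc_eq_integral_Ioc]
    congr 1; ext x; congr 1; ext y
    congr 1
    apply Complex.ext <;> simp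
  · refine Continuous.continuousOn ?_ |>.integrableOn_compact (isCompact_Icc.prod isCompact_Icc)
    exact hf.comp Complex.equivRealProdCLM.symm.continuous

def Per {E : Type*} (f : ℂ → E) : Prop := (∀ z, f (z + 1) = f z) ∧ ∀ z, f (z + Complex.I) = f z

theorem mu_trans {E : Type*} [NormedAddCommGroup E] [NormedSpace ℝ E] {f : ℂ → E} (hf : Continuous f)
    (hp : Per f) (a : ℂ) : ∫ z, f (z + a) ∂mu = ∫ z, f z ∂mu := by
  rw [sq_iter hf, sq_iter (by fun_prop)]
  have h1 : ∀ x : ℝ, ∫ y in (-(1/2):ℝ)..(1/2), f (x + y * Complex.I + a) =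
      ∫ y in (-(1/2):ℝ)..(1/2), f ((x + a.re : ℝ) + y * Complex.I) := by
    intro x
    have hper : Function.Periodic (fun y : ℝ => f ((x + a.re : ℝ) + y * Complex.I)) 1 := by
      intro y
      have := hp.2 ((x + a.re : ℝ) + y * Complex.I)
      simp only
      rw [← this]; congr 1; push_cast; ring
    have := hper.intervalIntegral_add_eq (-(1/2) + a.im) (-(1/2))
    rw [show (-(1/2) : ℝ) + 1 = 1/2 by norm_num, show (-(1/2) : ℝ) + a.im + 1 = 1/2 + a.im by ring] at this
    rw [← this, ← intervalIntegral.integral_comp_add_right]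
    congr 1; ext y; congr 1
    apply Complex.ext <;> simp
  simp only [h1]
  have hper : Function.Periodic (fun x : ℝ => ∫ y in (-(1/2):ℝ)..(1/2), f (x + y * Complex.I)) 1 := by
    intro x
    simp only
    congr 1; ext y
    rw [← hp.1 (x + y * Complex.I)]; congr 1; push_cast; ring
  have := hper.intervalIntegral_add_eq (-(1/2) + a.re) (-(1/2))
  rw [show (-(1/2) : ℝ) + 1 = 1/2 by norm_num, show (-(1/2) : ℝ) + a.re + 1 = 1/2 + a.re by ring] at this
  rw [← this, ← intervalIntegral.integral_comp_add_right]

theorem mu_prob : mu.real univ = 1 := by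
  have := sq_iter (f := fun _ => (1:ℝ)) continuous_const
  simp only [integral_const, smul_eq_mul, mul_one, intervalIntegral.integral_const] at this
  rw [this]; norm_num

instance : IsFiniteMeasure mu := ⟨by
  rw [Measure.restrict_apply_univ]; exact Sq_compact.measure_lt_top⟩

theorem ball_le_mu {f : ℂ → ℝ} (hf : Continuous f) (hp : Per f) (h0 : ∀ z, 0 ≤ f z) (z : ℂ) {s : ℝ} (hs : s ≤ 1/2) :
    ∫ y in Metric.closedBall z s, f y ≤ ∫ y, f y ∂mu := by
  rw [← mu_trans hf hp z]
  have e : ∫ y in Metric.closedBall z s, f y = ∫ y in Metric.closedBall 0 s, f (y + z) := by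
    have := (measurePreserving_add_right volume z).setIntegral_preimage_emb
      (MeasurableEquiv.addRight z).measurableEmbedding f (Metric.closedBall z s)
    rw [← this]
    congr 2
    ext y; simp [dist_eq_norm]
  rw [e]
  refine setIntegral_mono_set (mu_int (by fun_prop)) (Eventually.of_forall fun _ => h0 _)
    (HasSubset.Subset.eventuallyLE fun y hy => ?_)
  simp only [mem_closedBall_zero_iff] at hy
  have h1 := Complex.abs_re_le_norm y
  have h2 := Complex.abs_im_le_norm y
  simp only [Sq, Complex.mem_reProdIm, mem_Icc]
  rw [abs_le] at h1 h2
  refine ⟨⟨?_, ?_⟩, ?_, ?_⟩ <;> linarith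

def ek (k : ℤ × ℤ) (z : ℂ) : ℂ := Complex.exp ((2 * Real.pi * (k.1 * z.re + k.2 * z.im) : ℝ) * Complex.I)

theorem ek_cont (k : ℤ × ℤ) : Continuous (ek k) := by
  unfold ek; have := Complex.continuous_re; have := Complex.continuous_im; fun_prop
theorem ek_norm (k : ℤ × ℤ) (z : ℂ) : ‖ek k z‖ = 1 := Complex.norm_exp_ofReal_mul_I _
theorem ek_add (k : ℤ × ℤ) (z w : ℂ) : ek k (z + w) = ek k z * ek k w := by
  simp only [ek, ← Complex.exp_add]; congr 1; simp; ring
theorem ek_mul (k l : ℤ × ℤ) (z : ℂ) : ek k z * ek l z = ek (k + l) z := by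
  simp only [ek, ← Complex.exp_add]; congr 1; simp; ring
theorem ek_zero (z : ℂ) : ek 0 z = 1 := by simp [ek]
theorem ek_at0 (k : ℤ × ℤ) : ek k 0 = 1 := by simp [ek]
theorem ek_conj (k : ℤ × ℤ) (z : ℂ) : (starRingEnd ℂ) (ek k z) = ek (-k) z := by
  simp only [ek, ← Complex.exp_conj, map_mul, Complex.conj_ofReal, Complex.conj_I]; congr 1; push_cast [Prod.fst_neg, Prod.snd_neg]; ring
theorem ek_int (k : ℤ × ℤ) (n : ℤ) (x : ℝ) (h : x = n) : Complex.exp ((2 * Real.pi * x : ℝ) * Complex.I) = 1 := by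
  rw [Complex.exp_eq_one_iff]; exact ⟨n, by rw [h]; push_cast; ring⟩
theorem ek_per (k : ℤ × ℤ) : Per (ek k) := by
  constructor <;> intro z <;> rw [ek_add]
  · rw [show ek k 1 = 1 from ek_int k k.1 _ (by simp), mul_one]
  · rw [show ek k Complex.I = 1 from ek_int k k.2 _ (by simp), mul_one]

theorem ek_orth (k : ℤ × ℤ) : ∫ z, ek k z ∂mu = if k = 0 then 1 else 0 := by
  split_ifs with h
  · subst h; simp only [ek_zero, integral_const, mu_prob]; simp
  · have key : ∀ a, ek k a = -1 → ∫ z, ek k z ∂mu = 0 := by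
      intro a ha
      have := mu_trans (ek_cont k) (ek_per k) a
      simp only [ek_add, ha, mul_neg, mul_one, integral_neg] at this
      have h2 : (2:ℂ) * ∫ z, ek k z ∂mu = 0 := by linear_combination -this
      simpa using h2
    have hexp : ∀ x : ℝ, x = 1/2 → Complex.exp ((2 * Real.pi * x : ℝ) * Complex.I) = -1 := by
      intro x hx; rw [hx, show (2 * Real.pi * (1/2) : ℝ) = Real.pi by ring, Complex.exp_pi_mul_I]
    by_cases h1 : k.1 = 0
    · have h2 : k.2 ≠ 0 := fun h2 => h (Prod.ext h1 h2)
      have h2' : (k.2 : ℝ) ≠ 0 := by exact_mod_cast h2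
      apply key ((1 / (2 * k.2) : ℝ) * Complex.I)
      apply hexp
      simp [h1]; field_simp
    · have h2' : (k.1 : ℝ) ≠ 0 := by exact_mod_cast h1
      apply key ((1 / (2 * k.1) : ℝ))
      apply hexp
      simp only [Complex.ofReal_re, Complex.ofReal_im]; field_simp; ring

section
variable {V : Type*} [NormedAddCommGroup V] [InnerProductSpace ℂ V] [CompleteSpace V]

theorem bessel_id {F : ℂ → V} (hF : Continuous F) (S : Finset (ℤ × ℤ)) (a : ℤ × ℤ → V) :
    ∫ z, ‖F z - ∑ k ∈ S, ek k z • a k‖ ^ 2 ∂mu =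
     (∫ z, ‖F z‖ ^ 2 ∂mu) - 2 * (∑ k ∈ S, (inner ℂ (a k) (∫ z, ek (-k) z • F z ∂mu) : ℂ).re) + ∑ k ∈ S, ‖a k‖ ^ 2 := by
  have hc := ek_cont
  have e : ∀ z, ‖F z - ∑ k ∈ S, ek k z • a k‖ ^ 2 = ‖F z‖ ^ 2 -
      2 * (∑ k ∈ S, inner ℂ (a k) (ek (-k) z • F z)).re + (∑ k ∈ S, ∑ l ∈ S, ek (l - k) z * inner ℂ (a k) (a l)).re := by
    intro z
    have h1 := norm_sub_sq (𝕜 := ℂ) (F z) (∑ k ∈ S, ek k z • a k)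
    have h2 : ‖∑ k ∈ S, ek k z • a k‖ ^ 2 = (∑ k ∈ S, ∑ l ∈ S, ek (l - k) z * inner ℂ (a k) (a l)).re := by
      rw [← inner_self_eq_norm_sq (𝕜 := ℂ), sum_inner]
      simp only [inner_sum, inner_smul_left, inner_smul_right, ek_conj, ← mul_assoc]
      simp only [mul_comm (ek (-_) z), ek_mul, ← sub_eq_add_neg]; rfl
    rw [h1, h2, inner_re_symm, sum_inner]
    simp only [inner_smul_left, inner_smul_right, ek_conj]; rfl
  simp only [e]
  have i1 : Integrable (fun z => ‖F z‖ ^ 2) mu := mu_int (by fun_prop)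
  have i2 : ∀ k, Integrable (fun z => inner ℂ (a k) (ek (-k) z • F z)) mu := fun k => mu_int (by fun_prop)
  have i3 : ∀ k l, Integrable (fun z => ek (l - k) z * inner ℂ (a k) (a l)) mu := fun k l => mu_int (by fun_prop)
  have i2' := integrable_finsetSum S fun k _ => i2 k
  have i3' := integrable_finsetSum S fun k _ => integrable_finsetSum S fun l _ => i3 k l
  have i2r : Integrable (fun z => 2 * (∑ k ∈ S, inner ℂ (a k) (ek (-k) z • F z)).re) mu := i2'.re.const_mul 2
  have i3r : Integrable (fun z => (∑ k ∈ S, ∑ l ∈ S, ek (l - k) z * inner ℂ (a k) (a l)).re) mu := i3'.re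
  have i12 : Integrable (fun z => ‖F z‖ ^ 2 - 2 * (∑ k ∈ S, inner ℂ (a k) (ek (-k) z • F z)).re) mu := i1.sub i2r
  rw [integral_add i12 i3r, integral_sub i1 i2r, integral_const_mul]
  have r2 := integral_re i2'
  have r3 := integral_re i3'
  simp only [RCLike.re_eq_complex_re] at r2 r3
  rw [r2, r3, integral_finsetSum _ fun k _ => i2 k,
    integral_finsetSum _ fun k _ => integrable_finsetSum S fun l _ => i3 k l]
  congr 1
  · congr 2
    rw [Complex.re_sum]
    refine Finset.sum_congr rfl fun k _ => ?_
    rw [← integral_inner (mu_int (by fun_prop))]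
  · rw [Complex.re_sum]
    refine Finset.sum_congr rfl fun k hk => ?_
    rw [integral_finsetSum _ fun l _ => i3 k l]
    simp only [integral_mul_const, ek_orth, sub_eq_zero]
    rw [Finset.sum_eq_single k]
    · simp [inner_self_eq_norm_sq_to_K, ← Complex.ofReal_pow]
    · intro l _ hl; simp [hl]
    · intro h; exact absurd hk h

theorem parseval (S : Finset (ℤ × ℤ)) (a : ℤ × ℤ → V) :
    ∫ z, ‖∑ k ∈ S, ek k z • a k‖ ^ 2 ∂mu = ∑ k ∈ S, ‖a k‖ ^ 2 := by
  have := bessel_id (F := fun _ => (0:V)) continuous_const S a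
  simpa using this

theorem bessel {F : ℂ → V} (hF : Continuous F) (S : Finset (ℤ × ℤ)) :
    ∑ k ∈ S, ‖∫ z, ek (-k) z • F z ∂mu‖ ^ 2 ≤ ∫ z, ‖F z‖ ^ 2 ∂mu := by
  have h := bessel_id hF S fun k => ∫ z, ek (-k) z • F z ∂mu
  have h0 : 0 ≤ ∫ z, ‖F z - ∑ k ∈ S, ek k z • ∫ z, ek (-k) z • F z ∂mu‖ ^ 2 ∂mu :=
    integral_nonneg fun _ => sq_nonneg _
  have e : ∀ k, (inner ℂ (∫ z, ek (-k) z • F z ∂mu) (∫ z, ek (-k) z • F z ∂mu) : ℂ).re =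
      ‖∫ z, ek (-k) z • F z ∂mu‖ ^ 2 := fun k => by
    rw [← inner_self_eq_norm_sq (𝕜 := ℂ)]; rfl
  simp only [e] at h
  linarith
end

theorem swap_cpt {E : Type*} [NormedAddCommGroup E] [NormedSpace ℝ E] {A B : Set ℂ} (hA : IsCompact A) (hB : IsCompact B)
    (f : ℂ → ℂ → E) (hf : Continuous fun p : ℂ × ℂ => f p.1 p.2) :
    ∫ z in A, ∫ t in B, f z t = ∫ t in B, ∫ z in A, f z t := by
  apply integral_integral_swap
  rw [Measure.prod_restrict]
  exact hf.continuousOn.integrableOn_compact (hA.prod hB)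

theorem cs_mu {K a b : ℂ → ℝ} (hK : Continuous K) (ha : Continuous a) (hb : Continuous b) (h0 : ∀ z, 0 ≤ K z) :
    (∫ t, K t * (a t * b t) ∂mu) ^ 2 ≤ (∫ t, K t * a t ^ 2 ∂mu) * ∫ t, K t * b t ^ 2 ∂mu := by
  have h : ∀ x : ℝ, 0 ≤ (∫ t, K t * a t ^ 2 ∂mu) * (x * x) + (2 * ∫ t, K t * (a t * b t) ∂mu) * x + ∫ t, K t * b t ^ 2 ∂mu := by
    intro x
    have i1 : Integrable (fun t => K t * a t ^ 2) mu := mu_int (by fun_prop)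
    have i2 : Integrable (fun t => K t * (a t * b t)) mu := mu_int (by fun_prop)
    have i3 : Integrable (fun t => K t * b t ^ 2) mu := mu_int (by fun_prop)
    have i12 : Integrable (fun t => K t * a t ^ 2 * (x * x) + (2 * (K t * (a t * b t))) * x) mu := mu_int (by fun_prop)
    rw [← integral_const_mul, ← integral_mul_const, ← integral_mul_const, ← integral_add (by exact mu_int (by fun_prop)) (by exact mu_int (by fun_prop)),
      ← integral_add i12 i3]
    refine integral_nonneg fun t => ?_
    have := mul_nonneg (h0 t) (sq_nonneg (a t * x + b t))
    simp only [Pi.zero_apply]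
    linarith
  have := discrim_le_zero h
  unfold discrim at this
  linarith

structure Ker (K : ℂ → ℝ) : Prop where
  c : Continuous K
  n : ∀ z, 0 ≤ K z
  i : ∫ t, K t ∂mu = 1

section
variable {E : Type*} [NormedAddCommGroup E] [NormedSpace ℝ E]

theorem ker_jensen {K : ℂ → ℝ} (hK : Ker K) {f : ℂ → E} (hf : Continuous f) :
    ‖∫ t, K t • f t ∂mu‖ ^ 2 ≤ ∫ t, K t * ‖f t‖ ^ 2 ∂mu := by
  have h1 : ‖∫ t, K t • f t ∂mu‖ ≤ ∫ t, K t * (‖f t‖ * 1) ∂mu := by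
    refine (norm_integral_le_integral_norm _).trans_eq ?_
    congr 1; ext t; rw [norm_smul, Real.norm_of_nonneg (hK.n t), mul_one]
  have := cs_mu hK.c hf.norm (continuous_const (y := (1:ℝ))) hK.n
  simp only [one_pow, mul_one, hK.i] at this h1
  refine le_trans ?_ this
  gcongr

def cv (K : ℂ → ℝ) (f : ℂ → E) (z : ℂ) : E := ∫ t, K t • f (z + t) ∂mu

theorem cv_cont {K : ℂ → ℝ} (hK : Ker K) {f : ℂ → E} (hf : Continuous f) : Continuous (cv K f) := by
  have hc := hK.c
  unfold cv
  exact continuous_parametric_integral_of_continuous (f := fun z t => K t • f (z + t)) (by fun_prop) Sq_compact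

theorem cv_jensen {K : ℂ → ℝ} (hK : Ker K) {f : ℂ → E} (hf : Continuous f) (z : ℂ) :
    ‖cv K f z‖ ^ 2 ≤ cv K (fun z => ‖f z‖ ^ 2) z := ker_jensen hK (by fun_prop)

theorem cv_set {K : ℂ → ℝ} (hK : Ker K) {f : ℂ → E} (hf : Continuous f) {A : Set ℂ} (hA : IsCompact A) :
    ∫ z in A, cv K f z = ∫ t, (K t • ∫ z in A, f (z + t)) ∂mu := by
  have hc := hK.c
  unfold cv
  rw [swap_cpt hA Sq_compact (fun z t => K t • f (z + t)) (by fun_prop)]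
  simp only [integral_smul]

theorem cv_mu [CompleteSpace E] {K : ℂ → ℝ} (hK : Ker K) {f : ℂ → E} (hf : Continuous f) (hp : Per f) : ∫ z, cv K f z ∂mu = ∫ z, f z ∂mu := by
  rw [cv_set hK hf Sq_compact]
  have : ∀ t, ∫ z in Sq, f (z + t) = ∫ z, f z ∂mu := fun t => mu_trans hf hp t
  simp only [this]
  rw [integral_smul_const, hK.i, one_smul]

theorem cv_sup {K : ℂ → ℝ} {f : ℂ → ℝ} (hK : Ker K) (hf : Continuous f) (hp : Per f) (h0 : ∀ z, 0 ≤ f z) {B : ℝ} (hB : ∀ z ∈ Sq, K z ≤ B) (z : ℂ) :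
    cv K f z ≤ B * ∫ z, f z ∂mu := by
  have hc := hK.c
  rw [← mu_trans hf hp z, ← integral_const_mul]
  refine setIntegral_mono_on (mu_int (by fun_prop)) (mu_int (by fun_prop)) Sq_compact.measurableSet fun t ht => ?_
  rw [add_comm z, smul_eq_mul]
  exact mul_le_mul_of_nonneg_right (hB t ht) (h0 _)

theorem cv_nonneg {K : ℂ → ℝ} {f : ℂ → ℝ} (hK : Ker K) (h0 : ∀ z, 0 ≤ f z) (z : ℂ) : 0 ≤ cv K f z :=
  integral_nonneg fun t => mul_nonneg (hK.n t) (h0 _)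
end

def kk (K : ℂ → ℝ) (k : ℤ × ℤ) : ℂ := ∫ t, (K t : ℂ) * ek k t ∂mu
theorem kk_zero {K : ℂ → ℝ} (hK : Ker K) : kk K 0 = 1 := by
  simp only [kk, ek_zero, mul_one, integral_complex_ofReal, hK.i, Complex.ofReal_one]
theorem kk_le {K : ℂ → ℝ} (hK : Ker K) (k : ℤ × ℤ) : ‖kk K k‖ ≤ 1 := by
  refine (norm_integral_le_integral_norm _).trans_eq ?_
  rw [← hK.i]; congr 1; ext t; rw [norm_mul, ek_norm, Complex.norm_of_nonneg (hK.n t), mul_one]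

section
variable {V : Type*} [NormedAddCommGroup V] [InnerProductSpace ℂ V] [CompleteSpace V]

theorem cv_ek {K : ℂ → ℝ} (_hK : Ker K) (k : ℤ × ℤ) (a : V) (z : ℂ) :
    cv K (fun z => ek k z • a) z = (kk K k * ek k z) • a := by
  simp only [cv, kk, ek_add]
  have : ∀ t, K t • (ek k z * ek k t) • a = ((K t : ℂ) * ek k t) • (ek k z • a) := by
    intro t
    rw [← Complex.coe_smul (K t), smul_smul, smul_smul]; congr 1; ring
  simp only [this]
  rw [integral_smul_const, smul_smul]

theorem cv_poly {K : ℂ → ℝ} {S : Finset (ℤ × ℤ)} {κ : ℤ × ℤ → ℂ} (h : ∀ z, (K z : ℂ) = ∑ k ∈ S, κ k * ek (-k) z)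
    {F : ℂ → V} (hF : Continuous F) (hp : Per F) (z : ℂ) :
    cv K F z = ∑ k ∈ S, ek k z • κ k • ∫ t, ek (-k) t • F t ∂mu := by
  have hc := ek_cont
  have e : ∀ t, K t • F (z + t) = ∑ k ∈ S, (ek k z * κ k) • (ek (-k) (t + z) • F (t + z)) := by
    intro t
    rw [← Complex.coe_smul (K t), h, Finset.sum_smul, add_comm z t]
    refine Finset.sum_congr rfl fun k _ => ?_
    rw [smul_smul]; congr 1
    rw [ek_add (-k)]
    have : ek k z * ek (-k) z = 1 := by rw [ek_mul]; simp [ek_zero]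
    linear_combination -κ k * ek (-k) t * this
  simp only [cv, e]
  rw [integral_finsetSum _ fun k _ => mu_int (by fun_prop)]
  refine Finset.sum_congr rfl fun k _ => ?_
  have hp2 : Per fun t => ek (-k) t • F t :=
    ⟨fun z => by simp only [(ek_per (-k)).1, hp.1], fun z => by simp only [(ek_per (-k)).2, hp.2]⟩
  rw [integral_smul, mu_trans (f := fun t => ek (-k) t • F t) (by fun_prop) hp2, smul_smul]
end

def c0 (z : ℂ) : ℝ := 2 + Real.cos (2 * Real.pi * z.re) + Real.cos (2 * Real.pi * z.im)

theorem c0_span (n : ℕ) : (fun z => ((c0 z : ℝ) : ℂ) ^ n) ∈ Submodule.span ℂ (range fun k : ℤ × ℤ => ek (-k)) := by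
  set W := Submodule.span ℂ (range fun k : ℤ × ℤ => ek (-k)) with hW
  have hone : (fun _ => (1:ℂ)) ∈ W := by
    refine Submodule.subset_span ⟨0, ?_⟩; ext z; simp [ek_zero]
  have hek : ∀ f ∈ W, ∀ j, (fun z => ek j z * f z) ∈ W := by
    intro f hf j
    induction hf using Submodule.span_induction with
    | mem x h =>
      obtain ⟨k, rfl⟩ := h
      refine Submodule.subset_span ⟨k - j, ?_⟩
      ext z; simp only [ek_mul]; congr 1; ring
    | zero => convert W.zero_mem using 1; ext z; simp
    | add x y _ _ hx hy => convert W.add_mem hx hy using 1; ext z; simp [mul_add]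
    | smul a x _ hx => convert W.smul_mem a hx using 1; ext z; simp [mul_left_comm]
  induction n with
  | zero => simpa using hone
  | succ n ih =>
    have e : (fun z => ((c0 z : ℝ) : ℂ) ^ (n+1)) = (2:ℂ) • (fun z => ((c0 z : ℝ) : ℂ) ^ n) + (1/2:ℂ) • (fun z => ek (1,0) z * ((c0 z : ℝ) : ℂ) ^ n)
       + (1/2:ℂ) • (fun z => ek (-1,0) z * ((c0 z : ℝ) : ℂ) ^ n) + (1/2:ℂ) • (fun z => ek (0,1) z * ((c0 z : ℝ) : ℂ) ^ n)
       + (1/2:ℂ) • (fun z => ek (0,-1) z * ((c0 z : ℝ) : ℂ) ^ n) := by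
      ext z
      have e1 : ((c0 z : ℝ) : ℂ) = 2 + (1/2) * (ek (1,0) z + ek (-1,0) z) + (1/2) * (ek (0,1) z + ek (0,-1) z) := by
        simp only [c0, ek, Complex.ofReal_add, Complex.ofReal_cos, Complex.cos]
        push_cast; ring_nf
      simp only [Pi.add_apply, Pi.smul_apply, smul_eq_mul, pow_succ]
      linear_combination ((c0 z : ℝ) : ℂ) ^ n * e1
    rw [e]
    exact W.add_mem (W.add_mem (W.add_mem (W.add_mem (W.smul_mem _ ih) (W.smul_mem _ (hek _ ih _))) (W.smul_mem _ (hek _ ih _)))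
      (W.smul_mem _ (hek _ ih _))) (W.smul_mem _ (hek _ ih _))

theorem kernel (ψ : ℂ → ℝ) (hψ : Continuous ψ) (h0 : ψ 0 = 0) {ε : ℝ} (hε : 0 < ε) :
    ∃ K : ℂ → ℝ, Ker K ∧ (∫ t, K t * ψ t ∂mu < ε) ∧
      ∃ (S : Finset (ℤ × ℤ)) (κ : ℤ × ℤ → ℂ), ∀ z, (K z : ℂ) = ∑ k ∈ S, κ k * ek (-k) z := by
  obtain ⟨c, hc⟩ : ∃ c : ℂ → ℝ, c = c0 := ⟨c0, rfl⟩
  have hcc : Continuous c := by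
    have := Complex.continuous_re; have := Complex.continuous_im; rw [hc]; unfold c0; fun_prop
  have hc0 : ∀ z, 0 ≤ c z := fun z => by
    have := Real.neg_one_le_cos (2 * Real.pi * z.re)
    have := Real.neg_one_le_cos (2 * Real.pi * z.im)
    simp only [hc, c0]; linarith
  have hcm : ∀ z ∈ Sq, z ≠ 0 → c z < c 0 := by
    intro z hz hz0
    simp only [Sq, Complex.mem_reProdIm, mem_Icc] at hz
    have key : ∀ x : ℝ, -(1/2) ≤ x → x ≤ 1/2 → x ≠ 0 → Real.cos (2 * Real.pi * x) < 1 := by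
      intro x h1 h2 h3
      refine lt_of_le_of_ne (Real.cos_le_one _) fun h => h3 ?_
      have hpi := Real.pi_pos
      have := (Real.cos_eq_one_iff_of_lt_of_lt (x := 2 * Real.pi * x) (by nlinarith) (by nlinarith)).1 h
      have h4 : (2 * Real.pi) ≠ 0 := by positivity
      exact (mul_eq_zero.1 this).resolve_left h4
    simp only [hc, c0, Complex.zero_re, Complex.zero_im, mul_zero, Real.cos_zero]
    by_cases h : z.re = 0
    · have h2 : z.im ≠ 0 := fun h2 => hz0 (Complex.ext h h2)
      have := key _ hz.2.1 hz.2.2 h2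
      have := Real.cos_le_one (2 * Real.pi * z.re)
      linarith
    · have := key _ hz.1.1 hz.1.2 h
      have := Real.cos_le_one (2 * Real.pi * z.im)
      linarith
  have hin : (0:ℂ) ∈ closure (interior Sq) := by
    apply subset_closure
    rw [Sq, Complex.interior_reProdIm, interior_Icc, Complex.mem_reProdIm]
    norm_num
  have ht := tendsto_setIntegral_pow_smul_of_unique_maximum_of_isCompact_of_integrableOn (μ := volume)
    Sq_compact hcc.continuousOn hcm (fun z _ => hc0 z) (by simp [hc, c0]; norm_num) hin
    (hψ.continuousOn.integrableOn_compact Sq_compact) hψ.continuousWithinAt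
  rw [h0] at ht
  have ht1 := tendsto_setIntegral_pow_smul_of_unique_maximum_of_isCompact_of_integrableOn (μ := volume) (g := fun _ => (1:ℝ))
    Sq_compact hcc.continuousOn hcm (fun z _ => hc0 z) (by simp [hc, c0]; norm_num) hin
    (continuous_const.continuousOn.integrableOn_compact Sq_compact) continuous_const.continuousWithinAt
  obtain ⟨n, hn, hn1⟩ := ((ht.eventually (gt_mem_nhds hε)).and (ht1.eventually (lt_mem_nhds one_half_lt_one))).exists
  obtain ⟨I, hI⟩ : ∃ I, I = ∫ x in Sq, c x ^ n := ⟨_, rfl⟩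
  rw [← hI] at hn hn1
  have hI0 : I ≠ 0 := by
    rintro h; rw [h] at hn1; norm_num at hn1
  have hIp : 0 ≤ I := hI ▸ integral_nonneg fun x => pow_nonneg (hc0 x) n
  refine ⟨fun z => I⁻¹ * c z ^ n, ⟨by fun_prop, fun z => by have := hc0 z; positivity, ?_⟩, ?_, ?_⟩
  · rw [integral_const_mul, ← hI, inv_mul_cancel₀ hI0]
  · simp only [mul_assoc]
    rw [integral_const_mul]; exact hn
  · obtain ⟨κ, hκ⟩ := (Finsupp.mem_span_range_iff_exists_finsupp).1 (c0_span n)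
    refine ⟨κ.support, fun k => ((I⁻¹ : ℝ) : ℂ) * κ k, fun z => ?_⟩
    have := congrFun hκ z
    simp only [Finsupp.sum, Finset.sum_apply, Pi.smul_apply, smul_eq_mul] at this
    simp only [mul_assoc]
    rw [← Finset.mul_sum, this, hc]; push_cast; rfl

def gi (k : ℤ × ℤ) : ℂ := k.1 + k.2 * Complex.I
theorem gi_re (k : ℤ × ℤ) : (gi k).re = k.1 := by simp [gi]
theorem gi_im (k : ℤ × ℤ) : (gi k).im = k.2 := by simp [gi]
theorem gi_add (k l : ℤ × ℤ) : gi (k + l) = gi k + gi l := by simp [gi]; ring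
theorem gi_sub (k l : ℤ × ℤ) : gi (k - l) = gi k - gi l := by simp [gi]; ring
theorem gi_ne {k : ℤ × ℤ} (hk : k ≠ 0) : 1 ≤ ‖gi k‖ := by
  by_cases h : k.1 = 0
  · have h2 : k.2 ≠ 0 := fun h2 => hk (Prod.ext h h2)
    refine le_trans ?_ (Complex.abs_im_le_norm _)
    rw [gi_im]; exact_mod_cast Int.one_le_abs h2
  · refine le_trans ?_ (Complex.abs_re_le_norm _)
    rw [gi_re]; exact_mod_cast Int.one_le_abs h
theorem gi_fin (R : ℝ) : {k : ℤ × ℤ | ‖gi k‖ ≤ R}.Finite := by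
  refine ((finite_Icc (-⌈R⌉) ⌈R⌉).prod (finite_Icc (-⌈R⌉) ⌈R⌉)).subset fun k hk => ?_
  have h1 := (Complex.abs_re_le_norm _).trans hk
  have h2 := (Complex.abs_im_le_norm _).trans hk
  rw [gi_re] at h1
  rw [gi_im] at h2
  have h3 := h1.trans (Int.le_ceil R)
  have h4 := h2.trans (Int.le_ceil R)
  have h3' : |k.1| ≤ ⌈R⌉ := by exact_mod_cast h3
  have h4' : |k.2| ≤ ⌈R⌉ := by exact_mod_cast h4
  exact ⟨abs_le.1 h3', abs_le.1 h4'⟩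

section
variable {V : Type*} [NormedAddCommGroup V] [NormedSpace ℂ V] 

def lam (e m : V) (z : ℂ) : V := z • e + (starRingEnd ℂ) z • m
theorem lam_add (e m : V) (z w : ℂ) : lam e m (z + w) = lam e m z + lam e m w := by
  simp only [lam, map_add, add_smul]; abel
theorem lam_sub (e m : V) (z w : ℂ) : lam e m (z - w) = lam e m z - lam e m w := by
  simp only [lam, map_sub, sub_smul]; abel
theorem lam_ge {e m : V} {q : ℝ} (he : ‖e‖ = 1) (hm : ‖m‖ ≤ q) (z : ℂ) : (1 - q) * ‖z‖ ≤ ‖lam e m z‖ := by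
  have h := norm_sub_le_norm_add (z • e) ((starRingEnd ℂ) z • m)
  rw [norm_smul, norm_smul, Complex.norm_conj, he] at h
  have := mul_le_mul_of_nonneg_left hm (norm_nonneg z)
  unfold lam; linarith
theorem lam_le {e m : V} {q : ℝ} (he : ‖e‖ = 1) (hm : ‖m‖ ≤ q) (z : ℂ) : ‖lam e m z‖ ≤ (1 + q) * ‖z‖ := by
  have h := norm_add_le (z • e) ((starRingEnd ℂ) z • m)
  rw [norm_smul, norm_smul, Complex.norm_conj, he] at h
  have := mul_le_mul_of_nonneg_left hm (norm_nonneg z)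
  unfold lam; linarith

def cl (q : ℝ) (m : V) : V := (q / max q ‖m‖) • m
theorem cl_cont {q : ℝ} (hq : 0 < q) : Continuous (cl q : V → V) := by
  unfold cl
  have : ∀ m : V, max q ‖m‖ ≠ 0 := fun m => (lt_max_of_lt_left hq).ne'
  fun_prop (disch := assumption)
theorem cl_le {q : ℝ} (hq : 0 < q) (m : V) : ‖cl q m‖ ≤ q := by
  have h : 0 < max q ‖m‖ := lt_max_of_lt_left hq
  rw [cl, norm_smul, Real.norm_of_nonneg (by positivity), div_mul_eq_mul_div, div_le_iff₀ h]
  exact mul_le_mul_of_nonneg_left (le_max_right _ _) hq.le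
theorem cl_eq {q : ℝ} (hq : 0 < q) {m : V} (hm : ‖m‖ ≤ q) : cl q m = m := by
  rw [cl, max_eq_left hm, div_self hq.ne', one_smul]

variable {W : Type*} [NormedAddCommGroup W]
def per (Q : V → W) (e m : V) (x : V) : W := ∑ᶠ k : ℤ × ℤ, Q (x + lam e m (gi k))

variable {Q : V → W} {e m : V} {q r : ℝ}

theorem per_one (he : ‖e‖ = 1) (hQ : ∀ x, r ≤ ‖x‖ → Q x = 0) (hr : 2 * r ≤ 1 - q) (hq : q < 1) (hm : ‖m‖ ≤ q) {x : V} {k : ℤ × ℤ}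
    (hk : ‖x + lam e m (gi k)‖ < r) : per Q e m x = Q (x + lam e m (gi k)) ∧ ∀ j ≠ k, Q (x + lam e m (gi j)) = 0 := by
  have h : ∀ j ≠ k, Q (x + lam e m (gi j)) = 0 := by
    intro j hj
    apply hQ
    by_contra! h
    have h1 := lam_ge he hm (gi j - gi k)
    have h2 := gi_ne (sub_ne_zero.2 hj)
    rw [gi_sub] at h2
    rw [lam_sub] at h1
    have h3 := norm_sub_le (x + lam e m (gi j)) (x + lam e m (gi k))
    rw [add_sub_add_left_eq_sub] at h3
    nlinarith
  exact ⟨finsum_eq_single _ k fun j hj => h j hj, h⟩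

theorem per_ex (he : ‖e‖ = 1) (hQ : ∀ x, r ≤ ‖x‖ → Q x = 0) (hr : 2 * r ≤ 1 - q) (hq : q < 1) (hm : ‖m‖ ≤ q) (x : V) :
    ∃ k, per Q e m x = Q (x + lam e m (gi k)) ∧ ∀ j ≠ k, Q (x + lam e m (gi j)) = 0 := by
  by_cases h : ∃ k, ‖x + lam e m (gi k)‖ < r
  · obtain ⟨k, hk⟩ := h
    exact ⟨k, per_one he hQ hr hq hm hk⟩
  · push Not at h
    have h2 : ∀ k, Q (x + lam e m (gi k)) = 0 := fun k => hQ _ (h k)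
    exact ⟨0, by simp [per, h2], fun j _ => h2 j⟩

theorem per_le {B : ℝ} (he : ‖e‖ = 1) (hQ : ∀ x, r ≤ ‖x‖ → Q x = 0) (hr : 2 * r ≤ 1 - q) (hq : q < 1) (hm : ‖m‖ ≤ q)
    (hB : ∀ x, ‖Q x‖ ≤ B) (x : V) : ‖per Q e m x‖ ≤ B := by
  obtain ⟨k, hk, -⟩ := per_ex he hQ hr hq hm x
  rw [hk]; exact hB _

theorem per_lip {L : ℝ} (he : ‖e‖ = 1) (hQ : ∀ x, r ≤ ‖x‖ → Q x = 0) (hr : 2 * r ≤ 1 - q) (hq : q < 1) (hm : ‖m‖ ≤ q)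
    (hL : 0 ≤ L) (hlip : ∀ x y, ‖Q x - Q y‖ ≤ L * ‖x - y‖) (x y : V) : ‖per Q e m x - per Q e m y‖ ≤ 2 * L * ‖x - y‖ := by
  obtain ⟨k, hk, hk'⟩ := per_ex he hQ hr hq hm x
  obtain ⟨j, hj, hj'⟩ := per_ex he hQ hr hq hm y
  have h : ∀ i, ‖Q (x + lam e m (gi i)) - Q (y + lam e m (gi i))‖ ≤ L * ‖x - y‖ := fun i => by
    refine (hlip _ _).trans_eq ?_
    rw [add_sub_add_right_eq_sub]
  have h0 : 0 ≤ L * ‖x - y‖ := by positivity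
  rw [hk, hj]
  by_cases e1 : k = j
  · subst e1; linarith [h k]
  · have h1 := h k
    have h2 := h j
    rw [hj' k e1] at h1
    rw [hk' j (Ne.symm e1)] at h2
    have := norm_add_le (Q (x + lam e m (gi k)) - 0) (0 - Q (y + lam e m (gi j)))
    rw [sub_zero, zero_sub, ← sub_eq_add_neg] at this
    rw [sub_zero] at h1
    rw [zero_sub] at h2
    linarith

theorem per_per (l : ℤ × ℤ) (x : V) : per Q e m (x + lam e m (gi l)) = per Q e m x := by
  unfold per
  rw [← finsum_comp_equiv (f := fun k => Q (x + lam e m (gi k))) (Equiv.addLeft l)]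
  simp only [Equiv.coe_addLeft, gi_add, lam_add, add_assoc]

theorem per_in (he : ‖e‖ = 1) (hQ : ∀ x, r ≤ ‖x‖ → Q x = 0) (hr : 2 * r ≤ 1 - q) (hq : q < 1) (hm : ‖m‖ ≤ q) {x : V} (hx : ‖x‖ < r) :
    per Q e m x = Q x := by
  have e0 : x + lam e m (gi 0) = x := by simp [gi, lam]
  have := (per_one he hQ hr hq hm (k := 0) (by rwa [e0])).1
  rwa [e0] at this

theorem per_cont (hq0 : 0 < q) (he : ‖e‖ = 1) (hQ : ∀ x, r ≤ ‖x‖ → Q x = 0) (hq : q < 1) (hc : Continuous Q) :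
    Continuous fun p : V × V => per Q e (cl q p.1) p.2 := by
  unfold per
  have hcl := cl_cont (V := V) hq0
  refine continuous_finsum (fun k => by unfold lam; fun_prop) fun p => ?_
  refine ⟨univ ×ˢ Metric.ball p.2 1, prod_mem_nhds univ_mem (Metric.ball_mem_nhds _ one_pos), ?_⟩
  refine (gi_fin ((r + ‖p.2‖ + 1) / (1 - q))).subset ?_
  rintro k ⟨⟨m, x⟩, h1, h2⟩
  simp only [mem_prod, mem_univ, true_and, mem_ball_iff_norm] at h2
  simp only [Function.mem_support] at h1
  have h3 : ‖x + lam e (cl q m) (gi k)‖ < r := by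
    by_contra! h; exact h1 (hQ _ h)
  have h4 := lam_ge he (cl_le hq0 m) (gi k)
  have h5 := norm_sub_le (x + lam e (cl q m) (gi k)) x
  rw [add_sub_cancel_left] at h5
  have h6 : ‖x‖ ≤ ‖p.2‖ + 1 := by
    have := norm_add_le (x - p.2) p.2
    rw [sub_add_cancel] at this; linarith
  rw [Set.mem_ofPred_eq, le_div_iff₀ (by linarith)]
  linarith
end

section
variable {V : Type*} [NormedAddCommGroup V] [NormedSpace ℂ V]

theorem dz_of {A : ℂ →L[ℝ] V} {p g : V} (h : ∀ v, A v = v • p + (starRingEnd ℂ) v • g) : dz A = p := by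
  simp only [dz, h, map_one, Complex.conj_I, one_smul]
  match_scalars <;> first | linear_combination (-1 / 2 : ℂ) * Complex.I_mul_I | linear_combination (1 / 2 : ℂ) * Complex.I_mul_I
theorem db_of {A : ℂ →L[ℝ] V} {p g : V} (h : ∀ v, A v = v • p + (starRingEnd ℂ) v • g) : db A = g := by
  simp only [db, h, map_one, Complex.conj_I, one_smul]
  match_scalars <;> first | linear_combination (-1 / 2 : ℂ) * Complex.I_mul_I | linear_combination (1 / 2 : ℂ) * Complex.I_mul_I

def su (κ : ℤ × ℤ → ℂ) (S : Finset (ℤ × ℤ)) (a : ℤ × ℤ → V) (z : ℂ) : V :=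
  ∑ k ∈ S.erase 0, (κ k * (Real.pi * Complex.I * gi k)⁻¹ * ek k z) • a k
def gg (κ : ℤ × ℤ → ℂ) (S : Finset (ℤ × ℤ)) (a : ℤ × ℤ → V) (z : ℂ) : V :=
  ∑ k ∈ S, (κ k * ek k z) • a k
def pp (e : V) (κ : ℤ × ℤ → ℂ) (S : Finset (ℤ × ℤ)) (a : ℤ × ℤ → V) (z : ℂ) : V :=
  e + ∑ k ∈ S.erase 0, (κ k * ((starRingEnd ℂ) (gi k) / gi k) * ek k z) • a k
def UU (e m : V) (κ : ℤ × ℤ → ℂ) (S : Finset (ℤ × ℤ)) (a : ℤ × ℤ → V) (c : V) (z : ℂ) : V :=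
  c + lam e m z + su κ S a z - su κ S a 0

def Lk (k : ℤ × ℤ) : ℂ →L[ℝ] ℂ :=
  ((2 * Real.pi * k.1 * Complex.I) • Complex.ofRealCLM.comp Complex.reCLM + (2 * Real.pi * k.2 * Complex.I) • Complex.ofRealCLM.comp Complex.imCLM)
theorem Lk_apply (k : ℤ × ℤ) (v : ℂ) : Lk k v = Real.pi * Complex.I * (starRingEnd ℂ) (gi k) * v + Real.pi * Complex.I * gi k * (starRingEnd ℂ) v := by
  have e1 : v = v.re + v.im * Complex.I := (Complex.re_add_im v).symm
  have e2 : (starRingEnd ℂ) v = v.re - v.im * Complex.I := by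
    apply Complex.ext <;> simp
  rw [e2]; conv_rhs => rw [e1]
  simp only [Lk, gi, _root_.add_apply, _root_.smul_apply, ContinuousLinearMap.comp_apply, Complex.reCLM_apply, Complex.imCLM_apply,
    Complex.ofRealCLM_apply, smul_eq_mul, map_add, map_mul, Complex.conj_I, map_intCast]
  simp only [Complex.add_re, Complex.add_im, Complex.mul_re, Complex.mul_im, Complex.ofReal_re, Complex.ofReal_im, Complex.I_re, Complex.I_im]
  push_cast
  linear_combination (2 * Real.pi * Complex.I * k.2 * v.im) * Complex.I_mul_I
theorem ek_Lk (k : ℤ × ℤ) (z : ℂ) : ek k z = Complex.exp (Lk k z) := by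
  simp only [ek, Lk, _root_.add_apply, _root_.smul_apply, ContinuousLinearMap.comp_apply, Complex.reCLM_apply, Complex.imCLM_apply,
    Complex.ofRealCLM_apply, smul_eq_mul]
  congr 1; push_cast; ring
theorem ek_hasF (k : ℤ × ℤ) (z : ℂ) : HasFDerivAt (ek k) (ek k z • Lk k) z := by
  have h : HasFDerivAt (fun z => Complex.exp (Lk k z)) _ z := (Lk k).hasFDerivAt.cexp
  rw [← ek_Lk] at h
  exact h.congr_of_eventuallyEq (Eventually.of_forall fun z => ek_Lk k z)
theorem ek_smooth (k : ℤ × ℤ) : ContDiff ℝ ∞ (ek k) := by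
  rw [show ek k = fun z => Complex.exp (Lk k z) from funext (ek_Lk k)]
  exact (Lk k).contDiff.cexp

variable (e m c : V) (κ : ℤ × ℤ → ℂ) (S : Finset (ℤ × ℤ)) (a : ℤ × ℤ → V)

theorem UU_smooth : ContDiff ℝ ∞ (UU e m κ S a c) := by
  unfold UU su lam
  have := ek_smooth
  have h2 : ContDiff ℝ ∞ (starRingEnd ℂ : ℂ → ℂ) := Complex.conjCLE.contDiff
  fun_prop
theorem gg_cont : Continuous (gg κ S a) := by
  unfold gg; have := ek_cont; fun_prop
theorem pp_cont : Continuous (pp e κ S a) := by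
  unfold pp; have := ek_cont; fun_prop
theorem gg_per : Per (gg κ S a) := by
  constructor <;> intro z <;> simp only [gg, (ek_per _).1, (ek_per _).2]
theorem pp_per : Per (pp e κ S a) := by
  constructor <;> intro z <;> simp only [pp, (ek_per _).1, (ek_per _).2]
theorem su_per : Per (su κ S a) := by
  constructor <;> intro z <;> simp only [su, (ek_per _).1, (ek_per _).2]

theorem per_gi {E : Type*} {f : ℂ → E} (hp : Per f) (k : ℤ × ℤ) (z : ℂ) : f (z + gi k) = f z := by
  have h1 : Function.Periodic f 1 := hp.1
  have h2 : Function.Periodic f Complex.I := hp.2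
  have := h1.int_mul k.1 z
  have h3 := h2.int_mul k.2 (z + k.1)
  rw [mul_one] at this
  rw [gi, ← add_assoc, h3, this]

theorem UU_gi (k : ℤ × ℤ) (z : ℂ) : UU e m κ S a c (z + gi k) = UU e m κ S a c z + lam e m (gi k) := by
  simp only [UU, per_gi (su_per κ S a), lam_add]; abel

theorem UU_fderiv {S : Finset (ℤ × ℤ)} (h0 : (0 : ℤ × ℤ) ∈ S) {κ : ℤ × ℤ → ℂ} (hκ : κ 0 = 1) {a : ℤ × ℤ → V} (ha : a 0 = m) (z v : ℂ) :
    fderiv ℝ (UU e m κ S a c) z v = v • pp e κ S a z + (starRingEnd ℂ) v • gg κ S a z := by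
  have hl : HasFDerivAt (lam e m) ((ContinuousLinearMap.id ℝ ℂ).smulRight e + (Complex.conjCLE : ℂ →L[ℝ] ℂ).smulRight m) z :=
    ((ContinuousLinearMap.id ℝ ℂ).smulRight e + (Complex.conjCLE : ℂ →L[ℝ] ℂ).smulRight m).hasFDerivAt
  have hs : HasFDerivAt (su κ S a) (∑ k ∈ S.erase 0, ((κ k * (Real.pi * Complex.I * gi k)⁻¹) • (ek k z • Lk k)).smulRight (a k)) z := by
    unfold su
    exact HasFDerivAt.fun_sum fun k _ => ((ek_hasF k z).const_mul _).smul_const (a k)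
  have := (((hasFDerivAt_const c z).add hl).add hs).sub_const (su κ S a 0)
  have e1 : fderiv ℝ (UU e m κ S a c) z = _ := this.fderiv
  rw [e1]
  simp only [pp, gg]
  rw [← Finset.add_sum_erase _ _ h0, hκ, ek_zero, ha]
  simp only [_root_.add_apply, _root_.zero_apply, ContinuousLinearMap.smulRight_apply, ContinuousLinearMap.id_apply,
    _root_.sum_apply, zero_add, mul_one, one_smul, smul_add, Finset.smul_sum]
  rw [add_add_add_comm, ← Finset.sum_add_distrib]
  congr 1
  refine Finset.sum_congr rfl fun k hk => ?_
  have hk0 : gi k ≠ 0 := fun h => by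
    have := gi_ne (Finset.ne_of_mem_erase hk); rw [h, norm_zero] at this; linarith
  have hpi : (Real.pi : ℂ) ≠ 0 := by exact_mod_cast Real.pi_ne_zero
  simp only [_root_.smul_apply, smul_eq_mul, Lk_apply, smul_smul, ← add_smul]
  congr 1
  field_simp
  

end

theorem ci {f : ℂ → ℝ} (hf : Continuous f) (z : ℂ) (t : ℝ) :
    IntervalIntegrable (fun θ => f (circleMap z t θ)) volume (-Real.pi) Real.pi :=
  (hf.comp (continuous_circleMap z t)).intervalIntegrable _ _
theorem ctc {f : ℂ → ℝ} (hf : Continuous f) (z : ℂ) :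
    Continuous (fun t : ℝ => ∫ θ in (-Real.pi)..Real.pi, f (circleMap z t θ)) :=
  intervalIntegral.continuous_parametric_intervalIntegral_of_continuous' (f := fun t θ => f (circleMap z t θ))
    (hf.comp (cont_cm z)) _ _
theorem ball_deriv {f : ℂ → ℝ} (hf : Continuous f) (z : ℂ) {t : ℝ} (ht : 0 < t) :
    HasDerivAt (fun s => ∫ y in Metric.closedBall z s, f y) (t * ∫ θ in (-Real.pi)..Real.pi, f (circleMap z t θ)) t := by
  have hc := ctc hf z
  have h := intervalIntegral.integral_hasDerivAt_right (f := fun t => t * ∫ θ in (-Real.pi)..Real.pi, f (circleMap z t θ)) (a := 0) (b := t)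
    (Continuous.intervalIntegrable (by fun_prop) _ _)
    (Continuous.stronglyMeasurableAtFilter (by fun_prop) _ _) (by fun_prop)
  refine h.congr_of_eventuallyEq ?_
  filter_upwards [lt_mem_nhds ht] with s hs
  exact polar_bridge f z s hs.le hf.continuousOn

theorem swap_sum {ι : Type*} (S : Finset ι) (f : ι → ℂ → ℝ) (hf : ∀ i, Continuous (f i)) (z : ℂ) (t : ℝ) :
    ∑ i ∈ S, ∫ θ in (-Real.pi)..Real.pi, f i (circleMap z t θ) = ∫ θ in (-Real.pi)..Real.pi, ∑ i ∈ S, f i (circleMap z t θ) :=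
  (intervalIntegral.integral_finsetSum fun i _ => ci (hf i) z t).symm

section
variable {V : Type*} [NormedAddCommGroup V] [InnerProductSpace ℂ V] [FiniteDimensional ℂ V]

theorem energyV {u P g : ℂ → V} (hu : ContDiff ℝ 2 u) (hP : Continuous P) (hg : Continuous g)
    (h : ∀ y v, fderiv ℝ u y v = v • P y + (starRingEnd ℂ) v • g y) (z : ℂ) {s : ℝ} (hs : 0 ≤ s) :
    ∫ y in Metric.closedBall z s, (‖P y‖ ^ 2 - ‖g y‖ ^ 2) ≤
      2 * Real.pi * s ^ 2 * ∫ θ in (-Real.pi)..Real.pi, (‖P (circleMap z s θ)‖ ^ 2 + ‖g (circleMap z s θ)‖ ^ 2) := by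
  let b := stdOrthonormalBasis ℂ V
  have hi : ∀ i, ∫ y in Metric.closedBall z s, (‖inner ℂ (b i) (P y)‖ ^ 2 - ‖inner ℂ (b i) (g y)‖ ^ 2) ≤
      2 * Real.pi * s ^ 2 * ∫ θ in (-Real.pi)..Real.pi, (‖inner ℂ (b i) (P (circleMap z s θ))‖ ^ 2 + ‖inner ℂ (b i) (g (circleMap z s θ))‖ ^ 2) := by
    intro i
    let L : V →L[ℝ] ℂ := (innerSL ℂ (b i)).restrictScalars ℝ
    have hL : ∀ x, L x = inner ℂ (b i) x := fun x => rfl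
    have hf : ContDiff ℝ 2 (fun y => L (u y)) := L.contDiff.comp hu
    have hd : ∀ y v, fderiv ℝ (fun y => L (u y)) y v = v • inner ℂ (b i) (P y) + (starRingEnd ℂ) v • inner ℂ (b i) (g y) := by
      intro y v
      have := (L.hasFDerivAt.comp y (hu.differentiable (by norm_num) y).hasFDerivAt).fderiv
      rw [show (fun y => L (u y)) = L ∘ u from rfl, this, ContinuousLinearMap.comp_apply, h, hL, inner_add_right, inner_smul_right, inner_smul_right]; rfl
    have := energy1 _ hf z s hs
    simp only [fun y => dz_of (hd y), fun y => db_of (hd y)] at this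
    rw [polar_bridge _ z s hs (by fun_prop)]
    exact this
  have hsum := Finset.sum_le_sum fun i (_ : i ∈ Finset.univ) => hi i
  rw [← integral_finsetSum _ (fun i _ => (Continuous.continuousOn (by fun_prop)).integrableOn_compact (isCompact_closedBall z s)),
    ← Finset.mul_sum, swap_sum Finset.univ (fun i y => ‖inner ℂ (b i) (P y)‖ ^ 2 + ‖inner ℂ (b i) (g y)‖ ^ 2) (fun i => by fun_prop)] at hsum
  simpa only [Finset.sum_sub_distrib, Finset.sum_add_distrib, b.sum_sq_norm_inner_right] using hsum

theorem morrey {q : ℝ} (hq0 : 0 ≤ q) (hq : q < 1) : ∃ C β : ℝ, 0 < C ∧ 0 < β ∧ β ≤ 1 ∧ ∀ u P g r : ℂ → V, ContDiff ℝ 2 u → Continuous P → Continuous g →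
    Continuous r → (∀ y v, fderiv ℝ u y v = v • P y + (starRingEnd ℂ) v • g y) → Per P → Per r → (∀ y, ‖g y - r y‖ ≤ q * ‖P y‖) →
    ∀ z s, 0 < s → s ≤ 1/2 → ∫ y in Metric.closedBall z s, (‖P y‖ ^ 2 + ‖r y‖ ^ 2) ≤
      C * ((∫ y, ‖r y‖ ^ 2 ∂mu) + s ^ β * ∫ y, (‖P y‖ ^ 2 + ‖r y‖ ^ 2) ∂mu) := by
  obtain ⟨D, hD⟩ : ∃ D, D = (1 - q)⁻¹ := ⟨_, rfl⟩
  have hD1 : 1 ≤ D := by rw [hD]; exact (one_le_inv₀ (by linarith)).2 (by linarith)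
  have hDq : D * (1 - q) = 1 := by rw [hD]; exact inv_mul_cancel₀ (by linarith)
  obtain ⟨c, hc⟩ : ∃ c, c = 2 * Real.pi * (D * (2 + D)) := ⟨_, rfl⟩
  have hpi := Real.pi_gt_three
  have hc1 : 1 ≤ c := by
    have : 1 ≤ D * (2 + D) := by nlinarith
    rw [hc]; nlinarith
  refine ⟨D ^ 2 + 2, 1 / c, by positivity, by positivity, by rw [div_le_one (by linarith)]; exact hc1, ?_⟩
  intro u P g r hu hP hg hr hd pP pr hgr z s hs hs2
  have hg2 : ∀ y, ‖g y‖ ^ 2 ≤ q * ‖P y‖ ^ 2 + D * ‖r y‖ ^ 2 := by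
    intro y
    have h1 : ‖g y‖ ≤ q * ‖P y‖ + ‖r y‖ := by
      have := norm_add_le (g y - r y) (r y)
      rw [sub_add_cancel] at this; linarith [hgr y]
    have h2 : ‖g y‖ ^ 2 ≤ (q * ‖P y‖ + ‖r y‖) ^ 2 := by gcongr
    have h3 : 0 ≤ q * (1 - q) * (‖P y‖ - D * ‖r y‖) ^ 2 := by
      have : 0 ≤ 1 - q := by linarith
      positivity
    have h4 : q * (1 - q) * (‖P y‖ - D * ‖r y‖) ^ 2 = q * ‖P y‖ ^ 2 + D * ‖r y‖ ^ 2 - (q * ‖P y‖ + ‖r y‖) ^ 2 := by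
      linear_combination (-2 * q * ‖P y‖ * ‖r y‖ + ‖r y‖ ^ 2 * q * D - ‖r y‖ ^ 2) * hDq
    linarith
  have hH : Continuous fun y => ‖P y‖ ^ 2 + ‖r y‖ ^ 2 := by fun_prop
  have pH : Per fun y => ‖P y‖ ^ 2 + ‖r y‖ ^ 2 := ⟨fun z => by simp only [pP.1, pr.1], fun z => by simp only [pP.2, pr.2]⟩
  have pr2 : Per fun y => ‖r y‖ ^ 2 := ⟨fun z => by simp only [pr.1], fun z => by simp only [pr.2]⟩
  have hη : 0 ≤ ∫ y, ‖r y‖ ^ 2 ∂mu := integral_nonneg fun y => by positivity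
  have hY0 : 0 ≤ ∫ y, (‖P y‖ ^ 2 + ‖r y‖ ^ 2) ∂mu := integral_nonneg fun y => by positivity
  have key := ode_cmp (Y := fun s => ∫ y in Metric.closedBall z s, (‖P y‖ ^ 2 + ‖r y‖ ^ 2)) (s := 1/2) (a := (D ^ 2 + 1) * ∫ y, ‖r y‖ ^ 2 ∂mu) (c := c) (by positivity) (by linarith)
    (fun t ht => ball_deriv hH z ht.1) ?_ (t := s) ⟨hs, hs2⟩
  · have h1 := ball_le_mu hH pH (fun y => by positivity) z le_rfl
    have h2 : (s / (1/2)) ^ (1 / c) ≤ 2 * s ^ (1 / c) := by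
      rw [show s / (1/2) = 2 * s by ring, Real.mul_rpow (by norm_num) hs.le]
      gcongr
      calc (2:ℝ) ^ (1 / c) ≤ 2 ^ (1:ℝ) := Real.rpow_le_rpow_of_exponent_le (by norm_num) (by rw [div_le_one (by linarith)]; exact hc1)
        _ = 2 := Real.rpow_one 2
    have h3 : 0 ≤ s ^ (1 / c) := by positivity
    refine key.trans ?_
    have h4 : (s / (1/2)) ^ (1 / c) * ∫ y in Metric.closedBall z (1/2), (‖P y‖ ^ 2 + ‖r y‖ ^ 2) ≤ 2 * s ^ (1 / c) * ∫ y, (‖P y‖ ^ 2 + ‖r y‖ ^ 2) ∂mu := by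
      apply mul_le_mul h2 h1 (integral_nonneg fun y => by positivity) (by positivity)
    nlinarith [mul_nonneg h3 hY0, mul_nonneg (sq_nonneg D) (mul_nonneg h3 hY0)]
  · intro t ht
    have ien := energyV hu hP hg hd z ht.1.le
    have hint : ∀ f : ℂ → ℝ, Continuous f → IntegrableOn f (Metric.closedBall z t) := fun f hf =>
      hf.continuousOn.integrableOn_compact (isCompact_closedBall z t)
    have hm : (1 - q) * (∫ y in Metric.closedBall z t, ‖P y‖ ^ 2) - D * ∫ y in Metric.closedBall z t, ‖r y‖ ^ 2 ≤ ∫ y in Metric.closedBall z t, (‖P y‖ ^ 2 - ‖g y‖ ^ 2) := by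
      rw [← integral_const_mul, ← integral_const_mul, ← integral_sub (hint _ (by fun_prop)) (hint _ (by fun_prop))]
      refine integral_mono (hint _ (by fun_prop)) (hint _ (by fun_prop)) fun y => ?_
      have := hg2 y
      simp only; linarith
    have hth : ∫ θ in (-Real.pi)..Real.pi, (‖P (circleMap z t θ)‖ ^ 2 + ‖g (circleMap z t θ)‖ ^ 2) ≤
        (2 + D) * ∫ θ in (-Real.pi)..Real.pi, (‖P (circleMap z t θ)‖ ^ 2 + ‖r (circleMap z t θ)‖ ^ 2) := by
      rw [← intervalIntegral.integral_const_mul]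
      refine intervalIntegral.integral_mono_on (by linarith) (ci (f := fun y => ‖P y‖ ^ 2 + ‖g y‖ ^ 2) (by fun_prop) z t) (ci (f := fun y => (2 + D) * (‖P y‖ ^ 2 + ‖r y‖ ^ 2)) (by fun_prop) z t) fun θ _ => ?_
      have := hg2 (circleMap z t θ)
      nlinarith [sq_nonneg ‖P (circleMap z t θ)‖, sq_nonneg ‖r (circleMap z t θ)‖]
    have hrb := ball_le_mu (f := fun y => ‖r y‖ ^ 2) (by fun_prop) pr2 (fun y => by positivity) z ht.2
    rw [integral_add (hint _ (by fun_prop)) (hint _ (by fun_prop))]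
    set I := ∫ θ in (-Real.pi)..Real.pi, (‖P (circleMap z t θ)‖ ^ 2 + ‖r (circleMap z t θ)‖ ^ 2)
    set X := ∫ y in Metric.closedBall z t, ‖P y‖ ^ 2
    set R := ∫ y in Metric.closedBall z t, ‖r y‖ ^ 2
    have h5 : (1 - q) * X - D * R ≤ 2 * Real.pi * t ^ 2 * ((2 + D) * I) := (hm.trans ien).trans (by gcongr)
    have h6 := mul_le_mul_of_nonneg_left h5 (by linarith : 0 ≤ D)
    have h7 : D * ((1 - q) * X - D * R) = X - D ^ 2 * R := by linear_combination X * hDq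
    have h8 : D * (2 * Real.pi * t ^ 2 * ((2 + D) * I)) = c * t * (t * I) := by rw [hc]; ring
    rw [h7, h8] at h6
    nlinarith [mul_le_mul_of_nonneg_left hrb (sq_nonneg D)]
end

theorem kernel' (ψ : ℂ → ℝ) (hψ : Continuous ψ) (h0 : ψ 0 = 0) {ε : ℝ} (hε : 0 < ε) :
    ∃ K : ℂ → ℝ, Ker K ∧ (∫ t, K t * ψ t ∂mu < ε) ∧
      ∃ S : Finset (ℤ × ℤ), 0 ∈ S ∧ ∀ z, (K z : ℂ) = ∑ k ∈ S, kk K k * ek (-k) z := by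
  obtain ⟨K, hK, h1, S, κ, h2⟩ := kernel ψ hψ h0 hε
  have hc := ek_cont
  have h3 : ∀ k, kk K k = if k ∈ S then κ k else 0 := by
    intro k
    simp only [kk, h2, Finset.sum_mul, mul_assoc, ek_mul]
    rw [integral_finsetSum _ fun j _ => mu_int (by fun_prop)]
    simp only [integral_const_mul, ek_orth]
    simp only [neg_add_eq_zero, mul_ite, mul_one, mul_zero, Finset.sum_ite_eq']
  refine ⟨K, hK, h1, S, ?_, fun z => ?_⟩
  · by_contra h
    have := kk_zero hK
    rw [h3, if_neg h] at this
    exact zero_ne_one this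
  · rw [h2]
    refine Finset.sum_congr rfl fun k hk => ?_
    rw [h3, if_pos hk]

theorem cvx {q p ρ x : ℝ} (hq0 : 0 ≤ q) (hq : q < 1) (hx : 0 ≤ x) (h : x ≤ q * p + ρ) : x ^ 2 ≤ q * p ^ 2 + (1 - q)⁻¹ * ρ ^ 2 := by
  have hDq : (1 - q)⁻¹ * (1 - q) = 1 := inv_mul_cancel₀ (by linarith)
  have h2 : x ^ 2 ≤ (q * p + ρ) ^ 2 := by gcongr
  have h3 : 0 ≤ q * (1 - q) * (p - (1 - q)⁻¹ * ρ) ^ 2 := by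
    have : 0 ≤ 1 - q := by linarith
    positivity
  have h4 : q * (1 - q) * (p - (1 - q)⁻¹ * ρ) ^ 2 = q * p ^ 2 + (1 - q)⁻¹ * ρ ^ 2 - (q * p + ρ) ^ 2 := by
    linear_combination (-2 * q * p * ρ + ρ ^ 2 * q * (1 - q)⁻¹ - ρ ^ 2) * hDq
  linarith

section
variable {V : Type*} [NormedAddCommGroup V] [InnerProductSpace ℂ V] [FiniteDimensional ℂ V]

theorem cv_fsum {K : ℂ → ℝ} (hK : Ker K) (T : Finset (ℤ × ℤ)) (b : ℤ × ℤ → V) (z : ℂ) :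
    cv K (fun z => ∑ k ∈ T, ek k z • b k) z = ∑ k ∈ T, (kk K k * ek k z) • b k := by
  have hc := ek_cont
  have hk := hK.c
  simp only [← cv_ek hK, cv, Finset.smul_sum]
  rw [integral_finsetSum _ fun k _ => mu_int (by fun_prop)]

theorem cv_gg {K : ℂ → ℝ} (hK : Ker K) (S : Finset (ℤ × ℤ)) (a : ℤ × ℤ → V) (z : ℂ) :
    cv K (gg (fun _ => 1) S a) z = gg (kk K) S a z := by
  rw [gg, ← cv_fsum hK]; congr 1; ext z; simp [gg]

def bk (e : V) (a : ℤ × ℤ → V) (k : ℤ × ℤ) : V := if k = 0 then e else ((starRingEnd ℂ) (gi k) / gi k) • a k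
theorem pp_bk (e : V) {S : Finset (ℤ × ℤ)} (h0 : 0 ∈ S) {κ : ℤ × ℤ → ℂ} (hκ : κ 0 = 1) (a : ℤ × ℤ → V) (z : ℂ) :
    pp e κ S a z = ∑ k ∈ S, (κ k * ek k z) • bk e a k := by
  rw [pp, ← Finset.add_sum_erase _ _ h0, hκ, ek_zero]
  simp only [mul_one, one_smul, bk, if_true]
  congr 1
  refine Finset.sum_congr rfl fun k hk => ?_
  rw [if_neg (Finset.ne_of_mem_erase hk), smul_smul]; congr 1; ring
theorem cv_pp {K : ℂ → ℝ} (hK : Ker K) (e : V) {S : Finset (ℤ × ℤ)} (h0 : 0 ∈ S) (a : ℤ × ℤ → V) (z : ℂ) :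
    cv K (pp e (fun _ => 1) S a) z = pp e (kk K) S a z := by
  rw [pp_bk e h0 (kk_zero hK), ← cv_fsum hK]; congr 1; ext z; rw [pp_bk e h0 rfl]; simp
theorem bk_norm (e : V) (a : ℤ × ℤ → V) {k : ℤ × ℤ} (hk : k ≠ 0) : ‖bk e a k‖ = ‖a k‖ := by
  have h : ‖gi k‖ ≠ 0 := fun h => by have := gi_ne hk; rw [h] at this; linarith
  rw [bk, if_neg hk, norm_smul, norm_div, Complex.norm_conj, div_self h, one_mul]
theorem pp_norm {e : V} (he : ‖e‖ = 1) {S : Finset (ℤ × ℤ)} (h0 : 0 ∈ S) (a : ℤ × ℤ → V) :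
    ∫ z, ‖pp e (fun _ => 1) S a z‖ ^ 2 ∂mu = 1 + ∑ k ∈ S.erase 0, ‖a k‖ ^ 2 := by
  simp only [pp_bk e h0 (κ := fun _ => 1) rfl, one_mul]
  rw [parseval, ← Finset.add_sum_erase _ _ h0]
  congr 1
  · simp [bk, he]
  · exact Finset.sum_congr rfl fun k hk => by rw [bk_norm e a (Finset.ne_of_mem_erase hk)]
theorem pp_diff (e : V) {S : Finset (ℤ × ℤ)} (h0 : 0 ∈ S) (a : ℤ × ℤ → V) (t : ℂ) :
    ∫ z, ‖pp e (fun _ => 1) S a (z + t) - pp e (fun _ => 1) S a z‖ ^ 2 ∂mu ≤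
    ∫ z, ‖gg (fun _ => 1) S a (z + t) - gg (fun _ => 1) S a z‖ ^ 2 ∂mu := by
  have h : ∀ b : ℤ × ℤ → V, ∫ z, ‖(∑ k ∈ S, ek k (z + t) • b k) - ∑ k ∈ S, ek k z • b k‖ ^ 2 ∂mu =
      ∑ k ∈ S, ‖(ek k t - 1) • b k‖ ^ 2 := by
    intro b
    rw [← parseval]
    congr 1; ext z; congr 2
    rw [← Finset.sum_sub_distrib]
    refine Finset.sum_congr rfl fun k _ => ?_
    rw [smul_smul, ← sub_smul, ek_add]; congr 1; ring
  simp only [pp_bk e h0 (κ := fun _ => 1) rfl, one_mul, gg, h]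
  refine Finset.sum_le_sum fun k _ => ?_
  by_cases hk : k = 0
  · subst hk; simp [ek_zero]
  · rw [norm_smul, norm_smul, bk_norm e a hk]

structure HQ (Q : V → V →L[ℝ] V) (e : V) (q r L : ℝ) : Prop where
  he : ‖e‖ = 1
  q0 : 0 < q
  q1 : q < 1
  z : ∀ x, r ≤ ‖x‖ → Q x = 0
  r2 : 2 * r ≤ 1 - q
  b : ∀ x, ‖Q x‖ ≤ q
  L0 : 0 ≤ L
  lip : ∀ x y, ‖Q x - Q y‖ ≤ L * ‖x - y‖

def aa (Q : V → V →L[ℝ] V) (e : V) (q : ℝ) (K : ℂ → ℝ) (S : Finset (ℤ × ℤ)) (a : ℤ × ℤ → V) (c : V) (z : ℂ) : V →L[ℝ] V :=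
  per Q e (cl q (a 0)) (UU e (cl q (a 0)) (kk K) S a c z)
def FF (Q : V → V →L[ℝ] V) (e : V) (q : ℝ) (K : ℂ → ℝ) (S : Finset (ℤ × ℤ)) (a : ℤ × ℤ → V) (c : V) (z : ℂ) : V :=
  aa Q e q K S a c z (pp e (fun _ => 1) S a z)
def Phi (Q : V → V →L[ℝ] V) (e : V) (q : ℝ) (K K2 : ℂ → ℝ) (S : Finset (ℤ × ℤ)) (a : ℤ × ℤ → V) (c : V) (k : ℤ × ℤ) : V :=
  kk K2 k • ∫ t, ek (-k) t • FF Q e q K S a c t ∂mu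
def Sol (Q : V → V →L[ℝ] V) (e : V) (q : ℝ) (K K2 : ℂ → ℝ) (S : Finset (ℤ × ℤ)) (a : ℤ × ℤ → V) (c : V) : Prop :=
  ∀ k ∈ S, Phi Q e q K K2 S a c k = a k

variable {Q : V → V →L[ℝ] V} {e : V} {q r L : ℝ}

theorem HQ.cont (h : HQ Q e q r L) : Continuous Q := by
  have : LipschitzWith L.toNNReal Q := LipschitzWith.of_dist_le_mul fun x y => by
    rw [dist_eq_norm, dist_eq_norm, Real.coe_toNNReal _ h.L0]; exact h.lip x y
  exact this.continuous

section
variable (h : HQ Q e q r L) (K : ℂ → ℝ) (S : Finset (ℤ × ℤ)) (a : ℤ × ℤ → V) (c : V)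
include h
theorem aa_le (z : ℂ) : ‖aa Q e q K S a c z‖ ≤ q := per_le h.he h.z h.r2 h.q1 (cl_le h.q0 _) h.b _
theorem aa_lip (z w : ℂ) : ‖aa Q e q K S a c z - aa Q e q K S a c w‖ ≤
    2 * L * ‖UU e (cl q (a 0)) (kk K) S a c z - UU e (cl q (a 0)) (kk K) S a c w‖ :=
  per_lip h.he h.z h.r2 h.q1 (cl_le h.q0 _) h.L0 h.lip _ _
theorem aa_cont : Continuous (aa Q e q K S a c) := by
  have h1 := per_cont (Q := Q) h.q0 h.he h.z h.q1 h.cont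
  have h2 := (UU_smooth e (cl q (a 0)) c (kk K) S a).continuous
  exact h1.comp (continuous_const.prodMk h2 : Continuous fun z => (a 0, UU e (cl q (a 0)) (kk K) S a c z))
omit h in
theorem aa_per : Per (aa Q e q K S a c) := by
  have h1 : gi (1, 0) = 1 := by simp [gi]
  have h2 : gi (0, 1) = Complex.I := by simp [gi]
  constructor <;> intro z <;> simp only [aa]
  · rw [← h1, UU_gi, per_per]
  · rw [← h2, UU_gi, per_per]
theorem FF_cont : Continuous (FF Q e q K S a c) :=
  (aa_cont h K S a c).clm_apply (pp_cont e _ S a)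
omit h in
theorem FF_per : Per (FF Q e q K S a c) := by
  have h1 := aa_per (Q := Q) (e := e) (q := q) K S a c
  have h2 := pp_per e (fun _ => 1) S a
  exact ⟨fun z => by simp only [FF, h1.1, h2.1], fun z => by simp only [FF, h1.2, h2.2]⟩
theorem FF_le (z : ℂ) : ‖FF Q e q K S a c z‖ ≤ q * ‖pp e (fun _ => 1) S a z‖ :=
  (ContinuousLinearMap.le_opNorm _ _).trans (by gcongr; exact aa_le h K S a c z)
theorem FF_int : ∫ z, ‖FF Q e q K S a c z‖ ^ 2 ∂mu ≤ q ^ 2 * ∫ z, ‖pp e (fun _ => 1) S a z‖ ^ 2 ∂mu := by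
  have h1 := FF_cont h K S a c
  have h2 := pp_cont e (fun _ => 1) S a
  rw [← integral_const_mul]
  refine integral_mono (mu_int (by fun_prop)) (mu_int (by fun_prop)) fun z => ?_
  have := FF_le h K S a c z
  simp only [← mul_pow]; gcongr
theorem Phi_le {K2 : ℂ → ℝ} (hK2 : Ker K2) (h0 : 0 ∈ S) : ∑ k ∈ S, ‖Phi Q e q K K2 S a c k‖ ^ 2 ≤ q ^ 2 * (1 + ∑ k ∈ S.erase 0, ‖a k‖ ^ 2) := by
  rw [← pp_norm h.he h0]
  refine le_trans (le_trans ?_ (bessel (FF_cont h K S a c) S)) (FF_int h K S a c)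
  refine Finset.sum_le_sum fun k _ => ?_
  rw [Phi, norm_smul]
  gcongr
  exact mul_le_of_le_one_left (norm_nonneg _) (kk_le hK2 k)
end

theorem sol_basic (h : HQ Q e q r L) {K K2 : ℂ → ℝ} (hK2 : Ker K2) {S : Finset (ℤ × ℤ)} (h0 : 0 ∈ S)
    (hp : ∀ z, (K2 z : ℂ) = ∑ k ∈ S, kk K2 k * ek (-k) z) {a : ℤ × ℤ → V} {c : V} (hs : Sol Q e q K K2 S a c) :
    ‖a 0‖ ≤ q ∧ ∫ z, ‖pp e (fun _ => 1) S a z‖ ^ 2 ∂mu ≤ (1 - q ^ 2)⁻¹ ∧ ∀ z, gg (fun _ => 1) S a z = cv K2 (FF Q e q K S a c) z := by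
  have h1 := Phi_le h K S a c hK2 h0
  rw [Finset.sum_congr rfl fun k hk => by rw [hs k hk], ← Finset.add_sum_erase _ _ h0] at h1
  have hT : 0 ≤ ∑ k ∈ S.erase 0, ‖a k‖ ^ 2 := Finset.sum_nonneg fun _ _ => sq_nonneg _
  have hq := h.q0
  have hq1 := h.q1
  have hq2 : 0 < 1 - q ^ 2 := by nlinarith
  refine ⟨?_, ?_, fun z => ?_⟩
  · have : ‖a 0‖ ^ 2 ≤ q ^ 2 := by nlinarith
    exact (sq_le_sq₀ (norm_nonneg _) hq.le).1 this
  · rw [pp_norm h.he h0, ← one_div, le_div_iff₀ hq2]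
    nlinarith [sq_nonneg ‖a 0‖]
  · rw [cv_poly hp (FF_cont h K S a c) (FF_per K S a c)]
    refine Finset.sum_congr rfl fun k hk => ?_
    rw [one_mul]; congr 1; exact (hs k hk).symm
end

section
variable {V : Type*} [NormedAddCommGroup V] [InnerProductSpace ℂ V] [FiniteDimensional ℂ V]
variable {Q : V → V →L[ℝ] V} {e : V} {q r L : ℝ}

theorem per_nsq {f : ℂ → V} (h : Per f) : Per fun z => ‖f z‖ ^ 2 :=
  ⟨fun z => by simp only [h.1], fun z => by simp only [h.2]⟩

theorem cv_sub {K : ℂ → ℝ} (hK : Ker K) {f : ℂ → V} (hf : Continuous f) (z t : ℂ) :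
    cv K f (z + t) - cv K f z = cv K (fun z => f (z + t) - f z) z := by
  have := hK.c
  simp only [cv, smul_sub]
  rw [integral_sub (mu_int (by fun_prop)) (mu_int (by fun_prop))]
  congr 1; congr 1; ext s; rw [add_right_comm]

theorem cv_int_le {K : ℂ → ℝ} (hK : Ker K) {f : ℂ → V} (hf : Continuous f) (hp : Per f) :
    ∫ z, ‖cv K f z‖ ^ 2 ∂mu ≤ ∫ z, ‖f z‖ ^ 2 ∂mu := by
  rw [← cv_mu hK (f := fun z => ‖f z‖ ^ 2) (by fun_prop) (per_nsq hp)]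
  have h1 := cv_cont hK hf
  have h2 := cv_cont hK (f := fun z => ‖f z‖ ^ 2) (by fun_prop)
  exact integral_mono (mu_int (by fun_prop)) (mu_int h2) fun z => cv_jensen hK hf z

theorem UU_lip (h : HQ Q e q r L) {K K2 : ℂ → ℝ} (hK : Ker K) {B : ℝ} (hB : ∀ z ∈ Sq, K z ≤ B) (hK2 : Ker K2) {S : Finset (ℤ × ℤ)} (h0 : 0 ∈ S)
    (hp : ∀ z, (K2 z : ℂ) = ∑ k ∈ S, kk K2 k * ek (-k) z) {a : ℤ × ℤ → V} {c : V} (hs : Sol Q e q K K2 S a c) (x y : ℂ) :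
    ‖UU e (cl q (a 0)) (kk K) S a c x - UU e (cl q (a 0)) (kk K) S a c y‖ ≤ 2 * √(B * (1 - q ^ 2)⁻¹) * ‖x - y‖ := by
  obtain ⟨b1, b2, b3⟩ := sol_basic h hK2 h0 hp hs
  have hB0 : 0 ≤ B := (hK.n 0).trans (hB 0 (by simp [Sq, Complex.mem_reProdIm]))
  have hPc := pp_cont e (fun _ => 1) S a
  have hgc := gg_cont (fun _ => 1) S a
  have hq : q ^ 2 ≤ 1 := by nlinarith [h.q0, h.q1]
  have g2 : ∫ z, ‖gg (fun _ => 1) S a z‖ ^ 2 ∂mu ≤ (1 - q ^ 2)⁻¹ := by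
    simp only [b3]
    refine (cv_int_le hK2 (FF_cont h K S a c) (FF_per K S a c)).trans ((FF_int h K S a c).trans ?_)
    refine (mul_le_of_le_one_left (integral_nonneg fun _ => sq_nonneg _) hq).trans b2
  have bd : ∀ f : ℂ → V, Continuous f → Per f → ∫ z, ‖f z‖ ^ 2 ∂mu ≤ (1 - q ^ 2)⁻¹ → ∀ z, ‖cv K f z‖ ≤ √(B * (1 - q ^ 2)⁻¹) := by
    intro f hf pf hi z
    apply Real.le_sqrt_of_sq_le
    refine (cv_jensen hK hf z).trans ((cv_sup hK (by fun_prop) (per_nsq pf) (fun _ => sq_nonneg _) hB z).trans ?_)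
    gcongr
  have hd : ∀ z, ‖fderiv ℝ (UU e (cl q (a 0)) (kk K) S a c) z‖ ≤ 2 * √(B * (1 - q ^ 2)⁻¹) := by
    intro z
    refine ContinuousLinearMap.opNorm_le_bound _ (by positivity) fun v => ?_
    rw [UU_fderiv e _ c h0 (kk_zero hK) (cl_eq h.q0 b1).symm, ← cv_gg hK, ← cv_pp hK e h0]
    refine (norm_add_le _ _).trans ?_
    rw [norm_smul, norm_smul, Complex.norm_conj]
    have h1 := bd _ hPc (pp_per e _ S a) b2 z
    have h2 := bd _ hgc (gg_per _ S a) g2 z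
    nlinarith [norm_nonneg v]
  exact Convex.norm_image_sub_le_of_norm_fderiv_le (fun z _ => (UU_smooth e _ c (kk K) S a).differentiable (by simp) z) (fun z _ => hd z) convex_univ
    (mem_univ y) (mem_univ x)

theorem sol_res (h : HQ Q e q r L) {K K2 : ℂ → ℝ} (hK : Ker K) {B : ℝ} (hB : ∀ z ∈ Sq, K z ≤ B) (hK2 : Ker K2) {S : Finset (ℤ × ℤ)} (h0 : 0 ∈ S)
    (hp : ∀ z, (K2 z : ℂ) = ∑ k ∈ S, kk K2 k * ek (-k) z) {a : ℤ × ℤ → V} {c : V} (hs : Sol Q e q K K2 S a c) :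
    ∫ z, ‖gg (fun _ => 1) S a z - FF Q e q K S a c z‖ ^ 2 ∂mu ≤
     ((1 - q)⁻¹ * (2 * L * (2 * √(B * (1 - q ^ 2)⁻¹)))) ^ 2 * (1 - q ^ 2)⁻¹ * ∫ t, K2 t * ‖t‖ ^ 2 ∂mu := by
  obtain ⟨b1, b2, b3⟩ := sol_basic h hK2 h0 hp hs
  have hPc := pp_cont e (fun _ => 1) S a
  have hgc := gg_cont (fun _ => 1) S a
  have hFc := FF_cont h K S a c
  have hFp := FF_per (Q := Q) (e := e) (q := q) K S a c
  have hL := h.L0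
  have hq1 := h.q1
  have hK2c := hK2.c
  set Λ := 2 * L * (2 * √(B * (1 - q ^ 2)⁻¹)) with hΛ
  have hΛ0 : 0 ≤ Λ := by positivity
  have hal : ∀ z t, ‖aa Q e q K S a c (z + t) - aa Q e q K S a c z‖ ≤ Λ * ‖t‖ := by
    intro z t
    refine (aa_lip h K S a c _ _).trans ?_
    have := UU_lip h hK hB hK2 h0 hp hs (z + t) z
    rw [add_sub_cancel_left] at this
    exact (mul_le_mul_of_nonneg_left this (by positivity)).trans_eq (by rw [hΛ]; ring)
  have hD : ∀ t, ∫ z, ‖FF Q e q K S a c (z + t) - FF Q e q K S a c z‖ ^ 2 ∂mu ≤ ((1 - q)⁻¹ * Λ) ^ 2 * (1 - q ^ 2)⁻¹ * ‖t‖ ^ 2 := by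
    intro t
    have h1 : ∀ z, ‖FF Q e q K S a c (z + t) - FF Q e q K S a c z‖ ^ 2 ≤
        q * ‖pp e (fun _ => 1) S a (z + t) - pp e (fun _ => 1) S a z‖ ^ 2 + (1 - q)⁻¹ * (Λ * ‖t‖ * ‖pp e (fun _ => 1) S a z‖) ^ 2 := by
      intro z
      refine cvx h.q0.le h.q1 (norm_nonneg _) ?_
      have e1 : FF Q e q K S a c (z + t) - FF Q e q K S a c z = aa Q e q K S a c (z + t) (pp e (fun _ => 1) S a (z + t) - pp e (fun _ => 1) S a z) +
          (aa Q e q K S a c (z + t) - aa Q e q K S a c z) (pp e (fun _ => 1) S a z) := by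
        simp only [FF, map_sub, _root_.sub_apply]; abel
      rw [e1]
      refine (norm_add_le _ _).trans (add_le_add ?_ ?_)
      · exact (ContinuousLinearMap.le_opNorm _ _).trans (by gcongr; exact aa_le h K S a c _)
      · exact (ContinuousLinearMap.le_opNorm _ _).trans (by gcongr; exact hal z t)
    have h2 := integral_mono (μ := mu) (mu_int (by fun_prop)) (mu_int (by fun_prop)) h1
    rw [integral_add (mu_int (by fun_prop)) (mu_int (by fun_prop)), integral_const_mul, integral_const_mul] at h2
    simp only [mul_pow] at h2
    rw [integral_const_mul] at h2
    have h3 := pp_diff e h0 a t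
    have h4 : ∫ z, ‖gg (fun _ => 1) S a (z + t) - gg (fun _ => 1) S a z‖ ^ 2 ∂mu ≤ ∫ z, ‖FF Q e q K S a c (z + t) - FF Q e q K S a c z‖ ^ 2 ∂mu := by
      simp only [b3, cv_sub hK2 hFc]
      exact cv_int_le hK2 (by fun_prop) ⟨fun z => by simp only [add_right_comm z 1 t, hFp.1], fun z => by simp only [add_right_comm z Complex.I t, hFp.2]⟩
    set X := ∫ z, ‖FF Q e q K S a c (z + t) - FF Q e q K S a c z‖ ^ 2 ∂mu
    have hDq : (1 - q)⁻¹ * (1 - q) = 1 := inv_mul_cancel₀ (by linarith)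
    have hD0 : 0 ≤ (1 - q)⁻¹ := inv_nonneg.2 (by linarith)
    have h5 : X ≤ q * X + (1 - q)⁻¹ * (Λ ^ 2 * ‖t‖ ^ 2 * (1 - q ^ 2)⁻¹) := by
      refine h2.trans (add_le_add (mul_le_mul_of_nonneg_left (h3.trans h4) h.q0.le) ?_)
      gcongr
    have h6 := mul_le_mul_of_nonneg_left h5 hD0
    have h7 : X = (1 - q)⁻¹ * X - (1 - q)⁻¹ * (q * X) := by linear_combination -X * hDq
    rw [mul_add] at h6
    calc X = (1 - q)⁻¹ * X - (1 - q)⁻¹ * (q * X) := h7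
      _ ≤ (1 - q)⁻¹ * ((1 - q)⁻¹ * (Λ ^ 2 * ‖t‖ ^ 2 * (1 - q ^ 2)⁻¹)) := by linarith
      _ = _ := by ring
  have hr : ∀ z, ‖gg (fun _ => 1) S a z - FF Q e q K S a c z‖ ^ 2 ≤ ∫ t, K2 t * ‖FF Q e q K S a c (z + t) - FF Q e q K S a c z‖ ^ 2 ∂mu := by
    intro z
    have e1 : gg (fun _ => 1) S a z - FF Q e q K S a c z = ∫ t, K2 t • (FF Q e q K S a c (z + t) - FF Q e q K S a c z) ∂mu := by
      simp only [smul_sub]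
      rw [integral_sub (mu_int (by fun_prop)) (mu_int (by fun_prop)), integral_smul_const, hK2.i, one_smul, b3]; rfl
    rw [e1]
    exact ker_jensen hK2 (by fun_prop)
  have hc2 : Continuous fun z => ∫ t, K2 t * ‖FF Q e q K S a c (z + t) - FF Q e q K S a c z‖ ^ 2 ∂mu :=
    continuous_parametric_integral_of_continuous (f := fun z t => K2 t * ‖FF Q e q K S a c (z + t) - FF Q e q K S a c z‖ ^ 2) (by fun_prop) Sq_compact
  refine (integral_mono (mu_int (by fun_prop)) (mu_int hc2) hr).trans ?_
  rw [swap_cpt Sq_compact Sq_compact (fun z t => K2 t * ‖FF Q e q K S a c (z + t) - FF Q e q K S a c z‖ ^ 2) (by fun_prop), ← integral_const_mul]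
  have hc3 : Continuous fun t => ∫ z, K2 t * ‖FF Q e q K S a c (z + t) - FF Q e q K S a c z‖ ^ 2 ∂mu :=
    continuous_parametric_integral_of_continuous (f := fun t z => K2 t * ‖FF Q e q K S a c (z + t) - FF Q e q K S a c z‖ ^ 2) (by fun_prop) Sq_compact
  refine integral_mono (mu_int hc3) (mu_int (by fun_prop)) fun t => ?_
  simp only [integral_const_mul]
  calc _ ≤ K2 t * (((1 - q)⁻¹ * Λ) ^ 2 * (1 - q ^ 2)⁻¹ * ‖t‖ ^ 2) := mul_le_mul_of_nonneg_left (hD t) (hK2.n t)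
    _ = _ := by ring
end

section
variable {V : Type*} [NormedAddCommGroup V] [InnerProductSpace ℂ V] [FiniteDimensional ℂ V]
variable {Q : V → V →L[ℝ] V} {e : V} {q r L : ℝ}

theorem hold {U : ℂ → V} (hU : ContDiff ℝ 1 U) {G : ℂ → ℝ} (hG : Continuous G) (hd : ∀ z, ‖fderiv ℝ U z‖ ≤ 3 * G z) {C α : ℝ} (h0 : 0 ≤ C) (hα : 0 < α)
    (hα1 : α ≤ 1) (hp : ∀ z s, 0 < s → s ≤ 1/2 → Pot G z s ≤ C * s ^ α) {x y : ℂ} (hxy : ‖x - y‖ ≤ 1) : ‖U x - U y‖ ≤ 36 * C * ‖x - y‖ ^ α := by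
  have hPot : ∀ z s, Pot (fun z => 3 * G z) z s = 3 * Pot G z s := by
    intro z s; simp only [Pot, intervalIntegral.integral_const_mul]
  have h1 : ∀ x y : ℂ, ‖x - y‖ ≤ 1/4 → ‖U x - U y‖ ≤ 9 * C * ‖x - y‖ ^ α := by
    intro x y h
    rcases eq_or_ne x y with rfl | hne
    · rw [sub_self, norm_zero]; positivity
    have hd0 : 0 < ‖x - y‖ := norm_pos_iff.2 (sub_ne_zero.2 hne)
    have := modulus hU (by fun_prop) hd x y
    rw [hPot, hPot] at this
    have a1 := hp y _ hd0 (by linarith)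
    have a2 := hp x (2 * ‖x - y‖) (by linarith) (by linarith)
    rw [Real.mul_rpow (by norm_num) hd0.le] at a2
    have a3 : (2:ℝ) ^ α ≤ 2 := by
      simpa using Real.rpow_le_rpow_of_exponent_le (x := 2) (by norm_num) hα1
    have a4 := mul_le_mul_of_nonneg_left (mul_le_mul_of_nonneg_right a3 (Real.rpow_nonneg hd0.le α)) h0
    linarith
  have h2 : ∀ w : ℂ, ‖U (w + (x - y) / 4) - U w‖ ≤ 9 * C * ‖x - y‖ ^ α := by
    intro w
    have e1 : ‖w + (x - y) / 4 - w‖ = ‖x - y‖ / 4 := by simp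
    have := h1 (w + (x - y) / 4) w (by rw [e1]; linarith)
    rw [e1] at this
    refine this.trans ?_
    gcongr; linarith [norm_nonneg (x - y)]
  have b1 := h2 y
  have b2 := h2 (y + (x - y) / 4)
  have b3 := h2 (y + (x - y) / 4 + (x - y) / 4)
  have b4 := h2 (y + (x - y) / 4 + (x - y) / 4 + (x - y) / 4)
  rw [show y + (x - y) / 4 + (x - y) / 4 + (x - y) / 4 + (x - y) / 4 = x by ring] at b4
  have := norm_sub_le_norm_sub_add_norm_sub (U x) (U (y + (x - y) / 4 + (x - y) / 4 + (x - y) / 4)) (U y)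
  have := norm_sub_le_norm_sub_add_norm_sub (U (y + (x - y) / 4 + (x - y) / 4 + (x - y) / 4)) (U (y + (x - y) / 4 + (x - y) / 4)) (U y)
  have := norm_sub_le_norm_sub_add_norm_sub (U (y + (x - y) / 4 + (x - y) / 4)) (U (y + (x - y) / 4)) (U y)
  linarith

theorem osc {U : ℂ → V} {m : V} (he : ‖e‖ = 1) (hm : ‖m‖ ≤ q) (hU : ∀ k z, U (z + gi k) = U z + lam e m (gi k)) {C : ℝ}
    (h : ∀ x y, ‖x - y‖ ≤ 1 → ‖U x - U y‖ ≤ C) (x y : ℂ) : ‖U x - U y - lam e m (x - y)‖ ≤ C + (1 + q) := by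
  obtain ⟨k, hk⟩ : ∃ k, ‖x - y - gi k‖ ≤ 1 := by
    refine ⟨(round (x - y).re, round (x - y).im), (Complex.norm_le_abs_re_add_abs_im _).trans ?_⟩
    have h1 := abs_sub_round (x - y).re
    have h2 := abs_sub_round (x - y).im
    simp only [gi, Complex.sub_re, Complex.sub_im, Complex.add_re, Complex.add_im, Complex.mul_re, Complex.mul_im, Complex.I_re, Complex.I_im,
      Complex.intCast_re, Complex.intCast_im] at *
    norm_num at *; linarith
  have e1 : U x - U y - lam e m (x - y) = (U x - U (y + gi k)) - lam e m (x - y - gi k) := by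
    rw [hU, lam_sub e m (x - y)]; abel
  rw [e1]
  refine (norm_sub_le _ _).trans (add_le_add (h _ _ (by rwa [← sub_sub])) ((lam_le he hm _).trans ?_))
  have : 0 ≤ q := (norm_nonneg m).trans hm
  exact mul_le_of_le_one_right (by linarith) hk

structure Good (Q : V → V →L[ℝ] V) (e : V) (q C α ε : ℝ) (U : ℂ → V) (m : V) (G : ℂ → ℝ) : Prop where
  s : ContDiff ℝ 2 U
  hm : ‖m‖ ≤ q
  c : Continuous G
  g1 : ∀ z, 1 ≤ G z
  d : ∀ z, ‖fderiv ℝ U z‖ ≤ 3 * G z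
  b : ∀ z, ‖db (fderiv ℝ U z) - per Q e m (U z) (dz (fderiv ℝ U z))‖ ≤ ε * G z
  p : ∀ z s, 0 < s → s ≤ 1/2 → Pot G z s ≤ C * s ^ α
  h : ∀ x y, ‖x - y‖ ≤ 1 → ‖U x - U y‖ ≤ C * ‖x - y‖ ^ α
  l : ∀ x y, ‖U x - U y - lam e m (x - y)‖ ≤ C

theorem Sq_norm {t : ℂ} (ht : t ∈ Sq) : ‖t‖ ≤ 1 := by
  have h := Complex.norm_le_abs_re_add_abs_im t
  have h1 := abs_le.2 ht.1
  have h2 := abs_le.2 ht.2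
  linarith

set_option maxHeartbeats 1000000 in
theorem good_ex (h : HQ Q e q r L) : ∃ C α : ℝ, 0 < C ∧ 0 < α ∧ ∀ ε, 0 < ε → ∃ K K2 : ℂ → ℝ, Ker K ∧ Ker K2 ∧ ∃ S : Finset (ℤ × ℤ), 0 ∈ S ∧
    ∀ a c, Sol Q e q K K2 S a c → ∃ G, Good Q e q C α ε (UU e (cl q (a 0)) (kk K) S a c) (cl q (a 0)) G := by
  obtain ⟨C0, β, hC0, hβ, hβ1, hM⟩ := morrey (V := V) h.q0.le h.q1
  have hpi := Real.pi_pos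
  have hq : 0 < (1 - q ^ 2)⁻¹ := inv_pos.2 (by nlinarith [h.q0, h.q1])
  obtain ⟨D, hD⟩ : ∃ D, D = (1 - q ^ 2)⁻¹ + 1 := ⟨_, rfl⟩
  have hD1 : 1 < D := by linarith
  obtain ⟨C1, hC1⟩ : ∃ C1, C1 = Real.pi + C0 * (1 + D) + Real.pi / (β / 2) := ⟨_, rfl⟩
  have hC10 : 0 < C1 := by rw [hC1]; positivity
  have hL := h.L0
  refine ⟨36 * C1 + 3, β / 2, by positivity, by positivity, fun ε hε => ?_⟩
  obtain ⟨Λ, hΛ⟩ : ∃ Λ, Λ = 2 * L * (36 * C1) := ⟨_, rfl⟩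
  have hΛ0 : 0 ≤ Λ := by rw [hΛ]; positivity
  obtain ⟨K, hK, hKe, -⟩ := kernel' (fun t => ‖t‖ ^ β) (continuous_norm.rpow_const fun _ => Or.inr hβ.le) (by simp [hβ.ne'])
    (ε := (ε / 2) ^ 2 / (Λ ^ 2 + 1)) (by positivity)
  obtain ⟨B, hB⟩ : ∃ B, ∀ z ∈ Sq, K z ≤ B := (Sq_compact.bddAbove_image hK.c.continuousOn).imp fun B hB z hz => hB (mem_image_of_mem _ hz)
  have hB0 : 0 ≤ B := (hK.n 0).trans (hB 0 (by simp [Sq, Complex.mem_reProdIm]))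
  obtain ⟨s1, hs1⟩ : ∃ s1, s1 = (1 + B * D)⁻¹ := ⟨_, rfl⟩
  have hs10 : 0 < s1 := by rw [hs1]; positivity
  obtain ⟨η, hη, hηa, hηb, hηc⟩ : ∃ η : ℝ, 0 < η ∧ η ≤ 1 ∧ η ≤ s1 ^ β ∧ B * η ≤ (ε / 2) ^ 2 := by
    refine ⟨min 1 (min (s1 ^ β) ((ε / 2) ^ 2 / (B + 1))), by positivity, min_le_left _ _, (min_le_right _ _).trans (min_le_left _ _), ?_⟩
    refine (mul_le_mul_of_nonneg_left ((min_le_right _ _).trans (min_le_right _ _)) hB0).trans ?_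
    rw [mul_div_assoc', div_le_iff₀ (by positivity)]
    linarith [sq_nonneg (ε / 2)]
  obtain ⟨A, hA⟩ : ∃ A, A = ((1 - q)⁻¹ * (2 * L * (2 * √(B * (1 - q ^ 2)⁻¹)))) ^ 2 * (1 - q ^ 2)⁻¹ := ⟨_, rfl⟩
  have hA0 : 0 ≤ A := by rw [hA]; positivity
  obtain ⟨K2, hK2, hK2e, S, h0, hp⟩ := kernel' (fun t => ‖t‖ ^ 2) (by fun_prop) (by simp) (ε := η / (A + 1)) (by positivity)
  refine ⟨K, K2, hK, hK2, S, h0, fun a c hs => ?_⟩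
  obtain ⟨b1, b2, b3⟩ := sol_basic h hK2 h0 hp hs
  have hres := sol_res h hK hB hK2 h0 hp hs
  rw [← hA] at hres
  have hres' := hres.trans (mul_le_mul_of_nonneg_left hK2e.le hA0)
  rw [mul_div_assoc'] at hres'
  replace hres' := hres'.trans ((div_le_iff₀ (by positivity)).2 (show A * η ≤ η * (A + 1) by linarith))
  have hm := cl_eq h.q0 b1
  have hfd : ∀ z v, fderiv ℝ (UU e (cl q (a 0)) (kk K) S a c) z v = v • cv K (pp e (fun _ => 1) S a) z + (starRingEnd ℂ) v • cv K (gg (fun _ => 1) S a) z := by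
    intro z v; rw [UU_fderiv e _ c h0 (kk_zero hK) hm.symm, cv_gg hK, cv_pp hK e h0]
  have hfd0 : ∀ z v, fderiv ℝ (UU e (a 0) (fun _ => 1) S a c) z v = v • pp e (fun _ => 1) S a z + (starRingEnd ℂ) v • gg (fun _ => 1) S a z :=
    UU_fderiv e _ c h0 rfl rfl
  have hal := aa_lip h K S a c
  have hgi := UU_gi e (cl q (a 0)) c (kk K) S a
  have h2i : (2 : WithTop ℕ∞) ≤ ∞ := ENat.LEInfty.out
  have hUs := (UU_smooth e (cl q (a 0)) c (kk K) S a).of_le h2i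
  have hUs0 := (UU_smooth e (a 0) c (fun _ => 1) S a).of_le h2i
  have hPc := pp_cont e (fun _ => 1) S a
  have hPp := pp_per e (fun _ => 1) S a
  have hgc := gg_cont (fun _ => 1) S a
  have hgp := gg_per (fun _ => 1) S a
  have hFc := FF_cont h K S a c
  have hFp := FF_per (Q := Q) (e := e) (q := q) K S a c
  have hFl := FF_le h K S a c
  have hFd : ∀ z, FF Q e q K S a c z = aa Q e q K S a c z (pp e (fun _ => 1) S a z) := fun z => rfl
  have haad : ∀ z, aa Q e q K S a c z = per Q e (cl q (a 0)) (UU e (cl q (a 0)) (kk K) S a c z) := fun z => rfl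
  generalize UU e (cl q (a 0)) (kk K) S a c = U at *
  generalize UU e (a 0) (fun _ => 1) S a c = u at *
  generalize aa Q e q K S a c = T at *
  generalize FF Q e q K S a c = F at *
  generalize pp e (fun _ => 1) S a = P at *
  generalize gg (fun _ => 1) S a = g at *
  obtain ⟨R, hR⟩ : ∃ R : ℂ → V, R = fun z => g z - F z := ⟨_, rfl⟩
  have hRc : Continuous R := by rw [hR]; fun_prop
  have hRp : Per R := by rw [hR]; exact ⟨fun z => by simp only [hgp.1, hFp.1], fun z => by simp only [hgp.2, hFp.2]⟩
  have hgR : ∀ z, g z = F z + R z := fun z => by rw [hR]; simp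
  replace hres' : ∫ z, ‖R z‖ ^ 2 ∂mu ≤ η := by rw [hR]; exact hres'
  obtain ⟨H, hH⟩ : ∃ H : ℂ → ℝ, H = fun z => ‖P z‖ ^ 2 + ‖R z‖ ^ 2 := ⟨_, rfl⟩
  have hHc : Continuous H := by rw [hH]; fun_prop
  have hHp : Per H := by rw [hH]; exact ⟨fun z => by simp only [hPp.1, hRp.1], fun z => by simp only [hPp.2, hRp.2]⟩
  have hHn : ∀ z, 0 ≤ H z := fun z => by rw [hH]; positivity
  have hHi : ∫ z, H z ∂mu ≤ D := by
    rw [hH, integral_add (mu_int (by fun_prop)) (mu_int (by fun_prop)), hD]; linarith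
  have hmor : ∀ z s, 0 < s → s ≤ 1/2 → ∫ y in Metric.closedBall z s, H y ≤ C0 * (η + s ^ β * D) := by
    intro z s h1 h2
    have := hM u P g R hUs0 hPc hgc hRc hfd0 hPp hRp (fun y => by rw [hgR, add_sub_cancel_right]; exact hFl y) z s h1 h2
    rw [hH]
    refine this.trans ?_
    rw [hH] at hHi
    gcongr
  have hHK := cv_cont hK hHc
  have hHK0 := cv_nonneg hK hHn
  have hKc := hK.c
  have hmono : ∀ f : ℂ → ℝ, ∀ z, Continuous f → (∀ y, f y ≤ H y) → cv K f z ≤ cv K H z := fun f z hf hle =>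
    integral_mono (mu_int (by fun_prop)) (mu_int (by fun_prop)) fun t => mul_le_mul_of_nonneg_left (hle _) (hK.n t)
  have hsup : ∀ z, cv K H z ≤ B * D := fun z => (cv_sup hK hHc hHp hHn hB z).trans (by gcongr)
  obtain ⟨G, hGd⟩ : ∃ G : ℂ → ℝ, G = fun z => √(1 + cv K H z) := ⟨_, rfl⟩
  have hGc : Continuous G := by rw [hGd]; fun_prop
  have hG2 : ∀ z, G z ^ 2 = 1 + cv K H z := fun z => by rw [hGd]; exact Real.sq_sqrt (by linarith [hHK0 z])
  have hG1 : ∀ z, 1 ≤ G z := fun z => by rw [hGd]; exact Real.one_le_sqrt.2 (by linarith [hHK0 z])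
  have hball : ∀ z s, 0 < s → s ≤ 1/2 → ∫ y in Metric.closedBall z s, cv K H y ≤ C0 * (η + s ^ β * D) := by
    intro z s h1 h2
    rw [cv_set hK hHc (isCompact_closedBall z s)]
    have e1 : ∀ t, ∫ y in Metric.closedBall z s, H (y + t) = ∫ y in Metric.closedBall (z + t) s, H y := by
      intro t
      rw [← (measurePreserving_add_right volume t).setIntegral_preimage_emb (measurableEmbedding_addRight t) H]
      congr 2; ext y; simp
    simp only [e1]
    have hci : Continuous fun t => ∫ y in Metric.closedBall z s, H (y + t) :=
      continuous_parametric_integral_of_continuous (f := fun t y => H (y + t)) (by fun_prop) (isCompact_closedBall z s)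
    simp only [e1] at hci
    calc _ ≤ ∫ t, K t * (C0 * (η + s ^ β * D)) ∂mu := integral_mono (mu_int (hKc.mul hci)) (mu_int (by fun_prop)) fun t =>
          mul_le_mul_of_nonneg_left (hmor _ s h1 h2) (hK.n t)
      _ = _ := by rw [integral_mul_const, hK.i, one_mul]
  have hGi : ∀ z s, 0 < s → s ≤ 1/2 → ∫ y in Metric.closedBall z s, G y ^ 2 ≤ (Real.pi + C0 * (1 + D)) * s ^ (2 * (β / 2)) := by
    intro z s h1 h2
    rw [mul_div_cancel₀ β two_ne_zero]
    have hsb : s ≤ s ^ β := by simpa using Real.rpow_le_rpow_of_exponent_ge h1 (by linarith) hβ1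
    have hci : ∀ f : ℂ → ℝ, Continuous f → IntegrableOn f (Metric.closedBall z s) := fun f hf => hf.continuousOn.integrableOn_compact (isCompact_closedBall z s)
    rcases le_total s1 s with h3 | h3
    · simp only [hG2]
      rw [integral_add (hci _ (by fun_prop)) (hci _ hHK), setIntegral_const, smul_eq_mul, mul_one, vol_cb z h1.le]
      have h4 := hball z s h1 h2
      have h5 : η ≤ s ^ β := hηb.trans (by gcongr)
      have h6 : s ^ 2 ≤ s ^ β := by rw [sq]; exact (mul_le_of_le_one_left h1.le (by linarith)).trans hsb
      calc _ ≤ Real.pi * s ^ β + C0 * (s ^ β + s ^ β * D) := by gcongr; exact h4.trans (by gcongr)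
        _ = _ := by ring
    · calc _ ≤ ∫ y in Metric.closedBall z s, (1 + B * D) := integral_mono (hci _ (by fun_prop)) (hci _ (by fun_prop)) fun y => by
            simp only [hG2]; linarith [hsup y]
        _ = Real.pi * (s * (s * (1 + B * D))) := by rw [setIntegral_const, smul_eq_mul, vol_cb z h1.le]; ring
        _ ≤ Real.pi * (s ^ β * 1) := by
            gcongr
            calc _ ≤ s1 * (1 + B * D) := by gcongr
              _ = 1 := by rw [hs1]; exact inv_mul_cancel₀ (by positivity)
        _ ≤ _ := by rw [mul_one]; gcongr; linarith [show 0 ≤ C0 * (1 + D) by positivity]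
  have hPot : ∀ z s, 0 < s → s ≤ 1/2 → Pot G z s ≤ C1 * s ^ (β / 2) := by
    intro z s h1 h2
    rw [hC1]
    exact pot_bound hGc (by positivity) h1 fun t ht => hGi z t ht.1 (ht.2.trans h2)
  have hd : ∀ z, ‖fderiv ℝ U z‖ ≤ 3 * G z := by
    intro z
    have hn : 0 ≤ G z := by linarith [hG1 z]
    have h1 : ‖cv K P z‖ ≤ G z := by
      refine abs_le_of_sq_le_sq' ?_ hn |>.2
      rw [hG2]
      refine (cv_jensen hK hPc z).trans ((hmono _ z (by fun_prop) fun y => by rw [hH]; exact le_add_of_nonneg_right (sq_nonneg _)).trans (by linarith))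
    have h2 : ‖cv K g z‖ ≤ 2 * G z := by
      refine abs_le_of_sq_le_sq' ?_ (by linarith) |>.2
      rw [mul_pow, hG2]
      refine (cv_jensen hK hgc z).trans ?_
      have h3 := hmono (fun y => 2⁻¹ * ‖g y‖ ^ 2) z (by fun_prop) fun y => by
        have a1 : ‖g y‖ ≤ ‖P y‖ + ‖R y‖ := by
          rw [hgR]; exact (norm_add_le _ _).trans (by gcongr; exact (hFl y).trans (mul_le_of_le_one_left (norm_nonneg _) h.q1.le))
        rw [hH]; simp only
        linarith [sq_nonneg (‖P y‖ - ‖R y‖), pow_le_pow_left₀ (norm_nonneg (g y)) a1 2]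
      have h4 : cv K (fun y => 2⁻¹ * ‖g y‖ ^ 2) z = 2⁻¹ * cv K (fun y => ‖g y‖ ^ 2) z := by
        simp only [cv, smul_eq_mul, ← integral_const_mul]; congr 1; ext t; ring
      linarith [hHK0 z]
    refine ContinuousLinearMap.opNorm_le_bound _ (by linarith) fun v => ?_
    rw [hfd]
    refine (norm_add_le _ _).trans ?_
    rw [norm_smul, norm_smul, Complex.norm_conj]
    have h5 := mul_le_mul_of_nonneg_left h1 (norm_nonneg v)
    have h6 := mul_le_mul_of_nonneg_left h2 (norm_nonneg v)
    linarith
  have hhold : ∀ x y, ‖x - y‖ ≤ 1 → ‖U x - U y‖ ≤ 36 * C1 * ‖x - y‖ ^ (β / 2) := fun x y hxy =>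
    hold (hUs.of_le one_le_two) hGc hd hC10.le (by positivity) (by linarith) hPot hxy
  refine ⟨G, hUs, cl_le h.q0 _, hGc, hG1, hd, fun z => ?_, fun z s h1 h2 => (hPot z s h1 h2).trans (by gcongr; linarith),
    fun x y hxy => (hhold x y hxy).trans (by gcongr; linarith), fun x y => (osc h.he (cl_le h.q0 _) hgi (fun x y hxy => (hhold x y hxy).trans
      (mul_le_of_le_one_right (by positivity) (Real.rpow_le_one (norm_nonneg _) hxy (by positivity)))) x y).trans (by linarith [h.q1])⟩
  rw [dz_of (hfd z), db_of (hfd z), ← haad]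
  have e1 : cv K g z - T z (cv K P z) = ∫ t, K t • (g (z + t) - T z (P (z + t))) ∂mu := by
    simp only [smul_sub]
    rw [integral_sub (mu_int (by fun_prop)) (mu_int (by fun_prop)), cv, cv, ← ContinuousLinearMap.integral_comp_comm _ (mu_int (by fun_prop))]
    simp only [map_smul]
  rw [e1]
  have hac : Continuous fun t : ℂ => Λ * ‖t‖ ^ (β / 2) := (continuous_norm.rpow_const fun _ => Or.inr (by positivity)).const_mul Λ |>.congr fun _ => rfl
  have e2 : ‖∫ t, K t • (g (z + t) - T z (P (z + t))) ∂mu‖ ≤ ∫ t, (K t * (1 * ‖R (z + t)‖) + K t * (Λ * ‖t‖ ^ (β / 2) * ‖P (z + t)‖)) ∂mu := by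
    refine (norm_integral_le_integral_norm _).trans (setIntegral_mono_on (mu_int (by fun_prop)) (mu_int (by fun_prop)) Sq_compact.measurableSet fun t ht => ?_)
    rw [norm_smul, Real.norm_of_nonneg (hK.n t), ← mul_add, one_mul]
    refine mul_le_mul_of_nonneg_left ?_ (hK.n t)
    have e3 : g (z + t) - T z (P (z + t)) = R (z + t) + (T (z + t) - T z) (P (z + t)) := by
      rw [hgR, hFd, _root_.sub_apply]; abel
    rw [e3]
    refine (norm_add_le _ _).trans (add_le_add_right ((ContinuousLinearMap.le_opNorm _ _).trans ?_) _)
    gcongr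
    refine (hal _ _).trans ?_
    have := hhold (z + t) z (by rw [add_sub_cancel_left]; exact Sq_norm ht)
    rw [add_sub_cancel_left] at this
    exact (mul_le_mul_of_nonneg_left this (by positivity)).trans_eq (by rw [hΛ]; ring)
  refine e2.trans ?_
  rw [integral_add (mu_int (by fun_prop)) (mu_int (by fun_prop))]
  have c1 := cs_mu (K := K) (a := fun _ => 1) (b := fun t => ‖R (z + t)‖) hKc continuous_const (by fun_prop) hK.n
  have c2 := cs_mu (K := K) (b := fun t => ‖P (z + t)‖) hKc hac (by fun_prop) hK.n
  have d1 : ∫ t, K t * (1 * ‖R (z + t)‖) ∂mu ≤ ε / 2 := by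
    refine abs_le_of_sq_le_sq' (c1.trans ?_) (by positivity) |>.2
    simp only [one_pow, mul_one, hK.i, one_mul]
    refine (cv_sup hK (f := fun y => ‖R y‖ ^ 2) (by fun_prop) (per_nsq hRp) (fun _ => sq_nonneg _) hB z).trans ((mul_le_mul_of_nonneg_left hres' hB0).trans hηc)
  have d2 : ∫ t, K t * (Λ * ‖t‖ ^ (β / 2) * ‖P (z + t)‖) ∂mu ≤ ε / 2 * G z := by
    refine abs_le_of_sq_le_sq' (c2.trans ?_) (by have := hG1 z; positivity) |>.2
    rw [mul_pow, hG2]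
    refine mul_le_mul ?_ ?_ (integral_nonneg fun t => mul_nonneg (hK.n t) (sq_nonneg _)) (sq_nonneg _)
    · have : ∀ t : ℂ, K t * (Λ * ‖t‖ ^ (β / 2)) ^ 2 = Λ ^ 2 * (K t * ‖t‖ ^ β) := fun t => by
        rw [mul_pow, ← Real.rpow_natCast (‖t‖ ^ (β / 2)), ← Real.rpow_mul (norm_nonneg t)]; push_cast; rw [div_mul_cancel₀ β two_ne_zero]; ring
      simp only [this]
      rw [integral_const_mul]
      refine (mul_le_mul_of_nonneg_left hKe.le (sq_nonneg _)).trans ?_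
      rw [mul_div_assoc', div_le_iff₀ (by positivity)]
      linarith [sq_nonneg (ε / 2)]
    · exact (hmono (fun y => ‖P y‖ ^ 2) z (by fun_prop) fun y => by rw [hH]; exact le_add_of_nonneg_right (sq_nonneg _)).trans (by linarith)
  linarith [mul_le_mul_of_nonneg_left (hG1 z) (half_pos hε).le]
end

section
variable {V : Type*} [NormedAddCommGroup V] [InnerProductSpace ℂ V] [FiniteDimensional ℂ V]
variable {Q : V → V →L[ℝ] V} {e : V} {q r L : ℝ}

theorem Good.tr {C α ε : ℝ} {U : ℂ → V} {m : V} {G : ℂ → ℝ} (h : Good Q e q C α ε U m G) (w : ℂ) :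
    Good Q e q C α ε (fun z => U (z + w)) m (fun z => G (z + w)) := by
  have hs := h.s
  have hc := h.c
  refine ⟨by fun_prop, h.hm, by fun_prop, fun z => h.g1 _, fun z => ?_, fun z => ?_, fun z s h1 h2 => ?_, fun x y hxy => ?_, fun x y => ?_⟩
  · rw [fderiv_comp_add_right]; exact h.d _
  · rw [fderiv_comp_add_right]; exact h.b _
  · have := h.p (z + w) s h1 h2
    simp only [Pot, circleMap] at *
    simpa only [add_right_comm] using this
  · simpa using h.h (x + w) (y + w) (by simpa using hxy)
  · simpa using h.l (x + w) (y + w)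

def exs (S : Finset (ℤ × ℤ)) (x : S → V) (k : ℤ × ℤ) : V := if h : k ∈ S then x ⟨k, h⟩ else 0
theorem exs_cont (S : Finset (ℤ × ℤ)) (k : ℤ × ℤ) : Continuous fun x : S → V => exs S x k := by
  unfold exs; split <;> fun_prop

theorem brw (h : HQ Q e q r L) {K K2 : ℂ → ℝ} (hK2 : Ker K2) {S : Finset (ℤ × ℤ)} (h0 : 0 ∈ S) (p e2 : V) {T : ℝ} (hT : 0 < T)
    (D : ((ℂ → V) → ℝ)) (hD : ∀ F : (S → V) × ℝ → ℂ → V, Continuous (fun x : ((S → V) × ℝ) × ℂ => F x.1 x.2) → Continuous fun θ => D (F θ)) :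
    ∃ (a : ℤ × ℤ → V) (τ : ℝ), Sol Q e q K K2 S a (p + (τ : ℂ) • e2) ∧ τ = max 0 (min T (τ - D (UU e (cl q (a 0)) (kk K) S a (p + (τ : ℂ) • e2)))) := by
  have hcU : Continuous fun x : ((S → V) × ℝ) × ℂ => UU e (cl q (exs S x.1.1 0)) (kk K) S (exs S x.1.1) (p + (x.1.2 : ℂ) • e2) x.2 := by
    have := exs_cont (V := V) S
    have h2 := ek_cont
    have h3 := cl_cont (V := V) h.q0
    unfold UU su lam
    fun_prop
  have hcF : Continuous fun x : ((S → V) × ℝ) × ℂ => FF Q e q K S (exs S x.1.1) (p + (x.1.2 : ℂ) • e2) x.2 := by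
    have h1 : Continuous fun x : ((S → V) × ℝ) × ℂ => aa Q e q K S (exs S x.1.1) (p + (x.1.2 : ℂ) • e2) x.2 :=
      (per_cont (Q := Q) h.q0 h.he h.z h.q1 h.cont).comp
        (((exs_cont S 0).comp (continuous_fst.comp continuous_fst)).prodMk hcU)
    have h2 : Continuous fun x : ((S → V) × ℝ) × ℂ => pp e (fun _ => 1) S (exs S x.1.1) x.2 := by
      have := exs_cont (V := V) S
      have h2 := ek_cont
      unfold pp
      fun_prop
    exact h1.clm_apply h2
  have hcP : ∀ k, Continuous fun θ : (S → V) × ℝ => Phi Q e q K K2 S (exs S θ.1) (p + (θ.2 : ℂ) • e2) k := by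
    intro k
    have h2 := ek_cont (-k)
    have h3 : Continuous fun x : ((S → V) × ℝ) × ℂ => ek (-k) x.2 • FF Q e q K S (exs S x.1.1) (p + (x.1.2 : ℂ) • e2) x.2 := (h2.comp continuous_snd).smul hcF
    have h4 := continuous_parametric_integral_of_continuous (μ := volume) (f := fun (θ : (S → V) × ℝ) t => ek (-k) t • FF Q e q K S (exs S θ.1) (p + (θ.2 : ℂ) • e2) t) h3 Sq_compact
    exact h4.const_smul (kk K2 k)
  have hcD := hD (fun θ z => UU e (cl q (exs S θ.1 0)) (kk K) S (exs S θ.1) (p + (θ.2 : ℂ) • e2) z) hcU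
  let _ : InnerProductSpace ℝ V := InnerProductSpace.complexToReal
  let X := WithLp 2 (PiLp 2 (fun _ : S => V) × ℝ)
  let j : X → (S → V) × ℝ := fun x => (fun i => x.fst i, x.snd)
  have hj : Continuous j := by fun_prop
  obtain ⟨f, hf⟩ : ∃ f : X → X, f = fun x => WithLp.toLp 2 (WithLp.toLp 2 (fun i : S => Phi Q e q K K2 S (exs S (j x).1) (p + ((j x).2 : ℂ) • e2) i),
    max 0 (min T ((j x).2 - D (UU e (cl q (exs S (j x).1 0)) (kk K) S (exs S (j x).1) (p + ((j x).2 : ℂ) • e2))))) := ⟨_, rfl⟩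
  have hfc : Continuous f := by
    have h1 := fun k => (hcP k).comp hj
    have h2 := hcD.comp hj
    rw [hf]
    exact (WithLp.prod_continuous_toLp 2 _ _).comp (((PiLp.continuous_toLp 2 _).comp (continuous_pi fun i : S => h1 i)).prodMk
      (continuous_const.max (continuous_const.min ((continuous_snd.comp hj).sub h2))))
  have hq : 0 < 1 - q ^ 2 := by nlinarith [h.q0, h.q1]
  obtain ⟨R, hR⟩ : ∃ R, R = √((q ^ 2 + T ^ 2) / (1 - q ^ 2)) := ⟨_, rfl⟩
  have hR0 : 0 < R := by rw [hR]; positivity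
  have hR2 : R ^ 2 * (1 - q ^ 2) = q ^ 2 + T ^ 2 := by rw [hR, Real.sq_sqrt (by positivity)]; field_simp
  have hN : ∀ x : X, ‖x‖ ^ 2 = (∑ i, ‖x.fst i‖ ^ 2) + x.snd ^ 2 := by
    intro x; rw [WithLp.prod_norm_sq_eq_of_L2, PiLp.norm_sq_eq_of_L2, Real.norm_eq_abs, sq_abs]
  obtain ⟨x, -, hx⟩ := brouwer f hfc R hR0 fun x hx => by
    refine abs_le_of_sq_le_sq' ?_ hR0.le |>.2
    have h1 : ∑ k ∈ S.erase 0, ‖exs S (j x).1 k‖ ^ 2 ≤ ∑ i, ‖x.fst i‖ ^ 2 := by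
      refine (Finset.sum_le_sum_of_subset_of_nonneg (Finset.erase_subset 0 S) fun _ _ _ => sq_nonneg _).trans_eq ?_
      rw [← Finset.sum_coe_sort]
      exact Finset.sum_congr rfl fun i _ => by simp [exs, j]
    have h2 := Phi_le h K S (exs S (j x).1) (p + ((j x).2 : ℂ) • e2) hK2 h0
    rw [← Finset.sum_coe_sort] at h2
    have h3 := hN x
    have h4 := pow_le_pow_left₀ (norm_nonneg x) hx 2
    have h5 := hN (f x)
    have h6 : (f x).snd ^ 2 ≤ T ^ 2 := by
      rw [hf]
      exact pow_le_pow_left₀ (le_max_left _ _) (max_le hT.le (min_le_left _ _)) 2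
    have h7 : ∑ i, ‖(f x).fst i‖ ^ 2 = ∑ i : S, ‖Phi Q e q K K2 S (exs S (j x).1) (p + ((j x).2 : ℂ) • e2) i‖ ^ 2 := by rw [hf]; rfl
    rw [h5, h7]
    have h8 := mul_le_mul_of_nonneg_left (h1.trans (show _ ≤ R ^ 2 by linarith [sq_nonneg x.snd])) (sq_nonneg q)
    linarith
  refine ⟨exs S (j x).1, (j x).2, fun k hk => ?_, ?_⟩
  · have : (f x).fst ⟨k, hk⟩ = x.fst ⟨k, hk⟩ := by rw [hx]
    rw [hf] at this
    rw [exs, dif_pos hk]; exact this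
  · have : (f x).snd = x.snd := by rw [hx]
    rw [hf] at this
    exact this.symm

theorem touch (h : HQ Q e q r L) {e2 : V} (he2 : ‖e2‖ = 1) (hp : inner ℂ e e2 = 0) {A : Set V} (hA : A.Nonempty) (hAr : ∀ x ∈ A, ‖x‖ ≤ r) :
    ∃ C α : ℝ, 0 < C ∧ 0 < α ∧ ∀ ε δ, 0 < ε → 0 < δ → δ ≤ 1 → ∃ U m G, Good Q e q C α ε U m G ∧ (∀ z, δ ≤ Metric.infDist (U z) A) ∧
      Metric.infDist (U 0) A ≤ δ := by
  obtain ⟨C, α, hC, hα, H⟩ := good_ex h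
  refine ⟨C, α, hC, hα, fun ε δ hε hδ hδ1 => ?_⟩
  obtain ⟨K, K2, hK, hK2, S, h0, H⟩ := H ε hε
  obtain ⟨p, hpA⟩ := hA
  have hr : 0 ≤ r := (norm_nonneg p).trans (hAr p hpA)
  have hq1 : 0 < 1 - q := by linarith [h.q1]
  have hq0 := h.q0
  obtain ⟨X, hX⟩ : ∃ X, X = 1 + 2 * r + C := ⟨_, rfl⟩
  have hX0 : 0 < X := by rw [hX]; positivity
  obtain ⟨T, hT⟩ : ∃ T, T = X + (1 + q) * (X / (1 - q)) + 1 := ⟨_, rfl⟩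
  have hT0 : 0 < T := by rw [hT]; positivity
  obtain ⟨Z, hZ⟩ : ∃ Z, Z = (X + T) / (1 - q) := ⟨_, rfl⟩
  have hZ0 : 0 < Z := by rw [hZ]; positivity
  let D : (ℂ → V) → ℝ := fun F => sInf ((fun z => Metric.infDist (F z) A) '' Metric.closedBall 0 Z) - δ
  obtain ⟨a, τ, hs, hτ⟩ := brw (K := K) h hK2 h0 p e2 hT0 D fun F hF =>
    ((isCompact_closedBall (0:ℂ) Z).continuous_sInf (f := fun θ z => Metric.infDist (F θ z) A) ((Metric.continuous_infDist_pt A).comp hF)).sub continuous_const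
  obtain ⟨G, hG⟩ := H a _ hs
  have hU0 : UU e (cl q (a 0)) (kk K) S a (p + (τ : ℂ) • e2) 0 = p + (τ : ℂ) • e2 := by simp [UU, lam]
  generalize UU e (cl q (a 0)) (kk K) S a (p + (τ : ℂ) • e2) = U at *
  generalize cl q (a 0) = m at *
  have hUc : Continuous fun z => Metric.infDist (U z) A := (Metric.continuous_infDist_pt A).comp hG.s.continuous
  obtain ⟨w, hw, hw1⟩ := (isCompact_closedBall (0:ℂ) Z).exists_sInf_image_eq ⟨0, by simp [hZ0.le]⟩ hUc.continuousOn
  have hbdd : BddBelow ((fun z => Metric.infDist (U z) A) '' Metric.closedBall 0 Z) := ⟨0, by rintro _ ⟨z, -, rfl⟩; exact Metric.infDist_nonneg⟩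
  have hτ0 : 0 ≤ τ := by rw [hτ]; exact le_max_left _ _
  have hτT : τ ≤ T := by rw [hτ]; exact max_le hT0.le (min_le_left _ _)
  have hpt : ∀ z : ℂ, Metric.infDist (U z) A ≤ 1 → ∀ η > 0, ‖(τ : ℂ) • e2 + lam e m z‖ ≤ X + η := by
    intro z hz η hη
    obtain ⟨y, hy, hy1⟩ := (Metric.infDist_lt_iff ⟨p, hpA⟩).1 (lt_of_le_of_lt hz (lt_add_of_pos_right 1 hη))
    have h1 := hG.l z 0
    rw [hU0, sub_zero] at h1
    have e1 : (τ : ℂ) • e2 + lam e m z = (U z - y) + (y - p) - (U z - (p + (τ : ℂ) • e2) - lam e m z) := by abel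
    rw [e1]
    refine (norm_sub_le _ _).trans ?_
    have h2 := norm_add_le (U z - y) (y - p)
    have h3 := norm_sub_le y p
    rw [dist_eq_norm] at hy1
    linarith [hAr y hy, hAr p hpA]
  have hpt' : ∀ z : ℂ, Metric.infDist (U z) A ≤ 1 → ‖(τ : ℂ) • e2 + lam e m z‖ ≤ X := fun z hz => le_of_forall_pos_le_add (hpt z hz)
  have hfar : ∀ z, z ∉ Metric.closedBall (0:ℂ) Z → 1 < Metric.infDist (U z) A := by
    intro z hz
    by_contra! hc
    refine hz (mem_closedBall_zero_iff.2 ?_)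
    have h1 := hpt' z hc
    have h2 := norm_sub_le ((τ : ℂ) • e2 + lam e m z) ((τ : ℂ) • e2)
    rw [add_sub_cancel_left, norm_smul, he2, mul_one, Complex.norm_real, Real.norm_of_nonneg hτ0] at h2
    rw [hZ, le_div_iff₀ hq1]
    linarith [lam_ge h.he hG.hm z]
  have key : D U = 0 := by
    rcases lt_trichotomy (D U) 0 with hd | hd | hd
    · have hτ2 : τ = T := by
        rcases le_total T (τ - D U) with h1 | h1
        · rw [hτ, min_eq_left h1, max_eq_right hT0.le]
        · rw [min_eq_right h1, max_eq_right (by linarith)] at hτ; linarith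
      exfalso
      have h1 := hpt' w (by rw [← hw1]; simp only [D] at hd; linarith)
      have h2 := hG.hm
      have h3 : (1 - q) * ‖w‖ ≤ X := by
        have h4 := norm_inner_le_norm (𝕜 := ℂ) e ((τ : ℂ) • e2 + lam e m w)
        rw [h.he, one_mul, inner_add_right, inner_smul_right, hp, mul_zero, zero_add, lam, inner_add_right, inner_smul_right, inner_smul_right,
          inner_self_eq_norm_sq_to_K, h.he] at h4
        have h5 := norm_inner_le_norm (𝕜 := ℂ) e m
        rw [h.he, one_mul] at h5
        have h6 := norm_sub_le_norm_add (w * ((1:ℝ) : ℂ) ^ 2) ((starRingEnd ℂ) w * inner ℂ e m)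
        rw [norm_mul, norm_mul, Complex.norm_conj] at h6
        have h7 := mul_le_mul_of_nonneg_left (h5.trans h2) (norm_nonneg w)
        simp only [Complex.ofReal_one, one_pow, norm_one, mul_one] at h6
        have h8 : ‖w + (starRingEnd ℂ) w * inner ℂ e m‖ ≤ X := by simpa [lam] using h4.trans h1
        linarith
      have h4 := norm_sub_le ((τ : ℂ) • e2 + lam e m w) (lam e m w)
      rw [add_sub_cancel_right, norm_smul, he2, mul_one, Complex.norm_real, Real.norm_of_nonneg hτ0, hτ2] at h4
      rw [hτ2] at h1
      have h5 := lam_le h.he h2 w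
      have h6 : ‖w‖ ≤ X / (1 - q) := by rw [le_div_iff₀ hq1]; linarith
      have h7 := mul_le_mul_of_nonneg_left h6 (show 0 ≤ 1 + q by linarith)
      linarith
    · exact hd
    · exfalso
      have hτ2 : τ = 0 := by
        by_contra hne
        have : 0 < τ := lt_of_le_of_ne hτ0 (Ne.symm hne)
        have h2 := max_lt this ((min_le_right T _).trans_lt (show τ - D U < τ by linarith))
        linarith
      have h1 : sInf ((fun z => Metric.infDist (U z) A) '' Metric.closedBall 0 Z) ≤ Metric.infDist (U 0) A := csInf_le hbdd ⟨0, by simp [hZ0.le], rfl⟩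
      rw [hU0, hτ2] at h1
      simp only [Complex.ofReal_zero, zero_smul, add_zero, Metric.infDist_zero_of_mem hpA] at h1
      simp only [D] at hd; linarith
  simp only [D] at key
  refine ⟨_, m, _, hG.tr w, fun z => ?_, by simp only [zero_add]; linarith⟩
  by_cases hz : z + w ∈ Metric.closedBall (0:ℂ) Z
  · have := csInf_le hbdd ⟨z + w, hz, rfl⟩
    simp only at this; linarith
  · exact hδ1.trans (hfar _ hz).le
end

section
variable {V : Type*} [NormedAddCommGroup V] [InnerProductSpace ℂ V] [FiniteDimensional ℂ V]
variable {Q : V → V →L[ℝ] V} {e : V} {q r L : ℝ}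

structure Loc (Q : V → V →L[ℝ] V) (A : Set V) (p : V) (w : V → ℂ) (C : ℝ) (x : V) : Prop where
  s : ContDiffAt ℝ 2 w x
  d : Metric.infDist x A ≤ C * ‖w x‖
  e : ∀ ξ, ‖fderiv ℝ w x (ξ + Q x ξ) + Complex.I * fderiv ℝ w x (Complex.I • (ξ - Q x ξ))‖ ≤ C * ‖w x‖ * ‖ξ‖

theorem dz_le (B : ℂ →L[ℝ] V) : ‖dz B‖ ≤ ‖B‖ := by
  have h1 := B.le_opNorm 1
  have h2 := B.le_opNorm Complex.I
  rw [dz, norm_smul]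
  have := norm_sub_le (B 1) (Complex.I • B Complex.I)
  rw [norm_smul] at this
  norm_num at *
  linarith

theorem db_w {U : ℂ → V} {y : ℂ} {w : V → ℂ} (hw : DifferentiableAt ℝ w (U y)) (hU : DifferentiableAt ℝ U y) {Qx : V →L[ℝ] V} {C C2 W ε G : ℝ} (hC : 0 ≤ C)
    (hW : 0 ≤ W) (hG : 0 ≤ G)
    (he : ∀ ξ, ‖fderiv ℝ w (U y) (ξ + Qx ξ) + Complex.I * fderiv ℝ w (U y) (Complex.I • (ξ - Qx ξ))‖ ≤ C * W * ‖ξ‖)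
    (hd : ‖fderiv ℝ w (U y)‖ ≤ C2) (hε : ε ≤ C * W) (hUd : ‖fderiv ℝ U y‖ ≤ 3 * G) (hb : ‖db (fderiv ℝ U y) - Qx (dz (fderiv ℝ U y))‖ ≤ ε * G) :
    ‖db (fderiv ℝ (fun z => w (U z)) y)‖ ≤ W * ((2 * C + C * C2) * G) := by
  have h1 : fderiv ℝ (fun z => w (U z)) y = (fderiv ℝ w (U y)).comp (fderiv ℝ U y) := fderiv_comp y hw hU
  rw [h1, db]
  simp only [ContinuousLinearMap.comp_apply]
  rw [dz_db (fderiv ℝ U y) 1, dz_db (fderiv ℝ U y) Complex.I]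
  have hP := (dz_le (fderiv ℝ U y)).trans hUd
  have hC2 := (norm_nonneg _).trans hd
  generalize dz (fderiv ℝ U y) = P at *
  generalize db (fderiv ℝ U y) = g at *
  generalize fderiv ℝ w (U y) = D at *
  obtain ⟨R, hR⟩ : ∃ R, R = g - Qx P := ⟨_, rfl⟩
  rw [← hR] at hb
  have hg : g = Qx P + R := by rw [hR]; abel
  have e1 : D ((1:ℂ) • P + (starRingEnd ℂ) 1 • g) + Complex.I • D (Complex.I • P + (starRingEnd ℂ) Complex.I • g) =
      (D (P + Qx P) + Complex.I * D (Complex.I • (P - Qx P))) + (D R - Complex.I * D (Complex.I • R)) := by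
    rw [hg, map_one, Complex.conj_I, one_smul, one_smul, smul_eq_mul]
    simp only [map_add, map_sub, smul_add, smul_sub, neg_smul, map_neg]; ring
  rw [e1, norm_smul]
  have h2 := norm_add_le (D (P + Qx P) + Complex.I * D (Complex.I • (P - Qx P))) (D R - Complex.I * D (Complex.I • R))
  have h3 := norm_sub_le (D R) (Complex.I * D (Complex.I • R))
  rw [norm_mul, Complex.norm_I, one_mul] at h3
  have h4 : ‖D R‖ ≤ C2 * (C * W * G) := (D.le_of_opNorm_le hd R).trans (by gcongr; exact hb.trans (by gcongr))
  have h5 : ‖D (Complex.I • R)‖ ≤ C2 * (C * W * G) := (D.le_of_opNorm_le hd _).trans (by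
    rw [norm_smul, Complex.norm_I, one_mul]; gcongr; exact hb.trans (by gcongr))
  have h6 := (he P).trans (mul_le_mul_of_nonneg_left hP (by positivity))
  have h7 : ‖(1/2 : ℂ)‖ = 1/2 := by norm_num
  rw [h7]
  have h8 : 0 ≤ C * W * G := by positivity
  linarith

theorem core (h : HQ Q e q r L) {e2 : V} (he2 : ‖e2‖ = 1) (hp : inner ℂ e e2 = 0) {A : Set V} (hA : A.Nonempty) (hAc : IsClosed A) (hAr : ∀ x ∈ A, ‖x‖ < r)
    (hloc : ∀ p ∈ A, ∃ w C, w p = 0 ∧ ∀ᶠ x in 𝓝 p, Loc Q A p w C x) : False := by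
  obtain ⟨C, α, hC, hα, H⟩ := touch h he2 hp hA fun x hx => (hAr x hx).le
  have hd0 : ∀ n : ℕ, 0 < 1 / ((n : ℝ) + 1) := fun n => by positivity
  choose! U m G hG hU1 hU0 using fun n : ℕ => H (1 / ((n : ℝ) + 1)) (1 / ((n : ℝ) + 1)) (hd0 n) (hd0 n) (by
    rw [div_le_one (by positivity)]; linarith [n.cast_nonneg (α := ℝ)])
  obtain ⟨F, hF⟩ : ∃ F : Ultrafilter ℕ, (F : Filter ℕ) ≤ atTop := ⟨_, Ultrafilter.of_le atTop⟩
  have hδ : Tendsto (fun n : ℕ => 1 / ((n : ℝ) + 1)) F (𝓝 0) := tendsto_one_div_add_atTop_nhds_zero_nat.mono_left hF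
  have lim : ∀ (v : ℕ → V) (R : ℝ), (∀ n, ‖v n‖ ≤ R) → ∃ x, Tendsto v F (𝓝 x) := by
    intro v R hv
    let _ : ProperSpace V := FiniteDimensional.proper ℂ V
    obtain ⟨x, -, hx⟩ := (isCompact_closedBall (0:V) R).ultrafilter_le_nhds (F.map v) (by
      rw [le_principal_iff]; exact (Filter.univ_mem' (fun n => mem_closedBall_zero_iff.2 (hv n)) : v ⁻¹' Metric.closedBall 0 R ∈ (F : Filter ℕ)))
    exact ⟨x, hx⟩
  have hb0 : ∀ n, ‖U n 0‖ ≤ r + 2 := by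
    intro n
    have h1 : 1 / ((n : ℝ) + 1) ≤ 1 := by rw [div_le_one (by positivity)]; linarith [n.cast_nonneg (α := ℝ)]
    obtain ⟨y, hy, hy1⟩ := (Metric.infDist_lt_iff hA).1 (lt_of_le_of_lt ((hU0 n).trans h1) one_lt_two)
    rw [dist_eq_norm] at hy1
    have := norm_add_le (U n 0 - y) y
    rw [sub_add_cancel] at this
    linarith [hAr y hy]
  have hbz : ∀ z n, ‖U n z‖ ≤ C + (1 + q) * ‖z‖ + (r + 2) := by
    intro z n
    have h1 := (hG n).l z 0
    rw [sub_zero] at h1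
    have h2 := lam_le h.he (hG n).hm z
    have e1 : U n z = (U n z - U n 0 - lam e (m n) z) + lam e (m n) z + U n 0 := by abel
    rw [e1]
    exact (norm_add₃_le).trans (add_le_add (add_le_add h1 h2) (hb0 n))
  choose W hW using fun z => lim (fun n => U n z) _ (hbz z)
  obtain ⟨mm, hm⟩ := lim m q fun n => (hG n).hm
  have hmq : ‖mm‖ ≤ q := le_of_tendsto hm.norm (Eventually.of_forall fun n => (hG n).hm)
  have hinf : ∀ z, Tendsto (fun n => Metric.infDist (U n z) A) F (𝓝 0) → W z ∈ A := by
    intro z hz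
    rw [hAc.mem_iff_infDist_zero hA]
    exact tendsto_nhds_unique (((Metric.continuous_infDist_pt A).tendsto _).comp (hW z)) hz
  have hW0 : W 0 ∈ A := hinf 0 (tendsto_of_tendsto_of_tendsto_of_le_of_le tendsto_const_nhds hδ (fun n => Metric.infDist_nonneg) hU0)
  have hWh : ∀ x y, ‖x - y‖ ≤ 1 → ‖W x - W y‖ ≤ C * ‖x - y‖ ^ α := fun x y hxy =>
    le_of_tendsto ((hW x).sub (hW y)).norm (Eventually.of_forall fun n => (hG n).h x y hxy)
  have hsm : ∀ ρ > 0, ∃ s, 0 < s ∧ s ≤ 1/2 ∧ C * (2 * s) ^ α < ρ := by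
    intro ρ hρ
    have h1 : Tendsto (fun s : ℝ => C * (2 * s) ^ α) (𝓝 0) (𝓝 (C * (2 * 0) ^ α)) :=
      (tendsto_const_nhds.mul (((continuous_const.mul continuous_id).tendsto (0:ℝ)).rpow_const (Or.inr hα.le)))
    rw [mul_zero, Real.zero_rpow hα.ne', mul_zero] at h1
    have h2 : ∀ᶠ s in 𝓝[>] (0:ℝ), C * (2 * s) ^ α < ρ := (h1.eventually (gt_mem_nhds hρ)).filter_mono nhdsWithin_le_nhds
    have h3 : ∀ᶠ s in 𝓝[>] (0:ℝ), s ∈ Ioo (0:ℝ) (1/2) := Ioo_mem_nhdsGT (by norm_num)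
    obtain ⟨s, a3, a1, a2⟩ := (h2.and h3).exists
    exact ⟨s, a1, a2.le, a3⟩
  have hWc : Continuous W := by
    rw [continuous_iff_continuousAt]
    intro y
    rw [Metric.continuousAt_iff]
    intro ρ hρ
    obtain ⟨s, s0, s1, s2⟩ := hsm ρ hρ
    refine ⟨s, s0, fun {x} hx => ?_⟩
    rw [dist_eq_norm] at *
    refine (hWh x y (by linarith)).trans_lt (lt_of_le_of_lt ?_ s2)
    gcongr; linarith
  have hop : IsOpen (W ⁻¹' A) := by
    rw [Metric.isOpen_iff]
    intro z0 hz0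
    obtain ⟨w, C', hw0, hev⟩ := hloc _ hz0
    have hs0 := hev.self_of_nhds.s
    have hwc : ContinuousAt w (W z0) := hs0.continuousAt
    have hfc : ContinuousAt (fderiv ℝ w) (W z0) := (hs0.fderiv_right (m := 1) (by norm_num)).continuousAt
    have e1 : ∀ᶠ x in 𝓝 (W z0), ‖w x‖ < 1 := hwc.norm.eventually_lt_const (by simp only [hw0, norm_zero]; exact one_pos)
    have e2 : ∀ᶠ x in 𝓝 (W z0), ‖fderiv ℝ w x‖ < ‖fderiv ℝ w (W z0)‖ + 1 := hfc.norm.eventually_lt_const (by linarith)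
    have e3 : ∀ᶠ x in 𝓝 (W z0), ‖x‖ < r := continuous_norm.continuousAt.eventually_lt_const (hAr _ hz0)
    obtain ⟨ρ, hρ, hball⟩ := Metric.eventually_nhds_iff_ball.1 (hev.and (e1.and (e2.and e3)))
    obtain ⟨s, s0, s1, s2⟩ := hsm (ρ / 2) (half_pos hρ)
    refine ⟨s / 2, half_pos s0, fun z hz => ?_⟩
    rw [mem_ball_iff_norm] at hz
    generalize ‖fderiv ℝ w (W z0)‖ + 1 = C2 at *
    have hn : ∀ᶠ n in F, ∀ y ∈ Metric.closedBall z s, U n y ∈ Metric.ball (W z0) ρ := by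
      filter_upwards [(hW z0).eventually (Metric.ball_mem_nhds _ (half_pos hρ))] with n h1 y hy
      have h1' : ‖U n z0 - W z0‖ < ρ/2 := mem_ball_iff_norm.1 h1
      rw [mem_ball_iff_norm]
      rw [mem_closedBall_iff_norm] at hy
      have h2 : ‖y - z0‖ ≤ 2 * s := (norm_sub_le_norm_sub_add_norm_sub y z z0).trans (by linarith)
      have h3 := ((hG n).h y z0 (by linarith)).trans (mul_le_mul_of_nonneg_left (Real.rpow_le_rpow (norm_nonneg _) h2 hα.le) hC.le)
      linarith [norm_sub_le_norm_sub_add_norm_sub (U n y) (U n z0) (W z0)]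
    have hC' : 0 < C' := by
      obtain ⟨n, hn⟩ := hn.exists
      have h1 := (hball _ (hn z (Metric.mem_closedBall_self s0.le))).1.d
      have h2 := (hd0 n).trans_le ((hU1 n z).trans h1)
      by_contra! hc
      linarith [mul_nonpos_of_nonpos_of_nonneg hc (norm_nonneg (w (U n z)))]
    have hC2 : 0 < C2 := by
      obtain ⟨n, hn⟩ := hn.exists
      exact (norm_nonneg _).trans_lt (hball _ (hn z (Metric.mem_closedBall_self s0.le))).2.2.1
    obtain ⟨M, hM⟩ : ∃ M, M = 2 * C' + C' * C2 := ⟨_, rfl⟩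
    have hM0 : 0 < M := by rw [hM]; positivity
    have hz0' : z0 ∈ Metric.closedBall z s := by rw [mem_closedBall_iff_norm, norm_sub_rev]; linarith
    have hne : ∀ n, (∀ y ∈ Metric.closedBall z s, U n y ∈ Metric.ball (W z0) ρ) → ∀ y ∈ Metric.closedBall z s, w (U n y) ≠ 0 := by
      intro n hn y hy h0
      have h1 := (hU1 n y).trans (hball _ (hn y hy)).1.d
      rw [h0, norm_zero, mul_zero] at h1
      linarith [hd0 n]
    have key : ∀ᶠ n in F, Metric.infDist (U n z) A ≤ C' * (Real.exp (M * C) * ‖w (U n z0)‖ ^ (1/4 : ℝ)) := by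
      filter_upwards [hn] with n hn
      have hzz := Metric.mem_closedBall_self (x := z) s0.le
      refine (hball _ (hn z hzz)).1.d.trans (mul_le_mul_of_nonneg_left ?_ hC'.le)
      have hPot : ∀ x t, 0 < t → t ≤ 1/2 → Pot (fun y => M * G n y) x t ≤ M * C := by
        intro x t t0 t1
        have : Pot (fun y => M * G n y) x t = M * Pot (G n) x t := by simp only [Pot, intervalIntegral.integral_const_mul]
        rw [this]
        gcongr
        exact ((hG n).p x t t0 t1).trans (mul_le_of_le_one_right hC.le (Real.rpow_le_one t0.le (by linarith) hα.le))
      have hGc := (hG n).c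
      have hk := harnack (w := fun y => w (U n y)) (b := fun y => M * G n y) (z := z) (z0 := z0) (B := M * C) s0 hz.le
        (fun y hy => (hball _ (hn y hy)).1.s.comp y (hG n).s.contDiffAt) (hne n hn) (fun y hy => (hball _ (hn y hy)).2.1.le) (by fun_prop)
        (fun y hy => by
          obtain ⟨b1, b2, b3, b4⟩ := hball _ (hn y hy)
          have hb := (hG n).b y
          rw [per_in h.he h.z h.r2 h.q1 (hG n).hm b4] at hb
          rw [hM]
          exact db_w (b1.s.differentiableAt (by norm_num)) ((hG n).s.differentiable (by norm_num) y) hC'.le (norm_nonneg _) (by linarith [(hG n).g1 y]) b1.e b3.le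
            ((hU1 n y).trans b1.d) ((hG n).d y) hb)
        (hPot z s s0 s1) (hPot z0 (s / 2) (half_pos s0) (by linarith)) (by positivity)
      have p1 : 0 < ‖w (U n z)‖ := norm_pos_iff.2 (hne n hn z hzz)
      have p2 : 0 < ‖w (U n z0)‖ := norm_pos_iff.2 (hne n hn z0 hz0')
      rw [← Real.exp_log p1, Real.rpow_def_of_pos p2, ← Real.exp_add]
      exact Real.exp_le_exp.2 (by linarith)
    refine hinf z (tendsto_of_tendsto_of_tendsto_of_le_of_le' tendsto_const_nhds ?_ (Eventually.of_forall fun n => Metric.infDist_nonneg) key)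
    have h1 := (hwc.tendsto.comp (hW z0)).norm.rpow_const (p := 1/4) (Or.inr (by norm_num))
    rw [hw0, norm_zero, Real.zero_rpow (by norm_num)] at h1
    simpa using (h1.const_mul (Real.exp (M * C))).const_mul C'
  have huniv := IsClopen.eq_univ ⟨hAc.preimage hWc, hop⟩ ⟨0, hW0⟩
  have hall : ∀ z, W z ∈ A := fun z => by
    have : z ∈ W ⁻¹' A := by rw [huniv]; trivial
    exact this
  have hlin : ∀ z, ‖W z - W 0 - lam e mm z‖ ≤ C := fun z => by
    refine le_of_tendsto (((hW z).sub (hW 0)).sub ((tendsto_const_nhds.add (tendsto_const_nhds.smul hm)) : Tendsto (fun n => lam e (m n) z) F (𝓝 (lam e mm z)))).norm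
      (Eventually.of_forall fun n => ?_)
    have h1 := (hG n).l z 0
    rw [sub_zero] at h1
    exact h1
  have hq1 : 0 < 1 - q := by linarith [h.q1]
  have hr : 0 ≤ r := (norm_nonneg _).trans (hAr _ hW0).le
  obtain ⟨R, hR⟩ : ∃ R, R = (C + 2 * r + 1) / (1 - q) := ⟨_, rfl⟩
  have hR0 : 0 ≤ R := by rw [hR]; positivity
  have a1 := hlin (R : ℂ)
  have a2 := lam_ge h.he hmq (R : ℂ)
  rw [Complex.norm_real, Real.norm_of_nonneg hR0, hR, mul_div_cancel₀ _ hq1.ne'] at a2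
  rw [← hR] at a2
  have a3 := norm_sub_le (W R - W 0) (W R - W 0 - lam e mm R)
  rw [sub_sub_cancel] at a3
  have a4 := norm_sub_le (W R) (W 0)
  linarith [hAr _ (hall R), hAr _ hW0]
end

section
variable {E H F D G : Type*} [NormedAddCommGroup E] [NormedSpace ℝ E] [NormedAddCommGroup H] [NormedSpace ℝ H]
  [NormedAddCommGroup F] [NormedSpace ℝ F] [NormedAddCommGroup D] [NormedSpace ℝ D] [NormedAddCommGroup G] [NormedSpace ℝ G]

def Sm (f : E → F) (x : E) : Prop := ∀ᶠ y in 𝓝 x, ContDiffAt ℝ ∞ f y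

def cmpL (E F G : Type*) [NormedAddCommGroup E] [NormedSpace ℝ E] [NormedAddCommGroup F] [NormedSpace ℝ F] [NormedAddCommGroup G] [NormedSpace ℝ G] :
    (F →L[ℝ] G) →L[ℝ] (E →L[ℝ] F) →L[ℝ] (E →L[ℝ] G) := ContinuousLinearMap.compL ℝ E F G

set_option maxSynthPendingDepth 3 in
theorem cmp_le : ‖cmpL E F G‖ ≤ 1 := ContinuousLinearMap.norm_compL_le _ _ _ _

theorem bil (B : F →L[ℝ] G →L[ℝ] H) {f : E → F} {g : E → G} {x : E} (hf : Sm f x) (hg : Sm g x) (n : ℕ) :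
    ‖iteratedFDeriv ℝ n (fun y => B (f y) (g y)) x‖ ≤ ‖B‖ * ∑ i ∈ Finset.range (n + 1), (n.choose i : ℝ) * ‖iteratedFDeriv ℝ i f x‖ *
        ‖iteratedFDeriv ℝ (n - i) g x‖ := by
  obtain ⟨s, hs, so, xs⟩ := eventually_nhds_iff.1 (hf.and hg)
  have := B.norm_iteratedFDerivWithin_le_of_bilinear (N := ∞) (n := n) (fun y hy => (hs y hy).1.contDiffWithinAt) (fun y hy => (hs y hy).2.contDiffWithinAt) so.uniqueDiffOn xs
    (by exact_mod_cast le_top)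
  simpa only [iteratedFDerivWithin_of_isOpen _ so xs] using this

theorem an_bound [CompleteSpace F] {f : E → F} {p : E} (hf : AnalyticAt ℝ f p) : ∃ A κ s : ℝ, 0 < A ∧ 0 < κ ∧ 0 < s ∧ ∀ q ∈ Metric.ball p s, AnalyticAt ℝ f q ∧
    ∀ j : ℕ, ‖iteratedFDeriv ℝ j f q‖ ≤ A * j.factorial * κ ^ j := by
  obtain ⟨P, r, hP⟩ := hf
  obtain ⟨R, hR0, hR⟩ := ENNReal.lt_iff_exists_nnreal_btwn.1 hP.r_pos
  have hR0' : 0 < R := by exact_mod_cast hR0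
  have hrr : ((R / 2 : NNReal) + (R / 2 : NNReal) : ENNReal) < P.radius := by
    rw [← ENNReal.coe_add, add_halves]; exact hR.trans_le hP.r_le
  have hS := P.changeOriginSeries_summable_aux₁ hrr
  obtain ⟨S, hSe⟩ : ∃ S, S = ∑' s : Σ k l : ℕ, { s : Finset (Fin (k + l)) // s.card = l }, ‖P (s.1 + s.2.1)‖₊ * (R/2) ^ s.2.1 * (R/2) ^ s.1 := ⟨_, rfl⟩
  have hR2 : 0 < R / 2 := half_pos hR0'
  refine ⟨S + 1, ((R/2 : NNReal) : ℝ)⁻¹, (R/2 : NNReal), by positivity, by positivity, by exact_mod_cast hR2, fun q hq => ?_⟩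
  obtain ⟨y, rfl⟩ : ∃ y, q = p + y := ⟨q - p, by abel⟩
  rw [mem_ball_iff_norm, add_sub_cancel_left] at hq
  have hy : ‖y‖₊ ≤ R / 2 := hq.le
  have hyr : (‖y‖₊ : ENNReal) < r := lt_of_le_of_lt (by exact_mod_cast hy.trans (half_le_self hR0'.le)) hR
  have hc := hP.changeOrigin hyr
  refine ⟨hc.analyticAt, fun j => ?_⟩
  have h1 : ‖P.changeOrigin y j‖₊ * (R/2) ^ j ≤ S := by
    have h2 := (NNReal.summable_sigma.1 hS).1 j
    refine (mul_le_mul_of_nonneg_right (P.nnnorm_changeOrigin_le j (hyr.trans_le hP.r_le)) (by positivity)).trans ?_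
    rw [← NNReal.tsum_mul_right]
    refine (Summable.tsum_le_tsum (fun s => ?_) ((P.changeOriginSeries_summable_aux₂ (hyr.trans_le hP.r_le) j).mul_right _) h2).trans ?_
    · gcongr
    · rw [hSe]
      exact NNReal.tsum_comp_le_tsum_of_inj hS (i := fun s => (⟨j, s⟩ : Σ k l : ℕ, { s : Finset (Fin (k + l)) // s.card = l })) (fun a b h => by simpa using h)
  have h2 : ‖P.changeOrigin y j‖ ≤ (S + 1) * ((R/2 : NNReal) : ℝ)⁻¹ ^ j := by
    rw [inv_pow, ← div_eq_mul_inv, le_div_iff₀ (by positivity)]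
    have : ‖P.changeOrigin y j‖ * ((R/2 : NNReal) : ℝ) ^ j ≤ S := by exact_mod_cast h1
    linarith
  refine ContinuousMultilinearMap.opNorm_le_bound (by positivity) fun v => ?_
  rw [hc.iteratedFDeriv_eq_sum_of_completeSpace]
  refine (norm_sum_le _ _).trans ((Finset.sum_le_card_nsmul _ _ ((S + 1) * ((R/2 : NNReal) : ℝ)⁻¹ ^ j * ∏ i, ‖v i‖) fun σ _ => ?_).trans ?_)
  · refine ((P.changeOrigin y j).le_opNorm _).trans ?_
    rw [Equiv.prod_comp σ (fun i => ‖v i‖)]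
    gcongr
  · rw [Finset.card_univ, Fintype.card_perm, Fintype.card_fin, nsmul_eq_mul]
    apply le_of_eq; ring

def cuL (H F : Type*) [NormedAddCommGroup H] [NormedSpace ℝ H] [NormedAddCommGroup F] [NormedSpace ℝ F] (n : ℕ) :
    (H →L[ℝ] (H [×n]→L[ℝ] F)) ≃ₗᵢ[ℝ] (H [×(n+1)]→L[ℝ] F) := (continuousMultilinearCurryLeftEquiv ℝ (fun _ : Fin n.succ => H) F).symm

def TT (X : E → H →L[ℝ] E) (G : E → F) : (n : ℕ) → E → (H [×n]→L[ℝ] F)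
  | 0 => fun q => (continuousMultilinearCurryFin0 ℝ H F).symm (G q)
  | n + 1 => fun q => (cuL H F n) (cmpL H E _ (fderiv ℝ (TT X G n) q) (X q))

theorem AnalyticAt.sm [CompleteSpace F] {f : E → F} {x : E} (hf : AnalyticAt ℝ f x) : Sm f x := hf.eventually_analyticAt.mono fun _ h => h.contDiffAt

theorem an_bil (B : F →L[ℝ] G →L[ℝ] H) {f : E → F} {g : E → G} {x : E} (hf : AnalyticAt ℝ f x) (hg : AnalyticAt ℝ g x) : AnalyticAt ℝ (fun y => B (f y) (g y)) x :=
  (B.analyticAt_bilinear (f x, g x)).comp₂ hf hg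

theorem TT_an [CompleteSpace F] {X : E → H →L[ℝ] E} {G : E → F} {q : E} (hX : AnalyticAt ℝ X q) (hG : AnalyticAt ℝ G q) (n : ℕ) : AnalyticAt ℝ (TT X G n) q := by
  induction n with
  | zero => exact ((continuousMultilinearCurryFin0 ℝ H F).symm.analyticAt _).comp hG
  | succ n ih => exact ((cuL H F n).analyticAt _).comp (an_bil (cmpL H E _) ih.fderiv hX)

theorem fac_le (n j i : ℕ) (hi : i ≤ j) : j.choose i * (j - i).factorial * (n + 1 + i).factorial ≤ (n + 1 + j).factorial := by
  have h1 : (j - i).factorial * j.choose i = j.descFactorial (j - i) := by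
    rw [← Nat.choose_symm hi, Nat.descFactorial_eq_factorial_mul_choose]
  have h2 := Nat.factorial_mul_descFactorial (show j - i ≤ n + 1 + j by omega)
  rw [show n + 1 + j - (j - i) = n + 1 + i by omega] at h2
  rw [← h2, mul_comm (j.choose i), h1, mul_comm]
  exact Nat.mul_le_mul_left _ (Nat.descFactorial_le _ (by omega))

theorem TT_bound [CompleteSpace F] [CompleteSpace E] {X : E → H →L[ℝ] E} {G : E → F} {s : Set E} {M K A : ℝ} (hM : 0 ≤ M) (hK : 0 ≤ K) (hA : 0 ≤ A)
    (hX : ∀ q ∈ s, AnalyticAt ℝ X q ∧ ∀ j : ℕ, ‖iteratedFDeriv ℝ j X q‖ ≤ M * j.factorial * (K/2) ^ j)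
    (hG : ∀ q ∈ s, AnalyticAt ℝ G q ∧ ∀ j : ℕ, ‖iteratedFDeriv ℝ j G q‖ ≤ A * j.factorial * K ^ j) (n : ℕ) :
    ∀ q ∈ s, ∀ j : ℕ, ‖iteratedFDeriv ℝ j (TT X G n) q‖ ≤ A * (2 * M) ^ n * (n + j).factorial * K ^ (n + j) := by
  induction n with
  | zero =>
    intro q hq j
    have := (hG q hq).2 j
    rw [← (continuousMultilinearCurryFin0 ℝ H F).symm.norm_iteratedFDeriv_comp_left] at this
    simpa only [pow_zero, mul_one, zero_add, TT, Function.comp_def] using this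
  | succ n ih =>
    intro q hq j
    have h0 := (cuL H F n).norm_iteratedFDeriv_comp_left
      (fun q => cmpL H E _ (fderiv ℝ (TT X G n) q) (X q)) q j
    have h1 := bil (cmpL H E (H [×n]→L[ℝ] F)) (TT_an (hX q hq).1 (hG q hq).1 n).fderiv.sm (hX q hq).1.sm j
    refine (h0.le.trans h1).trans ((mul_le_of_le_one_left (Finset.sum_nonneg fun _ _ => by positivity) cmp_le).trans ?_)
    have h2 : ∀ i ∈ Finset.range (j + 1), (j.choose i : ℝ) * ‖iteratedFDeriv ℝ i (fderiv ℝ (TT X G n)) q‖ * ‖iteratedFDeriv ℝ (j - i) X q‖ ≤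
        A * (2 * M) ^ n * M * (n + 1 + j).factorial * K ^ (n + 1 + j) * (1/2) ^ (j - i) := by
      intro i hi
      have hij : i ≤ j := by rw [Finset.mem_range] at hi; omega
      rw [norm_iteratedFDeriv_fderiv]
      have a1 := ih q hq (i + 1)
      have a2 := (hX q hq).2 (j - i)
      have a3 : ((j.choose i * (j - i).factorial * (n + 1 + i).factorial : ℕ) : ℝ) ≤ ((n + 1 + j).factorial : ℕ) := by exact_mod_cast fac_le n j i hij
      push_cast at a3
      calc _ ≤ (j.choose i : ℝ) * (A * (2 * M) ^ n * (n + (i + 1)).factorial * K ^ (n + (i + 1))) * (M * (j - i).factorial * (K/2) ^ (j - i)) := by gcongr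
        _ = (A * (2 * M) ^ n * M * K ^ (n + 1 + j) * (1/2) ^ (j - i)) * (j.choose i * (j - i).factorial * (n + 1 + i).factorial) := by
          rw [show n + (i + 1) = n + 1 + i by ring, show n + 1 + j = (n + 1 + i) + (j - i) by omega, pow_add K, div_eq_mul_inv K, mul_pow K]
          ring
        _ ≤ (A * (2 * M) ^ n * M * K ^ (n + 1 + j) * (1/2) ^ (j - i)) * (n + 1 + j).factorial := by gcongr
        _ = _ := by ring
    refine (Finset.sum_le_sum h2).trans ?_
    rw [← Finset.mul_sum]
    have h3 : ∑ i ∈ Finset.range (j + 1), (1/2 : ℝ) ^ (j - i) ≤ 2 := by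
      have := Finset.sum_range_reflect (fun i => (1/2 : ℝ) ^ i) (j + 1)
      simp only [add_tsub_cancel_right] at this
      rw [this]; exact sum_geometric_two_le _
    refine (mul_le_mul_of_nonneg_left h3 (by positivity)).trans (le_of_eq (by ring))
end

section
open scoped ContDiff NNReal

section
variable {E H F : Type*} [NormedAddCommGroup E] [NormedSpace ℝ E] [NormedAddCommGroup H] [NormedSpace ℝ H]
  [NormedAddCommGroup F] [NormedSpace ℝ F]

theorem taylor01 [CompleteSpace F] {g : ℕ → ℝ → F} {A : ℝ} (hd : ∀ n, ∀ t ∈ Icc (0:ℝ) 1, HasDerivWithinAt (g n) (g (n+1) t) (Icc 0 1) t)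
    (hb : ∀ n, ∀ t ∈ Icc (0:ℝ) 1, ‖g n t‖ ≤ A * n.factorial * (1/2) ^ n) :
    HasSum (fun n => (n.factorial : ℝ)⁻¹ • g n 0) (g 0 1) := by
  have hs : Summable (fun n => (n.factorial : ℝ)⁻¹ • g n 0) := by
    refine Summable.of_norm_bounded (g := fun n => A * (1/2) ^ n) (summable_geometric_two.mul_left A) fun n => ?_
    rw [norm_smul, norm_inv, Real.norm_natCast, inv_mul_le_iff₀ (by positivity)]
    refine (hb n 0 (by simp)).trans (le_of_eq (by ring))
  rw [hs.hasSum_iff_tendsto_nat, ← tendsto_add_atTop_iff_nat 1]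
  have hS : ∀ N, ∀ t ∈ Icc (0:ℝ) 1, HasDerivWithinAt (fun t => ∑ i ∈ Finset.range (N + 1), ((1 - t) ^ i * (i.factorial : ℝ)⁻¹) • g i t)
      (((1 - t) ^ N * (N.factorial : ℝ)⁻¹) • g (N + 1) t) (Icc 0 1) t := by
    intro N t ht
    induction N with
    | zero => simpa using hd 0 t ht
    | succ N ih =>
      simp_rw [Finset.sum_range_succ _ (N + 1)]
      have h1 : HasDerivWithinAt (fun t : ℝ => (1 - t) ^ (N + 1) * ((N + 1).factorial : ℝ)⁻¹) (-((1 - t) ^ N * (N.factorial : ℝ)⁻¹)) (Icc 0 1) t := by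
        have := ((((hasDerivAt_id t).const_sub 1).pow (N + 1)).mul_const (((N + 1).factorial : ℝ)⁻¹)).hasDerivWithinAt (s := Icc 0 1)
        convert! this using 1
        rw [Nat.factorial_succ]; push_cast; simp only [Nat.add_sub_cancel, id]; field_simp
      convert! ih.add (h1.smul (hd (N + 1) t ht)) using 1
      simp
  rw [tendsto_iff_norm_sub_tendsto_zero]
  have hl : Tendsto (fun N : ℕ => A * ((N:ℝ) * (1/2) ^ N + (1/2) ^ N)) atTop (𝓝 (A * (0 + 0))) :=
    (((tendsto_self_mul_const_pow_of_lt_one (by norm_num) (by norm_num)).add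
      (tendsto_pow_atTop_nhds_zero_of_lt_one (by norm_num) (by norm_num))).const_mul A)
  rw [add_zero, mul_zero] at hl
  refine squeeze_zero (fun _ => norm_nonneg _) (fun N => ?_) hl
  have hA : 0 ≤ A := by simpa using (norm_nonneg _).trans (hb 0 0 (by simp))
  have h3 := norm_image_sub_le_of_norm_deriv_le_segment_01' (C := A * ((N:ℝ) * (1/2) ^ N + (1/2) ^ N)) (hS N) (fun t ht => ?_)
  · rw [norm_sub_rev]
    refine le_trans (le_of_eq ?_) h3
    congr 2
    · rw [Finset.sum_eq_single 0] <;> simp +contextual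
    · simp
  · rw [norm_smul, norm_mul, norm_inv, Real.norm_natCast, norm_pow, Real.norm_of_nonneg (by linarith [ht.2])]
    have h4 := hb (N + 1) t ⟨ht.1, ht.2.le⟩
    have h5 : (1 - t) ^ N ≤ 1 := pow_le_one₀ (by linarith [ht.2]) (by linarith [ht.1])
    calc _ ≤ 1 * (N.factorial : ℝ)⁻¹ * (A * (N+1).factorial * (1/2) ^ (N + 1)) := by gcongr
      _ = A * (N + 1) * (1/2) ^ N * (1/2) := by rw [Nat.factorial_succ]; push_cast; field_simp; ring
      _ ≤ A * (N + 1) * (1/2) ^ N * 1 := by gcongr; norm_num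
      _ = _ := by ring

theorem TT_succ (X : E → H →L[ℝ] E) (G : E → F) (n : ℕ) (q : E) (x : H) :
    TT X G (n + 1) q (fun _ => x) = fderiv ℝ (TT X G n) q (X q x) (fun _ => x) := rfl

theorem tay [CompleteSpace F] [CompleteSpace E] {X : E → H →L[ℝ] E} {G : E → F} {s : Set E} {M K A : ℝ} (hM : 0 ≤ M) (hK : 0 ≤ K) (hA : 0 ≤ A)
    (hX : ∀ q ∈ s, AnalyticAt ℝ X q ∧ ∀ j : ℕ, ‖iteratedFDeriv ℝ j X q‖ ≤ M * j.factorial * (K/2) ^ j)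
    (hG : ∀ q ∈ s, AnalyticAt ℝ G q ∧ ∀ j : ℕ, ‖iteratedFDeriv ℝ j G q‖ ≤ A * j.factorial * K ^ j) {β : ℝ → E} {x : H}
    (hβ : ∀ t ∈ Icc (0:ℝ) 1, β t ∈ s ∧ HasDerivWithinAt β (X (β t) x) (Icc 0 1) t) (hx : 2 * M * K * ‖x‖ ≤ 1 / 2) :
    HasSum (fun n => (n.factorial : ℝ)⁻¹ • TT X G n (β 0) (fun _ => x)) (G (β 1)) := by
  refine taylor01 (g := fun n t => TT X G n (β t) (fun _ => x)) (A := A) (fun n t ht => ?_) (fun n t ht => ?_)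
  · have h1 := (TT_an (hX _ (hβ t ht).1).1 (hG _ (hβ t ht).1).1 n).differentiableAt.hasFDerivAt
    exact (ContinuousMultilinearMap.apply ℝ (fun _ : Fin n => H) F (fun _ => x)).hasFDerivAt.comp_hasDerivWithinAt t (h1.comp_hasDerivWithinAt t (hβ t ht).2)
  · have h1 := TT_bound hM hK hA hX hG n _ (hβ t ht).1 0
    rw [norm_iteratedFDeriv_zero, add_zero] at h1
    refine ((TT X G n (β t)).le_opNorm _).trans ?_
    rw [Finset.prod_const, Finset.card_univ, Fintype.card_fin]
    calc _ ≤ (A * (2 * M) ^ n * n.factorial * K ^ n) * ‖x‖ ^ n := by gcongr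
      _ = A * n.factorial * (2 * M * K * ‖x‖) ^ n := by rw [mul_pow, mul_pow]; ring
      _ ≤ _ := by gcongr

theorem flowx [CompleteSpace E] {Y : E → E} {p : E} {a K : ℝ≥0} (hb : ∀ q ∈ Metric.closedBall p a, ‖Y q‖ ≤ a) (hl : LipschitzOnWith K Y (Metric.closedBall p a)) :
    ∃ α : ℝ → E, α 0 = p ∧ ∀ t ∈ Icc (0:ℝ) 1, α t ∈ Metric.closedBall p a ∧ HasDerivWithinAt α (Y (α t)) (Icc 0 1) t := by
  have hP : IsPicardLindelof (fun _ => Y) (⟨0, by simp⟩ : Icc (0:ℝ) 1) p a 0 a K := .of_time_independent hb hl (by simp)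
  have hx : p ∈ Metric.closedBall p ((0 : ℝ≥0) : ℝ) := by simp
  obtain ⟨α, hα⟩ := ODE.FunSpace.exists_isFixedPt_next hP hx
  rw [ODE.FunSpace.isFixedPt_next_iff] at hα
  have hm : ∀ t, α.compProj t ∈ Metric.closedBall p a := fun t => α.compProj_mem_closedBall hP.mul_max_le
  have he : ∀ t ∈ Icc (0:ℝ) 1, α.compProj t = ODE.picard (fun _ => Y) 0 p α.compProj t := fun t ht => by
    rw [ODE.FunSpace.compProj_of_mem ht, hα]
  refine ⟨α.compProj, by rw [he 0 (by simp)]; simp [ODE.picard], fun t ht => ⟨hm t, ?_⟩⟩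
  exact (ODE.hasDerivWithinAt_picard_Icc (by simp) hP.continuousOn_uncurry α.continuous_compProj.continuousOn (fun t _ => hm t) p ht).congr he (he t ht)

theorem flow_series [CompleteSpace F] [CompleteSpace E] {X : E → H →L[ℝ] E} {G : E → F} {p : E} (hX : AnalyticAt ℝ X p) (hG : AnalyticAt ℝ G p)
    (h0 : ∀ n, TT X G n p = 0) :
    ∃ f : H → E, AnalyticAt ℝ f 0 ∧ f 0 = p ∧ ∀ᶠ x in 𝓝 (0:H), G (f x) = 0 ∧ ∀ t ∈ Icc (0:ℝ) 1, HasDerivWithinAt (fun t => f (t • x)) (X (f (t • x)) x) (Icc 0 1) t := by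
  obtain ⟨M, κ, s, hM, hκ, hs, hXb⟩ := an_bound hX
  obtain ⟨A, κ', s', hA, hκ', hs', hGb⟩ := an_bound hG
  obtain ⟨B, κ'', s'', hB, hκ'', hs'', hIb⟩ := an_bound (analyticAt_id (𝕜 := ℝ) (z := p))
  obtain ⟨K, hK, hK1, hK2, hK3⟩ : ∃ K : ℝ, 0 < K ∧ κ ≤ K / 2 ∧ κ' ≤ K ∧ κ'' ≤ K :=
    ⟨2 * κ + κ' + κ'', by positivity, by linarith, by linarith, by linarith⟩
  obtain ⟨L, S, hS, hL⟩ := (hX.contDiffAt (n := 1)).exists_lipschitzOnWith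
  obtain ⟨s3, hs3, hs3'⟩ := Metric.mem_nhds_iff.1 hS
  obtain ⟨a, ha0, ha⟩ : ∃ a : ℝ≥0, 0 < a ∧ (a:ℝ) < min (min s s') (min s'' s3) := by
    obtain ⟨a, h1, h2⟩ := exists_between (show 0 < min (min s s') (min s'' s3) by positivity)
    exact ⟨⟨a, h1.le⟩, h1, h2⟩
  simp only [lt_min_iff] at ha
  have hX' : ∀ q ∈ Metric.closedBall p a, AnalyticAt ℝ X q ∧ ∀ j : ℕ, ‖iteratedFDeriv ℝ j X q‖ ≤ M * j.factorial * (K/2) ^ j := fun q hq =>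
    ⟨(hXb q (Metric.closedBall_subset_ball ha.1.1 hq)).1, fun j => ((hXb q (Metric.closedBall_subset_ball ha.1.1 hq)).2 j).trans (by gcongr)⟩
  have hG' : ∀ q ∈ Metric.closedBall p a, AnalyticAt ℝ G q ∧ ∀ j : ℕ, ‖iteratedFDeriv ℝ j G q‖ ≤ A * j.factorial * K ^ j := fun q hq =>
    ⟨(hGb q (Metric.closedBall_subset_ball ha.1.2 hq)).1, fun j => ((hGb q (Metric.closedBall_subset_ball ha.1.2 hq)).2 j).trans (by gcongr)⟩
  have hI' : ∀ q ∈ Metric.closedBall p a, AnalyticAt ℝ (id : E → E) q ∧ ∀ j : ℕ, ‖iteratedFDeriv ℝ j (id : E → E) q‖ ≤ B * j.factorial * K ^ j := fun q hq =>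
    ⟨(hIb q (Metric.closedBall_subset_ball ha.2.1 hq)).1, fun j => ((hIb q (Metric.closedBall_subset_ball ha.2.1 hq)).2 j).trans (by gcongr)⟩
  have hp : p ∈ Metric.closedBall p (a:ℝ) := Metric.mem_closedBall_self a.2
  let P : FormalMultilinearSeries ℝ H E := fun n => (n.factorial : ℝ)⁻¹ • TT X id n p
  let c : ℝ≥0 := ⟨1 / (2 * M * K), by positivity⟩
  have hc : 0 < c := by show (0:ℝ) < 1 / (2 * M * K); positivity
  have hr : (c : ENNReal) ≤ P.radius := by
    refine P.le_radius_of_bound B fun n => ?_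
    have := TT_bound hM.le hK.le hB.le hX' hI' n p hp 0
    rw [norm_iteratedFDeriv_zero, add_zero] at this
    have e : ‖P n‖ = (n.factorial : ℝ)⁻¹ * ‖TT X id n p‖ := by
      simp only [P]; rw [norm_smul, norm_inv, Real.norm_natCast]
    rw [e]
    calc _ ≤ (n.factorial : ℝ)⁻¹ * (B * (2 * M) ^ n * n.factorial * K ^ n) * (1 / (2 * M * K)) ^ n := by gcongr; rfl
      _ = B := by rw [div_pow, mul_pow (2 * M), one_pow]; field_simp
  have hP := P.hasFPowerSeriesOnBall (lt_of_lt_of_le (by exact_mod_cast hc) hr)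
  have key : ∀ (β : ℝ → E) (x : H), β 0 = p → (∀ t ∈ Icc (0:ℝ) 1, β t ∈ Metric.closedBall p a ∧ HasDerivWithinAt β (X (β t) x) (Icc 0 1) t) →
      2 * M * K * ‖x‖ ≤ 1 / 2 → P.sum x = β 1 ∧ G (β 1) = 0 := by
    intro β x h1 h2 h3
    have a1 := tay hM.le hK.le hB.le hX' hI' h2 h3
    have a2 := tay hM.le hK.le hA.le hX' hG' h2 h3
    rw [h1] at a1 a2
    refine ⟨a1.tsum_eq, ?_⟩
    simp only [h0, _root_.zero_apply, smul_zero] at a2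
    exact a2.unique hasSum_zero
  have hev : ∀ᶠ x in 𝓝 (0:H), 2 * M * K * ‖x‖ < 1 / 2 ∧ M * ‖x‖ < a := by
    have c1 : ContinuousAt (fun x : H => 2 * M * K * ‖x‖) 0 := by fun_prop
    have c2 : ContinuousAt (fun x : H => M * ‖x‖) 0 := by fun_prop
    exact (c1.eventually_lt continuousAt_const (by simp)).and (c2.eventually_lt continuousAt_const (by simpa using ha0))
  have main : ∀ᶠ x in 𝓝 (0:H), G (P.sum x) = 0 ∧ ∀ t ∈ Icc (0:ℝ) 1, HasDerivWithinAt (fun t => P.sum (t • x)) (X (P.sum (t • x)) x) (Icc 0 1) t := by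
    filter_upwards [hev] with x hx
    obtain ⟨α, hα0, hα⟩ := flowx (Y := fun q => X q x) (p := p) (a := a) (K := L * ‖x‖₊) (fun q hq => by
        have h1 := (hX' q hq).2 0
        rw [norm_iteratedFDeriv_zero] at h1
        simp only [Nat.factorial_zero, Nat.cast_one, mul_one, pow_zero] at h1
        exact ((X q).le_opNorm x).trans ((mul_le_mul_of_nonneg_right h1 (norm_nonneg _)).trans hx.2.le))
      (LipschitzOnWith.of_dist_le_mul fun q hq q' hq' => by
        have h1 := hL.dist_le_mul q (hs3' (Metric.closedBall_subset_ball ha.2.2 hq)) q' (hs3' (Metric.closedBall_subset_ball ha.2.2 hq'))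
        rw [dist_eq_norm] at h1 ⊢
        rw [← _root_.sub_apply]
        refine ((X q - X q').le_opNorm x).trans ((mul_le_mul_of_nonneg_right h1 (norm_nonneg _)).trans (le_of_eq ?_))
        push_cast; ring)
    have e : ∀ t ∈ Icc (0:ℝ) 1, P.sum (t • x) = α t ∧ G (α t) = 0 := by
      intro t ht
      have hmaps : MapsTo (fun τ : ℝ => t * τ) (Icc 0 1) (Icc 0 1) := fun τ hτ =>
        ⟨mul_nonneg ht.1 hτ.1, mul_le_one₀ ht.2 hτ.1 hτ.2⟩
      have := key (fun τ => α (t * τ)) (t • x) (by simpa using hα0) (fun τ hτ => ⟨(hα _ (hmaps hτ)).1, ?_⟩) ?_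
      · simpa using this
      · have h1 := (hα _ (hmaps hτ)).2.scomp τ ((hasDerivWithinAt_id τ (Icc 0 1)).const_mul t) hmaps
        simpa [Function.comp_def] using h1
      · rw [norm_smul, Real.norm_of_nonneg ht.1]
        have : t * ‖x‖ ≤ ‖x‖ := mul_le_of_le_one_left (norm_nonneg _) ht.2
        refine le_trans ?_ hx.1.le
        gcongr
    refine ⟨?_, fun t ht => ?_⟩
    · have := e 1 (by simp); rw [one_smul] at this; rw [this.1, this.2]
    · rw [(e t ht).1]
      exact (hα t ht).2.congr (fun τ hτ => (e τ hτ).1) (e t ht).1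
  refine ⟨P.sum, hP.analyticAt, ?_, main⟩
  have := key (fun _ => p) 0 rfl (fun t _ => ⟨hp, by simpa using hasDerivWithinAt_const t (Icc (0:ℝ) 1) p⟩) (by simp)
  exact this.1
end
end

section
variable {E H F : Type*} [NormedAddCommGroup E] [NormedSpace ℝ E] [NormedAddCommGroup H] [NormedSpace ℝ H]
  [NormedAddCommGroup F] [NormedSpace ℝ F]

def BX (X : E → H →L[ℝ] E) (q : E) : H →L[ℝ] H →L[ℝ] E := cmpL H E (H →L[ℝ] E) (fderiv ℝ X q) (X q)

def flL (H E : Type*) [NormedAddCommGroup H] [NormedSpace ℝ H] [NormedAddCommGroup E] [NormedSpace ℝ E] :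
    (H →L[ℝ] H →L[ℝ] E) →L[ℝ] (H →L[ℝ] H →L[ℝ] E) := (ContinuousLinearMap.flipₗᵢ ℝ H H E).toContinuousLinearEquiv.toContinuousLinearMap

def FX (X : E → H →L[ℝ] E) (q : E) : H →L[ℝ] H →L[ℝ] E := BX X q - flL H E (BX X q)

theorem FX_apply (X : E → H →L[ℝ] E) (q : E) (u v : H) : FX X q u v = fderiv ℝ X q (X q u) v - fderiv ℝ X q (X q v) u := rfl

theorem lin_an (B : E →L[ℝ] F) {f : H → E} {x : H} (hf : AnalyticAt ℝ f x) : AnalyticAt ℝ (fun y => B (f y)) x := (B.analyticAt _).comp hf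

theorem FX_an [CompleteSpace E] {X : E → H →L[ℝ] E} {q : E} (hX : AnalyticAt ℝ X q) : AnalyticAt ℝ (FX X) q := by
  have h : AnalyticAt ℝ (BX X) q := an_bil (cmpL H E (H →L[ℝ] E)) hX.fderiv hX
  have h2 := lin_an (F := H →L[ℝ] H →L[ℝ] E) (flL H E) h
  exact h.sub h2

theorem frob [CompleteSpace E] {X : E → H →L[ℝ] E} {p : E} (hX : AnalyticAt ℝ X p)
    (h0 : ∀ n, TT X (FX X) n p = 0) :
    ∃ f : H → E, AnalyticAt ℝ f 0 ∧ f 0 = p ∧ ∀ᶠ x in 𝓝 (0:H), fderiv ℝ f x = X (f x) := by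
  obtain ⟨f, hf, hf0, hev⟩ := flow_series hX (FX_an hX) h0
  refine ⟨f, hf, hf0, ?_⟩
  have hXf : AnalyticAt ℝ X (f 0) := by rwa [hf0]
  have e1 : ∀ᶠ y in 𝓝 (0:H), AnalyticAt ℝ X (f y) := hf.continuousAt.eventually hXf.eventually_analyticAt
  have e2 : ∀ᶠ y in 𝓝 (0:H), ‖fderiv ℝ X (f y)‖ < ‖fderiv ℝ X (f 0)‖ + 1 :=
    (((hXf.fderiv.continuousAt).comp (f := f) hf.continuousAt).norm).eventually_lt continuousAt_const (by simp)
  have e3 : ∀ᶠ y in 𝓝 (0:H), fderiv ℝ f y y = X (f y) y := by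
    filter_upwards [hev, hf.eventually_analyticAt] with y hy hfy
    have h1 := hy.2 1 (by simp)
    rw [one_smul] at h1
    have h2 : HasDerivAt (fun t : ℝ => f (t • y)) (fderiv ℝ f y y) 1 := by
      have h3 := ((hasDerivAt_id (1:ℝ)).smul_const y)
      have h4 : HasFDerivAt f (fderiv ℝ f y) ((1:ℝ) • y) := by rw [one_smul]; exact hfy.differentiableAt.hasFDerivAt
      simpa [Function.comp_def] using h4.comp_hasDerivAt (1:ℝ) h3
    exact (uniqueDiffOn_Icc zero_lt_one 1 (by simp)).eq_deriv _ h2.hasDerivWithinAt h1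
  obtain ⟨δ, hδ, hball⟩ := Metric.eventually_nhds_iff_ball.1 (((hev.and e1).and (e2.and (eventually_eventually_nhds.2 e3))).and hf.eventually_analyticAt)
  filter_upwards [Metric.ball_mem_nhds _ hδ] with x hx
  ext e
  rw [← sub_eq_zero]
  have hin : ∀ t ∈ Icc (0:ℝ) 1, t • x ∈ Metric.ball (0:H) δ := fun t ht => by
    rw [mem_ball_zero_iff, norm_smul, Real.norm_of_nonneg ht.1]
    rw [mem_ball_zero_iff] at hx
    exact (mul_le_of_le_one_left (norm_nonneg _) ht.2).trans_lt hx
  have hZ : ∀ t ∈ Icc (0:ℝ) 1, HasDerivAt (fun t : ℝ => t • (fderiv ℝ f (t • x) e - X (f (t • x)) e))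
      (fderiv ℝ X (f (t • x)) (t • (fderiv ℝ f (t • x) e - X (f (t • x)) e)) x) t := by
    intro t ht
    obtain ⟨⟨⟨⟨hF, -⟩, hXy⟩, -, hI⟩, hfy⟩ := hball _ (hin t ht)
    generalize hy : t • x = y at *
    have s1 : HasDerivAt (fun t : ℝ => t • x) x t := by simpa using (hasDerivAt_id t).smul_const x
    have hDf := hfy.fderiv.differentiableAt.hasFDerivAt
    have hff := hfy.differentiableAt.hasFDerivAt
    have hXX := hXy.differentiableAt.hasFDerivAt
    have hXf := hXX.comp y hff
    have d1 := (hDf.sub hXf).clm_apply (hasFDerivAt_const e y)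
    rw [← hy] at d1
    have d2 := (hasDerivAt_id t).smul (d1.comp_hasDerivAt t s1)
    rw [hy] at d2
    have d3 := ((hDf.sub hXf).clm_apply (hasFDerivAt_id y)).congr_of_eventuallyEq (f₁ := fun _ => (0:E))
      (hI.mono fun z hz => by simp [hz])
    have d4 := DFunLike.congr_fun (d3.unique (hasFDerivAt_const (0:E) y)) e
    have sy := (hfy.contDiffAt (n := ∞)).isSymmSndFDerivAt (by rw [minSmoothness_of_isRCLikeNormedField]; exact ENat.LEInfty.out) e y
    have hFe := DFunLike.congr_fun (DFunLike.congr_fun hF y) e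
    rw [FX_apply] at hFe
    have hIy := hI.self_of_nhds
    have sxy : ∀ (A : H →L[ℝ] H →L[ℝ] E) (v : H), t • A x v = A y v := fun A v => by rw [← hy, map_smul]; rfl
    have sxy2 : ∀ (A : H →L[ℝ] E), t • A x = A y := fun A => by rw [← hy, map_smul]
    convert! d2 using 1
    simp only [Function.comp_apply, ContinuousLinearMap.comp_apply, _root_.add_apply, _root_.sub_apply, ContinuousLinearMap.flip_apply, _root_.zero_apply, map_zero, zero_add,
      add_zero, id, one_smul, smul_sub, ContinuousLinearMap.coe_id', ContinuousLinearMap.id_apply, map_sub, map_smul, _root_.smul_apply, sxy2, sxy, hy] at d4 hFe sy ⊢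
    have hx1 : t • fderiv ℝ X (f y) (fderiv ℝ f y x) e = fderiv ℝ X (f y) (X (f y) y) e := by
      rw [← hIy]; exact sxy ((fderiv ℝ X (f y)).comp (fderiv ℝ f y)) e
    rw [hx1, eq_neg_of_add_eq_zero_left d4, sy, sub_eq_zero.1 hFe]; abel
  have := eq_zero_of_abs_deriv_le_mul_abs_self_of_eq_zero_right (K := (‖fderiv ℝ X (f 0)‖ + 1) * ‖x‖) (fun t ht => (hZ t ht).continuousAt.continuousWithinAt)
    (fun t ht => (hZ t ⟨ht.1, ht.2.le⟩).hasDerivWithinAt) (by simp) (fun t ht => ?_) 1 (by simp)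
  · simpa using this
  · have hb := (hball _ (hin t ⟨ht.1, ht.2.le⟩)).1.2.1
    refine (ContinuousLinearMap.le_opNorm₂ _ _ _).trans ?_
    rw [mul_right_comm]
    gcongr
end

section
variable {E H F D G : Type*} [NormedAddCommGroup E] [NormedSpace ℝ E] [NormedAddCommGroup H] [NormedSpace ℝ H]
  [NormedAddCommGroup F] [NormedSpace ℝ F] [NormedAddCommGroup D] [NormedSpace ℝ D] [NormedAddCommGroup G] [NormedSpace ℝ G]

theorem Sm.lin {f : D → E} {x : D} (hf : Sm f x) (B : E →L[ℝ] F) : Sm (fun y => B (f y)) x := hf.mono fun _ h => B.contDiff.contDiffAt.comp _ h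

theorem Sm.bil {f : D → E} {g : D → F} {x : D} (hf : Sm f x) (hg : Sm g x) (B : E →L[ℝ] F →L[ℝ] G) : Sm (fun y => B (f y) (g y)) x := by
  filter_upwards [hf.lin B, hg] with y h1 h2 using h1.clm_apply h2

theorem Sm.fderiv {f : D → E} {x : D} (hf : Sm f x) : Sm (fderiv ℝ f) x := hf.mono fun _ h => h.fderiv_right (m := ∞) (by simp)

theorem Sm.sub {f g : D → E} {x : D} (hf : Sm f x) (hg : Sm g x) : Sm (fun y => f y - g y) x := by
  filter_upwards [hf, hg] with y h1 h2 using h1.sub h2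

theorem Sm.an [CompleteSpace F] {f : D → E} {g : E → F} {x : D} (hf : Sm f x) (hg : AnalyticAt ℝ g (f x)) : Sm (fun y => g (f y)) x := by
  filter_upwards [hf, (hf.self_of_nhds.continuousAt).eventually hg.sm] with y h1 h2 using h2.comp _ h1

theorem Sm.diff {f : D → E} {x : D} (hf : Sm f x) : ∀ᶠ y in 𝓝 x, HasFDerivAt f (_root_.fderiv ℝ f y) y :=
  hf.mono fun _ h => (h.differentiableAt (by simp)).hasFDerivAt

def Flat (k : ℕ) (f : D → E) : Prop := Sm f 0 ∧ ∀ i < k, iteratedFDeriv ℝ i f 0 = 0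

theorem Flat.lin {k : ℕ} {f : D → E} (hf : Flat k f) (B : E →L[ℝ] F) : Flat k (fun y => B (f y)) := by
  refine ⟨hf.1.lin B, fun i hi => ?_⟩
  have := B.iteratedFDeriv_comp_left hf.1.self_of_nhds (i := i) (by exact_mod_cast le_top)
  rw [Function.comp_def] at this
  rw [this, hf.2 i hi]; ext; simp

theorem Flat.sub {k : ℕ} {f g : D → E} (hf : Flat k f) (hg : Flat k g) : Flat k (fun y => f y - g y) := by
  refine ⟨hf.1.sub hg.1, fun i hi => ?_⟩
  have := iteratedFDeriv_sub_apply (i := i) (hf.1.self_of_nhds.of_le (by exact_mod_cast le_top)) (hg.1.self_of_nhds.of_le (by exact_mod_cast le_top))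
  rw [hf.2 i hi, hg.2 i hi, sub_zero] at this
  exact this

theorem Flat.mono {k m : ℕ} {f : D → E} (hf : Flat k f) (h : m ≤ k) : Flat m f := ⟨hf.1, fun i hi => hf.2 i (by omega)⟩

theorem Flat.congr {k : ℕ} {f g : D → E} (hf : Flat k f) (h : g =ᶠ[𝓝 (0:D)] f) : Flat k g := by
  refine ⟨?_, fun i hi => ?_⟩
  · filter_upwards [hf.1, h.eventuallyEq_nhds] with y h1 h2 using h1.congr_of_eventuallyEq h2
  · rw [h.iteratedFDeriv ℝ i |>.self_of_nhds, hf.2 i hi]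

theorem Flat.fderiv {k : ℕ} {f : D → E} (hf : Flat (k+1) f) : Flat k (fderiv ℝ f) := by
  refine ⟨hf.1.fderiv, fun i hi => ?_⟩
  rw [← norm_eq_zero, norm_iteratedFDeriv_fderiv, hf.2 (i+1) (by omega), norm_zero]

theorem Flat.bil_l {k : ℕ} {f : D → E} {g : D → F} (hf : Flat k f) (hg : Sm g 0) (B : E →L[ℝ] F →L[ℝ] G) : Flat k (fun y => B (f y) (g y)) := by
  refine ⟨hf.1.bil hg B, fun i hi => ?_⟩
  have := _root_.bil B hf.1 hg i
  rw [← norm_le_zero_iff]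
  refine this.trans (le_of_eq ?_)
  rw [Finset.sum_eq_zero, mul_zero]
  intro j hj
  rw [Finset.mem_range] at hj
  rw [hf.2 j (by omega)]; simp

theorem Flat.bil_r {k : ℕ} {f : D → E} {g : D → F} (hf : Sm f 0) (hg : Flat k g) (B : E →L[ℝ] F →L[ℝ] G) : Flat k (fun y => B (f y) (g y)) :=
  hg.bil_l hf B.flip

theorem sm_inv [CompleteSpace D] [CompleteSpace H] {A : D → D →L[ℝ] H} (hA : Sm A 0) (e : D ≃L[ℝ] H) (he : A 0 = e) :
    ∃ B : D → H →L[ℝ] D, Sm B 0 ∧ ∀ᶠ y in 𝓝 0, ∀ a, A y (B y a) = a := by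
  have hc : ∀ᶠ y in 𝓝 0, A y ∈ range ((↑) : (D ≃L[ℝ] H) → D →L[ℝ] H) :=
    hA.self_of_nhds.continuousAt.eventually (by rw [he]; exact e.nhds)
  refine ⟨fun y => (A y).inverse, ?_, ?_⟩
  · filter_upwards [hc, hA] with y h1 h2
    obtain ⟨e', he'⟩ := h1
    exact ContDiffAt.comp (g := ContinuousLinearMap.inverse) y (by rw [← he']; exact contDiffAt_map_inverse e') h2
  · filter_upwards [hc] with y h1 a
    obtain ⟨e', he'⟩ := h1
    rw [← he', ContinuousLinearMap.inverse_equiv]; simp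

theorem flat_step [CompleteSpace F] {X : E → H →L[ℝ] E} {γ : D → E} {R : D → D →L[ℝ] E} {B : D → H →L[ℝ] D} {m : ℕ} (π : E →L[ℝ] H) (hγ : Sm γ 0)
    (hR : Flat m R) (hd : ∀ᶠ y in 𝓝 0, fderiv ℝ γ y = (X (γ y)).comp (π.comp (fderiv ℝ γ y)) + R y) (hB : Sm B 0) (hAB : ∀ᶠ y in 𝓝 0, ∀ a, π (fderiv ℝ γ y (B y a)) = a)
    {T : E → F} (hT : AnalyticAt ℝ T (γ 0)) (hf : Flat (m + 1) (fun y => T (γ y))) : Flat m (fun y => cmpL H E F (fderiv ℝ T (γ y)) (X (γ y))) := by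
  have h2 : Flat m (fun y => cmpL D E F (fderiv ℝ T (γ y)) (R y)) := Flat.bil_r (hγ.an hT.fderiv) hR _
  refine ((hf.fderiv.sub h2).bil_l hB (cmpL H D F)).congr ?_
  filter_upwards [hAB, hγ.diff, hγ.self_of_nhds.continuousAt.eventually hT.eventually_analyticAt, hd] with y a1 a2 a3 a4
  have a5 := (a3.differentiableAt.hasFDerivAt.comp y a2).fderiv
  rw [Function.comp_def] at a5
  ext a
  rw [a5]
  show fderiv ℝ T (γ y) (X (γ y) a) = fderiv ℝ T (γ y) (fderiv ℝ γ y (B y a)) - fderiv ℝ T (γ y) (R y (B y a))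
  rw [← map_sub]
  have := DFunLike.congr_fun a4 (B y a)
  simp only [_root_.add_apply, ContinuousLinearMap.comp_apply, a1] at this
  rw [this, add_sub_cancel_right]

theorem flat_ind [CompleteSpace F] [CompleteSpace E] {X : E → H →L[ℝ] E} {γ : D → E} {R : D → D →L[ℝ] E} {B : D → H →L[ℝ] D} {k : ℕ} (π : E →L[ℝ] H) (hγ : Sm γ 0)
    (hX : AnalyticAt ℝ X (γ 0)) (hR : Flat k R) (hd : ∀ᶠ y in 𝓝 0, fderiv ℝ γ y = (X (γ y)).comp (π.comp (fderiv ℝ γ y)) + R y) (hB : Sm B 0) (hAB : ∀ᶠ y in 𝓝 0, ∀ a, π (fderiv ℝ γ y (B y a)) = a)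
    {T : E → F} (hT : AnalyticAt ℝ T (γ 0)) (hf : Flat k (fun y => T (γ y))) (n : ℕ) (hn : n < k) : TT X T n (γ 0) = 0 := by
  have hn' : Flat (k - n) (fun y => TT X T n (γ y)) := by
    induction n with
    | zero => exact hf.lin (continuousMultilinearCurryFin0 ℝ H F).symm.toContinuousLinearEquiv.toContinuousLinearMap
    | succ n ih =>
      have ih := ih (by omega)
      rw [show k - n = k - (n + 1) + 1 by omega] at ih
      exact (flat_step π hγ (hR.mono (by omega)) hd hB hAB (TT_an hX hT n) ih).lin (cuL H F n).toContinuousLinearEquiv.toContinuousLinearMap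
  have := hn'.2 0 (by omega)
  have h2 := DFunLike.congr_fun this (0 : Fin 0 → D)
  rwa [iteratedFDeriv_zero_apply, _root_.zero_apply] at h2

theorem flat_TT [CompleteSpace D] [CompleteSpace H] [CompleteSpace E] {X : E → H →L[ℝ] E} {γ : D → E} {R : D → D →L[ℝ] E} {k : ℕ} (π : E →L[ℝ] H) (hγ : Sm γ 0)
    (hX : AnalyticAt ℝ X (γ 0)) (hR : Flat k R) (e : D ≃L[ℝ] H) (he : π.comp (fderiv ℝ γ 0) = e)
    (hd : ∀ᶠ y in 𝓝 0, fderiv ℝ γ y = (X (γ y)).comp (π.comp (fderiv ℝ γ y)) + R y) (n : ℕ) (hn : n + 1 < k) : TT X (FX X) n (γ 0) = 0 := by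
  obtain ⟨B, hB, hAB⟩ := sm_inv (hγ.fderiv.lin (cmpL D E H π)) e he
  change ∀ᶠ y in 𝓝 0, ∀ a, π (fderiv ℝ γ y (B y a)) = a at hAB
  have h0 : Flat (k - 1) (fun y => FX X (γ y)) := by
    have hP : Flat k (fun y => cmpL H E (H →L[ℝ] E) (fderiv ℝ X (γ y)) (cmpL H D E (R y) (B y))) :=
      Flat.bil_r (hγ.an hX.fderiv) (hR.bil_l hB _) _
    have hS : Flat (k - 1) (fun y => cmpL H (D →L[ℝ] E) (H →L[ℝ] E) ((cmpL H D E).flip (B y)) (cmpL H D (D →L[ℝ] E) (fderiv ℝ R y) (B y))) :=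
      Flat.bil_r (hB.lin _) ((Flat.fderiv (by rwa [Nat.sub_add_cancel (by omega)])).bil_l hB _) _
    have hPS := (hP.mono (show k - 1 ≤ k by omega)).lin (-ContinuousLinearMap.id ℝ _) |>.sub hS
    refine (hPS.sub (hPS.lin (flL H E))).congr ?_
    filter_upwards [hAB, hγ, hγ.fderiv, hγ.diff, hR.1.diff, hγ.self_of_nhds.continuousAt.eventually hX.eventually_analyticAt, hd, eventually_eventually_nhds.2 hd] with y h1 h2 h2' h3 h4 h5 h6 h7
    ext a b
    have hDf := (h2'.differentiableAt (by simp)).hasFDerivAt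
    have hXf := h5.differentiableAt.hasFDerivAt.comp y h3
    have d1 := ((hXf.clm_comp ((hasFDerivAt_const π y).clm_comp hDf)).add h4).congr_of_eventuallyEq h7
    have sy := h2.isSymmSndFDerivAt (by rw [minSmoothness_of_isRCLikeNormedField]; exact ENat.LEInfty.out) (B y a) (B y b)
    have e1 : ∀ u v, X (γ y) (π (fderiv ℝ (fderiv ℝ γ) y u v)) + fderiv ℝ X (γ y) (fderiv ℝ γ y u) (π (fderiv ℝ γ y v)) + fderiv ℝ R y u v = fderiv ℝ (fderiv ℝ γ) y u v := by
      intro u v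
      have ea := DFunLike.congr_fun (DFunLike.congr_fun (d1.unique hDf) u) v
      simpa using ea
    have e2 : ∀ a, fderiv ℝ γ y (B y a) = X (γ y) a + R y (B y a) := by
      intro a
      have := DFunLike.congr_fun h6 (B y a)
      simpa only [_root_.add_apply, ContinuousLinearMap.comp_apply, h1] using this
    have e3 := (e1 (B y a) (B y b)).trans (sy.trans (e1 (B y b) (B y a)).symm)
    rw [sy, h1, h1, e2, e2, map_add, map_add, _root_.add_apply, _root_.add_apply] at e3
    show fderiv ℝ X (γ y) (X (γ y) a) b - fderiv ℝ X (γ y) (X (γ y) b) a = (-fderiv ℝ X (γ y) (R y (B y a)) b - fderiv ℝ R y (B y a) (B y b)) -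
      (-fderiv ℝ X (γ y) (R y (B y b)) a - fderiv ℝ R y (B y b) (B y a))
    rw [← sub_eq_zero] at e3
    rw [← sub_eq_zero, ← e3]; abel
  exact flat_ind π hγ hX (hR.mono (Nat.sub_le k 1)) hd hB hAB (FX_an hX) h0 n (by omega)
end

section
variable {E : Type*} [NormedAddCommGroup E] [NormedSpace ℝ E]

def PK (θ : E → E →L[ℝ] ℂ) (k : ℕ) (q : E) : Prop := ∃ γ : ℝ × ℝ → E, Sm γ 0 ∧ γ 0 = q ∧ Function.Injective (fderiv ℝ γ 0) ∧
  Flat k (fun y => cmpL (ℝ × ℝ) E ℂ (θ (γ y)) (fderiv ℝ γ y))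

theorem bdd_ev {F : Type*} [NormedAddCommGroup F] {f : E → F} {p : E} (hf : ContinuousAt f p) : ∃ c, 0 ≤ c ∧ ∀ᶠ q in 𝓝 p, ‖f q‖ ≤ c :=
  ⟨‖f p‖ + 1, by positivity, (hf.norm.eventually_lt continuousAt_const (by simp)).mono fun _ h => h.le⟩

theorem ct_ev {H : Type*} [NormedAddCommGroup H] [NormedSpace ℝ H] {g : H → E} (h : ∀ᶠ x in 𝓝 (0:H), HasFDerivAt g (0 : H →L[ℝ] E) x) :
    ∀ᶠ x in 𝓝 (0:H), g x = g 0 := by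
  obtain ⟨δ, hδ, hb⟩ := Metric.eventually_nhds_iff_ball.1 h
  filter_upwards [Metric.ball_mem_nhds _ hδ] with x hx
  have := (convex_ball (0:H) δ).norm_image_sub_le_of_norm_hasFDerivWithin_le (C := 0) (fun y hy => (hb y hy).hasFDerivWithinAt) (by simp) (Metric.mem_ball_self hδ) hx
  rw [zero_mul, norm_le_zero_iff, sub_eq_zero] at this
  exact this

theorem split_ev {θ : E → E →L[ℝ] ℂ} {p : E} (hθ : AnalyticAt ℝ θ p) (σ : ℂ →L[ℝ] E) (hσ : ∀ c, θ p (σ c) = c) :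
    ∃ Λ : E → ℂ →L[ℝ] E, AnalyticAt ℝ Λ p ∧ ∀ᶠ q in 𝓝 p, (∀ c, θ q (Λ q c) = c) ∧ (∀ c, Λ q (θ q (σ c)) = σ c) ∧ ∀ c, ∃ d, Λ q c = σ d := by
  have h1 : (θ p).comp σ = 1 := by ext1 c; exact hσ c
  have hm : AnalyticAt ℝ (fun q => (θ q).comp σ) p := lin_an ((cmpL ℂ E ℂ).flip σ) hθ
  have hI : AnalyticAt ℝ (Ring.inverse : (ℂ →L[ℝ] ℂ) → _) ((θ p).comp σ) := by
    have := analyticAt_inverse (𝕜 := ℝ) (1 : (ℂ →L[ℝ] ℂ)ˣ)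
    rw [h1]; exact this
  refine ⟨fun q => σ.comp (Ring.inverse ((θ q).comp σ)), lin_an (cmpL ℂ ℂ E σ) (hI.comp (f := fun q => (θ q).comp σ) hm), ?_⟩
  have hu : ∀ᶠ q in 𝓝 p, IsUnit ((θ q).comp σ) := hm.continuousAt.eventually (by
    show ∀ᶠ y in 𝓝 ((θ p).comp σ), IsUnit y
    rw [h1]; exact (Units.isOpen).mem_nhds isUnit_one)
  filter_upwards [hu] with q hq
  refine ⟨fun c => DFunLike.congr_fun (Ring.mul_inverse_cancel _ hq) c, fun c => ?_, fun c => ⟨_, rfl⟩⟩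
  exact congrArg σ (DFunLike.congr_fun (Ring.inverse_mul_cancel _ hq) c)

theorem geo [FiniteDimensional ℝ E] (h4 : Module.finrank ℝ E = 4) {θ : E → E →L[ℝ] ℂ} {ρ : E → ℝ} {p : E} {K : Set E} (hθ : AnalyticAt ℝ θ p) (hs : Function.Surjective (θ p))
    (hρ : ∀ᶠ q in 𝓝 p, HasFDerivAt ρ (Complex.reCLM.comp (θ q)) q) (hρ0 : ρ p = 0) (hK : ∀ᶠ q in 𝓝 p, ρ q = 0 → (∀ k, PK θ k q) → q ∈ K)
    (hp : ∀ k, ∃ᶠ q in 𝓝 p, PK θ k q) :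
    ∃ (w : E → ℂ) (C : ℝ), 0 ≤ C ∧ w p = 0 ∧ ∀ᶠ q in 𝓝 p, ContDiffAt ℝ 2 w q ∧ Metric.infDist q K ≤ C * ‖w q‖ ∧ ∀ v, ‖fderiv ℝ w q v - θ q v‖ ≤ C * ‖w q‖ * ‖v‖ := by
  have : CompleteSpace E := FiniteDimensional.complete ℝ E
  obtain ⟨σ', hσ'⟩ := (θ p : E →ₗ[ℝ] ℂ).exists_rightInverse_of_surjective (LinearMap.range_eq_top.2 hs)
  obtain ⟨σ, hσ⟩ : ∃ σ : ℂ →L[ℝ] E, ∀ c, θ p (σ c) = c := ⟨σ'.toContinuousLinearMap, fun c => LinearMap.congr_fun hσ' c⟩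
  clear hσ' σ'
  obtain ⟨Λ, hΛ, hev⟩ := split_ev hθ σ hσ
  let H := LinearMap.ker (θ p : E →ₗ[ℝ] ℂ)
  have hH2 : Module.finrank ℝ H = 2 := by
    have := (θ p : E →ₗ[ℝ] ℂ).finrank_range_add_finrank_ker
    rw [LinearMap.range_eq_top.2 hs, finrank_top, Complex.finrank_real_complex, h4] at this
    show Module.finrank ℝ (LinearMap.ker (θ p : E →ₗ[ℝ] ℂ)) = 2
    omega
  obtain ⟨π, hπ⟩ : ∃ π : E →L[ℝ] H, ∀ v, ((π v : H) : E) = v - σ (θ p v) :=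
    ⟨(ContinuousLinearMap.id ℝ E - σ.comp (θ p)).codRestrict H (fun v => by show θ p (v - σ (θ p v)) = 0; rw [map_sub, hσ, sub_self]), fun v => rfl⟩
  obtain ⟨X, hXe⟩ : ∃ X : E → H →L[ℝ] E, X = fun q => (ContinuousLinearMap.id ℝ E - (Λ q).comp (θ q)).comp H.subtypeL := ⟨_, rfl⟩
  have hX : AnalyticAt ℝ X p := by
    have h1 : AnalyticAt ℝ (fun q => ContinuousLinearMap.id ℝ E - (Λ q).comp (θ q)) p := analyticAt_const.sub (an_bil (cmpL E ℂ E) hΛ hθ)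
    rw [hXe]; exact lin_an ((cmpL H E E).flip H.subtypeL) h1
  have hXa : ∀ q x, X q x = x - Λ q (θ q x) := fun q x => by rw [hXe]; rfl
  clear hXe
  have hθH : ∀ x : H, θ p x = 0 := fun x => x.2
  have hπσ : ∀ c, π (σ c) = 0 := fun c => by ext; rw [hπ, hσ, sub_self]; rfl
  have hπH : ∀ x : H, π x = x := fun x => by ext; rw [hπ, hθH, map_zero, sub_zero]
  have hΛσ : ∀ᶠ q in 𝓝 p, ∀ c, π (Λ q c) = 0 := by
    filter_upwards [hev] with q hq c
    obtain ⟨d, hd⟩ := hq.2.2 c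
    rw [hd, hπσ]
  have hall : ∀ᶠ q in 𝓝 p, (∀ x, θ q (X q x) = 0) ∧ (∀ x, π (X q x) = x) ∧ ∀ v, X q (π v) + Λ q (θ q v) = v := by
    filter_upwards [hev, hΛσ] with q hq h2
    refine ⟨fun x => by rw [hXa, map_sub, hq.1, sub_self], fun x => by rw [hXa, map_sub, h2, sub_zero, hπH], fun v => ?_⟩
    rw [hXa, hπ, map_sub (θ q), map_sub, hq.2.1]; abel
  have hTT : ∀ n, TT X (FX X) n p = 0 := by
    intro n
    by_contra hne
    have e1 := (TT_an hX (FX_an hX) n).continuousAt.eventually_ne hne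
    obtain ⟨q, ⟨γ, hγ, rfl, hinj, hfl⟩, h1, h2, h3, h4, h5⟩ := ((hp (n + 2)).and_eventually (e1.and (hX.eventually_analyticAt.and (hΛ.eventually_analyticAt.and (hall.and (eventually_eventually_nhds.2 hall)))))).exists
    apply h1
    have hz : ∀ u, θ (γ 0) (fderiv ℝ γ 0 u) = 0 := fun u => by
      have := DFunLike.congr_fun (hfl.2 0 (by omega)) (0 : Fin 0 → ℝ × ℝ)
      rw [iteratedFDeriv_zero_apply, _root_.zero_apply] at this
      exact DFunLike.congr_fun this u
    have hinj2 : Function.Injective (π.comp (fderiv ℝ γ 0) : ℝ × ℝ →ₗ[ℝ] H) := by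
      rw [injective_iff_map_eq_zero]
      intro u hu
      have := h4.2.2 (fderiv ℝ γ 0 u)
      rw [hz, map_zero, add_zero, show π (fderiv ℝ γ 0 u) = 0 from hu, map_zero] at this
      exact (injective_iff_map_eq_zero _).1 hinj u this.symm
    let e := (LinearEquiv.ofInjectiveOfFinrankEq _ hinj2 (by rw [hH2]; simp)).toContinuousLinearEquiv
    refine flat_TT (R := fun y => cmpL (ℝ × ℝ) ℂ E (Λ (γ y)) (cmpL (ℝ × ℝ) E ℂ (θ (γ y)) (fderiv ℝ γ y))) π hγ h2 (Flat.bil_r (hγ.an h3) hfl _) e rfl ?_ n (by omega)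
    filter_upwards [hγ.self_of_nhds.continuousAt.eventually h5] with y hy
    refine ContinuousLinearMap.ext fun u => ?_
    exact (hy.2.2 _).symm
  obtain ⟨f, hf, hf0, hDf⟩ := frob hX hTT
  have hfp : Tendsto f (𝓝 0) (𝓝 p) := hf0 ▸ hf.continuousAt
  have hDf' : ∀ᶠ x in 𝓝 (0:H), HasFDerivAt f (X (f x)) x := by
    filter_upwards [hDf, hf.eventually_analyticAt] with x h1 h2 using h1 ▸ h2.differentiableAt.hasFDerivAt
  have hρf : ∀ᶠ x in 𝓝 (0:H), ρ (f x) = 0 := by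
    have : ∀ᶠ x in 𝓝 (0:H), HasFDerivAt (ρ ∘ f) (0 : H →L[ℝ] ℝ) x := by
      filter_upwards [hDf', hfp.eventually hρ, hfp.eventually hall] with x h1 h2 h3
      convert! h2.comp x h1
      ext u
      simp [h3.1]
    filter_upwards [ct_ev this] with x hx
    rw [Function.comp_apply, Function.comp_apply, hf0, hρ0] at hx; exact hx
  have hπf : ∀ᶠ x in 𝓝 (0:H), π (f x) = x + π p := by
    have : ∀ᶠ x in 𝓝 (0:H), HasFDerivAt (fun x => π (f x) - x) (0 : H →L[ℝ] H) x := by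
      filter_upwards [hDf', hfp.eventually hall] with x h1 h3
      have e : π.comp (X (f x)) - ContinuousLinearMap.id ℝ H = 0 := ContinuousLinearMap.ext fun u => by simp [h3.2.1]
      exact e ▸ (π.hasFDerivAt.comp x h1).sub (hasFDerivAt_id x)
    filter_upwards [ct_ev this] with x hx
    rw [hf0, sub_zero, sub_eq_iff_eq_add'] at hx; exact hx
  have hfK : ∀ᶠ x in 𝓝 (0:H), f x ∈ K := by
    let L : (ℝ × ℝ) ≃L[ℝ] H := ContinuousLinearEquiv.ofFinrankEq (by rw [hH2]; simp)
    filter_upwards [hfp.eventually hK, hρf, eventually_eventually_nhds.2 (hDf'.and (hfp.eventually hall)), eventually_eventually_nhds.2 hf.eventually_analyticAt] with x h1 h2 h3 h4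
    refine h1 h2 fun k => ?_
    have hc : Tendsto (fun z : ℝ × ℝ => x + L z) (𝓝 0) (𝓝 x) := by
      have : ContinuousAt (fun z : ℝ × ℝ => x + L z) 0 := by fun_prop
      simpa [ContinuousAt] using this
    have hd : ∀ᶠ z in 𝓝 (0 : ℝ × ℝ), HasFDerivAt (fun z => f (x + L z)) ((X (f (x + L z))).comp (L : ℝ × ℝ →L[ℝ] H)) z ∧ ∀ u, θ (f (x + L z)) (X (f (x + L z)) u) = 0 := by
      filter_upwards [hc.eventually h3] with z hz
      exact ⟨hz.1.comp z (((L : ℝ × ℝ →L[ℝ] H).hasFDerivAt).const_add x), hz.2.1⟩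
    refine ⟨fun z => f (x + L z), ?_, by simp, ?_, ?_⟩
    · filter_upwards [hc.eventually h4] with z hz
      exact hz.contDiffAt.comp z (contDiffAt_const.add L.contDiff.contDiffAt)
    · have := hd.self_of_nhds.1.fderiv
      rw [this]
      simp only [map_zero, add_zero]
      refine Function.Injective.comp (g := X (f x)) (fun a b hab => ?_) L.injective
      rw [← h3.self_of_nhds.2.2.1 a, hab, h3.self_of_nhds.2.2.1 b]
    · refine Flat.congr (f := fun _ => 0) ⟨Eventually.of_forall fun _ => contDiffAt_const, fun i _ => by rw [show (fun _ : ℝ × ℝ => (0 : ℝ × ℝ →L[ℝ] ℂ)) = 0 from rfl, iteratedFDeriv_zero]; rfl⟩ ?_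
      filter_upwards [hd] with z hz
      refine ContinuousLinearMap.ext fun u => ?_
      rw [hz.1.fderiv]
      exact hz.2 (L u)
  have hc : Tendsto (fun q => π (q - p)) (𝓝 p) (𝓝 0) := by
    have : ContinuousAt (fun q => π (q - p)) p := by fun_prop
    simpa [ContinuousAt] using this
  obtain ⟨c1, hc1, hb1⟩ := bdd_ev hθ.continuousAt
  obtain ⟨c2, hc2, hb2⟩ := bdd_ev hθ.fderiv.continuousAt
  obtain ⟨c3, hc3, hb3⟩ := bdd_ev hΛ.continuousAt
  obtain ⟨L, S, hS, hL⟩ := (hX.contDiffAt (n := 1)).exists_lipschitzOnWith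
  have hfc : Tendsto (fun q => f (π (q - p))) (𝓝 p) (𝓝 p) := hfp.comp hc
  refine ⟨fun q => θ q (q - f (π (q - p))), c3 + (c2 + c1 * L * ‖π‖) * c3, by positivity, by simp [hf0], ?_⟩
  filter_upwards [hc.eventually hπf, hc.eventually hDf', hc.eventually hfK, hc.eventually hf.eventually_analyticAt, hall, hb1, hb2, hb3, hS, hfc.eventually hS, hθ.eventually_analyticAt] with
    q e1 e2 e3 e4 e5 e6 e7 e8 e9 e10 e11
  generalize hw : q - f (π (q - p)) = w0
  have hw0 : w0 = Λ q (θ q w0) := by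
    have := e5.2.2 w0
    rw [show π w0 = 0 by rw [← hw, map_sub, e1, map_sub]; abel, map_zero, zero_add] at this
    exact this.symm
  have hn : ‖w0‖ ≤ c3 * ‖θ q w0‖ := by
    conv_lhs => rw [hw0]
    exact ((Λ q).le_opNorm _).trans (by gcongr)
  have hd0 : HasFDerivAt (fun q => q - f (π (q - p))) (ContinuousLinearMap.id ℝ E - (X (f (π (q - p)))).comp π) q :=
    (hasFDerivAt_id q).sub (e2.comp q (π.hasFDerivAt.comp q ((hasFDerivAt_id q).sub_const p)))
  refine ⟨?_, ?_, fun v => ?_⟩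
  · have s1 : ContDiffAt ℝ 2 (fun q => f (π (q - p))) q := e4.contDiffAt.comp q (π.contDiff.contDiffAt.comp q (contDiffAt_id.sub contDiffAt_const))
    exact e11.contDiffAt.clm_apply (contDiffAt_id.sub s1)
  · refine (Metric.infDist_le_dist_of_mem e3).trans ?_
    rw [dist_eq_norm, hw]
    refine hn.trans ?_
    gcongr
    have : 0 ≤ (c2 + c1 * L * ‖π‖) * c3 := by positivity
    linarith
  · rw [(e11.differentiableAt.hasFDerivAt.clm_apply hd0).fderiv]
    simp only [_root_.add_apply, ContinuousLinearMap.comp_apply, _root_.sub_apply, ContinuousLinearMap.flip_apply, hw, ContinuousLinearMap.id_apply, map_sub (θ q)]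
    have h1 : θ q (X (f (π (q - p))) (π v)) = -θ q ((X q - X (f (π (q - p)))) (π v)) := by
      rw [_root_.sub_apply, map_sub (θ q), e5.1, zero_sub, neg_neg]
    have h2 : ‖X q - X (f (π (q - p)))‖ ≤ L * ‖w0‖ := by
      have := hL.dist_le_mul q e9 _ e10
      rwa [dist_eq_norm, dist_eq_norm, hw] at this
    have h3 : ‖θ q ((X q - X (f (π (q - p)))) (π v))‖ ≤ c1 * ((L * ‖w0‖) * (‖π‖ * ‖v‖)) :=
      ((θ q).le_opNorm _).trans (mul_le_mul e6 (((X q - X (f (π (q - p)))).le_opNorm _).trans (mul_le_mul h2 (π.le_opNorm v) (norm_nonneg _) (by positivity))) (norm_nonneg _) hc1)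
    have h4 : ‖fderiv ℝ θ q v w0‖ ≤ c2 * ‖v‖ * ‖w0‖ := (ContinuousLinearMap.le_opNorm₂ _ _ _).trans (by gcongr)
    rw [h1, show θ q v - -θ q ((X q - X (f (π (q - p)))) (π v)) + fderiv ℝ θ q v w0 - θ q v = θ q ((X q - X (f (π (q - p)))) (π v)) + fderiv ℝ θ q v w0 by abel]
    refine (norm_add_le _ _).trans ((add_le_add h3 h4).trans ?_)
    calc _ = (c2 + c1 * L * ‖π‖) * ‖w0‖ * ‖v‖ := by ring
      _ ≤ (c2 + c1 * L * ‖π‖) * (c3 * ‖θ q w0‖) * ‖v‖ := by gcongr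
      _ = (0 + (c2 + c1 * L * ‖π‖) * c3) * ‖θ q w0‖ * ‖v‖ := by ring
      _ ≤ _ := by gcongr
end

section
variable {V : Type*} [NormedAddCommGroup V] [InnerProductSpace ℂ V] [FiniteDimensional ℂ V]

def mI (V : Type*) [NormedAddCommGroup V] [InnerProductSpace ℂ V] : V →L[ℝ] V := ((Complex.I : ℂ) • ContinuousLinearMap.id ℂ V).restrictScalars ℝ

theorem mI_a (v : V) : mI V v = Complex.I • v := rfl

def QQ (j : V →L[ℝ] V) : V →L[ℝ] V := (1 + (mI V).comp j) * Ring.inverse (1 - (mI V).comp j)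

theorem QQ_nrm (j : V →L[ℝ] V) (v : V) : ‖v - Complex.I • j v‖ ^ 2 - ‖v + Complex.I • j v‖ ^ 2 = 4 * (inner ℂ v (j v)).im := by
  rw [@norm_sub_sq ℂ, @norm_add_sq ℂ, inner_smul_right]
  simp; ring

theorem QQ_u {j : V →L[ℝ] V} (h : ∀ v, v ≠ 0 → 0 < (inner ℂ v (j v)).im) : IsUnit (1 - (mI V).comp j) := by
  have hi : Function.Injective ((1 - (mI V).comp j : V →L[ℝ] V) : V →ₗ[ℝ] V) := by
    rw [injective_iff_map_eq_zero]
    intro v hv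
    by_contra h0
    have h1 := QQ_nrm j v
    have h2 : v - Complex.I • j v = 0 := hv
    rw [h2, norm_zero] at h1
    nlinarith [h v h0, sq_nonneg ‖v + Complex.I • j v‖]
  exact ContinuousLinearMap.isUnit_iff_bijective.2 ⟨hi, LinearMap.injective_iff_surjective.1 hi⟩

theorem QQ_e {j : V →L[ℝ] V} (h : ∀ v, v ≠ 0 → 0 < (inner ℂ v (j v)).im) (ξ : V) :
    ∃ v, ξ = v - Complex.I • j v ∧ QQ j ξ = v + Complex.I • j v := by
  refine ⟨Ring.inverse (1 - (mI V).comp j) ξ, ?_, rfl⟩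
  exact (DFunLike.congr_fun (Ring.mul_inverse_cancel _ (QQ_u h)) ξ).symm

theorem QQ_lt {j : V →L[ℝ] V} (h : ∀ v, v ≠ 0 → 0 < (inner ℂ v (j v)).im) {ξ : V} (h0 : ξ ≠ 0) : ‖QQ j ξ‖ < ‖ξ‖ := by
  obtain ⟨v, h1, h2⟩ := QQ_e h ξ
  have hv : v ≠ 0 := by rintro rfl; apply h0; simpa using h1
  have h3 := QQ_nrm j v
  rw [← h1, ← h2] at h3
  refine lt_of_pow_lt_pow_left₀ 2 (norm_nonneg _) ?_
  linarith [h v hv]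

theorem QQ_an {j : V → V →L[ℝ] V} {x : V} (hj : AnalyticAt ℝ j x) (h : ∀ v, v ≠ 0 → 0 < (inner ℂ v (j x v)).im) : AnalyticAt ℝ (fun x => QQ (j x)) x := by
  have : CompleteSpace V := FiniteDimensional.complete ℂ V
  have h1 : AnalyticAt ℝ (fun x => (mI V).comp (j x)) x := lin_an (cmpL V V V (mI V)) hj
  obtain ⟨u, hu⟩ := QQ_u h
  have h2 := analyticAt_inverse (𝕜 := ℝ) u
  rw [hu] at h2
  have h3 : AnalyticAt ℝ (fun x => 1 - (mI V).comp (j x)) x := analyticAt_const.sub h1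
  exact (analyticAt_const.add h1).mul (h2.comp (f := fun x => 1 - (mI V).comp (j x)) h3)

theorem QQ_bd {e : V} (he : ‖e‖ = 1) {j : V → V →L[ℝ] V} (hQ : ∀ x, AnalyticAt ℝ (fun x => QQ (j x)) x) (ht : ∀ x v, v ≠ 0 → 0 < (inner ℂ v (j x v)).im) {a : ℝ} (ha0 : 0 < a) :
    ∃ q : ℝ, 0 < q ∧ q < 1 ∧ ∀ x ∈ Metric.closedBall (0:V) (2 * a), ‖QQ (j x)‖ ≤ q := by
    have : FiniteDimensional ℝ V := inferInstance
    have : ProperSpace V := FiniteDimensional.proper ℝ V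
    have hK : IsCompact (Metric.closedBall (0:V) (2 * a) ×ˢ Metric.sphere (0:V) 1) := (isCompact_closedBall _ _).prod (isCompact_sphere _ _)
    have hc : Continuous fun z : V × V => ‖QQ (j z.1) z.2‖ := by
      have : Continuous fun x => QQ (j x) := continuous_iff_continuousAt.2 fun x => (hQ x).continuousAt
      exact ((this.comp continuous_fst).clm_apply continuous_snd).norm
    obtain ⟨z, hz, hm⟩ := hK.exists_isMaxOn ⟨(0, e), Metric.mem_closedBall_self (by linarith), by simp [he]⟩ hc.continuousOn
    have hz1 : ‖QQ (j z.1) z.2‖ < 1 := by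
      have h1 : ‖z.2‖ = 1 := by simpa using hz.2
      have := QQ_lt (ht z.1) (ξ := z.2) (norm_ne_zero_iff.1 (by rw [h1]; exact one_ne_zero))
      rwa [h1] at this
    refine ⟨(1 + ‖QQ (j z.1) z.2‖) / 2, by positivity, by linarith, fun x hx => ContinuousLinearMap.opNorm_le_bound _ (by positivity) fun v => ?_⟩
    by_cases hv : v = 0
    · simp [hv]
    have hv' : 0 < ‖v‖ := norm_pos_iff.2 hv
    have h1 := isMaxOn_iff.1 hm (x, ‖v‖⁻¹ • v) ⟨hx, by simp [norm_smul, hv'.ne']⟩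
    generalize ‖QQ (j z.1) z.2‖ = m at *
    replace h1 : ‖QQ (j x) (‖v‖⁻¹ • v)‖ ≤ m := h1
    rw [map_smul, norm_smul, norm_inv, norm_norm, inv_mul_le_iff₀ hv'] at h1
    nlinarith

set_option maxHeartbeats 400000 in
theorem core2 {e e2 : V} (he : ‖e‖ = 1) (he2 : ‖e2‖ = 1) (hp : inner ℂ e e2 = 0) {j : V → V →L[ℝ] V} (hj : ∀ x, AnalyticAt ℝ j x) (ht : ∀ x v, v ≠ 0 → 0 < (inner ℂ v (j x v)).im)
    {A : Set V} (hA : A.Nonempty) (hAc : IsCompact A)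
    (hloc : ∀ p ∈ A, ∃ (w : V → ℂ) (C : ℝ), 0 ≤ C ∧ w p = 0 ∧ ∀ᶠ x in 𝓝 p, ContDiffAt ℝ 2 w x ∧ Metric.infDist x A ≤ C * ‖w x‖ ∧
      ∀ v, ‖fderiv ℝ w x v + Complex.I * fderiv ℝ w x (j x v)‖ ≤ C * ‖w x‖ * ‖v‖) : False := by
  have hQ : ∀ x, AnalyticAt ℝ (fun x => QQ (j x)) x := fun x => QQ_an (hj x) (ht x)
  have : FiniteDimensional ℝ V := inferInstance
  have : ProperSpace V := FiniteDimensional.proper ℝ V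
  obtain ⟨a, ha0, ha⟩ := hAc.isBounded.subset_ball_lt 0 0
  obtain ⟨χ, hχi, hχo⟩ : ∃ χ : ContDiffBump (0 : V), χ.rIn = a ∧ χ.rOut = 2 * a := ⟨⟨a, 2 * a, ha0, by linarith⟩, rfl, rfl⟩
  obtain ⟨q, hq0, hq1, hq⟩ := QQ_bd he hQ ht ha0
  obtain ⟨R, hR0, hR⟩ : ∃ R : ℝ, 0 < R ∧ 2 * (2 * a / R) ≤ 1 - q := ⟨4 * a / (1 - q), div_pos (by linarith) (by linarith), by
    have : 1 - q ≠ 0 := by linarith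
    field_simp; norm_num⟩
  obtain ⟨Q0, hQe⟩ : ∃ Q0 : V → V →L[ℝ] V, Q0 = fun x => χ x • QQ (j x) := ⟨_, rfl⟩
  have hQ0 : ContDiff ℝ 1 Q0 := hQe ▸  χ.contDiff.smul (contDiff_iff_contDiffAt.2 fun x => (hQ x).contDiffAt)
  obtain ⟨L, hL⟩ := hQ0.lipschitzWith_of_hasCompactSupport (hQe ▸ χ.hasCompactSupport.smul_right) (by norm_num)
  have hχz : ∀ x : V, 2 * a ≤ ‖x‖ → χ x = 0 := fun x hx => χ.zero_of_le_dist (by simpa [hχo] using hx)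
  have hQb : ∀ x, ‖Q0 x‖ ≤ q := fun x => by
    by_cases hx : 2 * a ≤ ‖x‖
    · simp [hQe, hχz x hx, hq0.le]
    · rw [hQe, norm_smul, Real.norm_of_nonneg χ.nonneg]
      push Not at hx
      have := hq x (by simpa using hx.le)
      nlinarith [χ.le_one (x := x), χ.nonneg (x := x), norm_nonneg (QQ (j x))]
  have hH : HQ (fun x => Q0 (R • x)) e q (2 * a / R) (L * R) := by
    refine ⟨he, hq0, hq1, fun x hx => ?_, hR, fun x => hQb _, by positivity, fun x y => ?_⟩
    · rw [div_le_iff₀ hR0] at hx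
      simp only [hQe]
      rw [hχz _ (by rw [norm_smul, Real.norm_of_nonneg hR0.le]; linarith), zero_smul]
    · have := hL.dist_le_mul (R • x) (R • y)
      rwa [dist_eq_norm, dist_eq_norm, ← smul_sub, norm_smul, Real.norm_of_nonneg hR0.le, ← mul_assoc] at this
  have hRc : Continuous fun x : V => R • x := by fun_prop
  refine core hH he2 hp (A := (fun x : V => R • x) ⁻¹' A) ?_ (hAc.isClosed.preimage hRc) ?_ ?_
  · obtain ⟨y, hy⟩ := hA
    exact ⟨R⁻¹ • y, by simpa [smul_smul, hR0.ne'] using hy⟩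
  · intro x hx
    have := ha hx
    rw [mem_ball_zero_iff, norm_smul, Real.norm_of_nonneg hR0.le] at this
    rw [lt_div_iff₀ hR0]; linarith
  · intro p hpA
    obtain ⟨w, C, hC, hw0, hw⟩ := hloc _ hpA
    refine ⟨fun x => w (R • x), C * R⁻¹ + C * R * 2, hw0, ?_⟩
    have hin : ∀ᶠ x in 𝓝 p, R • x ∈ Metric.ball (0:V) a := hRc.continuousAt.eventually (Metric.isOpen_ball.mem_nhds (ha hpA))
    filter_upwards [hRc.continuousAt.eventually hw, hin] with x ⟨h1, h2, h3⟩ h4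
    have hd : HasFDerivAt (fun x => w (R • x)) ((fderiv ℝ w (R • x)).comp (R • ContinuousLinearMap.id ℝ V)) x :=
      (h1.differentiableAt (by norm_num)).hasFDerivAt.comp x ((hasFDerivAt_id x).const_smul R)
    refine ⟨h1.comp x (contDiff_const_smul R).contDiffAt, ?_, fun ξ => ?_⟩
    · obtain ⟨y, hy, hxy⟩ := hAc.exists_infDist_eq_dist hA (R • x)
      have h5 : Metric.infDist x ((fun x : V => R • x) ⁻¹' A) ≤ dist x (R⁻¹ • y) := Metric.infDist_le_dist_of_mem (by simpa [smul_smul, hR0.ne'] using hy)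
      have h6 : dist x (R⁻¹ • y) = R⁻¹ * dist (R • x) y := by
        rw [dist_eq_norm, dist_eq_norm, ← Real.norm_of_nonneg (inv_nonneg.2 hR0.le), ← norm_smul, smul_sub, smul_smul, Real.norm_of_nonneg (inv_nonneg.2 hR0.le), inv_mul_cancel₀ hR0.ne', one_smul]
      rw [h6, ← hxy] at h5
      have h7 : R⁻¹ * Metric.infDist (R • x) A ≤ R⁻¹ * (C * ‖w (R • x)‖) := by gcongr
      have h8 : 0 ≤ C * R * 2 * ‖w (R • x)‖ := by positivity
      linarith
    · have hχ1 : Q0 (R • x) = QQ (j (R • x)) := by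
        simp only [hQe]
        rw [χ.one_of_mem_closedBall (by rw [hχi]; exact Metric.ball_subset_closedBall h4), one_smul]
      obtain ⟨v, e1, e2⟩ := QQ_e (ht (R • x)) ξ
      have e3 : ξ + Q0 (R • x) ξ = (2:ℝ) • v := by rw [hχ1, e2, e1, two_smul]; abel
      have e4 : Complex.I • (ξ - Q0 (R • x) ξ) = j (R • x) ((2:ℝ) • v) := by
        rw [hχ1, e2, e1, show v - Complex.I • j (R • x) v - (v + Complex.I • j (R • x) v) = -(Complex.I • ((2:ℝ) • j (R • x) v)) by
          rw [smul_comm, two_smul]; abel, smul_neg, smul_smul, Complex.I_mul_I, map_smul]; simp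
      have e5 : ‖(2:ℝ) • v‖ ≤ 2 * ‖ξ‖ := by
        rw [← e3]
        have := (Q0 (R • x)).le_of_opNorm_le (hQb (R • x)) ξ
        have h9 := norm_add_le ξ (Q0 (R • x) ξ)
        nlinarith [norm_nonneg ξ]
      rw [hd.fderiv, e3, e4]
      generalize (2:ℝ) • v = u at *
      have e6 := h3 (R • u)
      rw [map_smul (j (R • x)), norm_smul, Real.norm_of_nonneg hR0.le] at e6
      refine e6.trans ?_
      calc _ ≤ C * ‖w (R • x)‖ * (R * (2 * ‖ξ‖)) := by gcongr
        _ = C * R * 2 * ‖w (R • x)‖ * ‖ξ‖ := by ring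
        _ ≤ _ := by
          gcongr
          have : 0 ≤ C * R⁻¹ := by positivity
          linarith
end

def imL : ℝ →L[ℝ] ℂ := (Complex.I • ContinuousLinearMap.id ℂ ℂ).restrictScalars ℝ ∘L Complex.ofRealCLM

def th (J : E4 → E4 →L[ℝ] E4) (ρ : E4 → ℝ) (q : E4) : E4 →L[ℝ] ℂ :=
  cmpL E4 ℝ ℂ Complex.ofRealCLM (fderiv ℝ ρ q) - cmpL E4 ℝ ℂ imL (cmpL E4 E4 ℝ (fderiv ℝ ρ q) (J q))

variable {J : E4 → E4 →L[ℝ] E4} {ρ : E4 → ℝ} {Ω : Set E4}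

theorem th_a (q v : E4) : th J ρ q v = (fderiv ℝ ρ q v : ℂ) - Complex.I * (fderiv ℝ ρ q (J q v) : ℂ) := rfl

theorem th_an {q : E4} (hJ : AnalyticAt ℝ J q) (hρ : AnalyticAt ℝ ρ q) : AnalyticAt ℝ (th J ρ) q :=
  (lin_an (cmpL E4 ℝ ℂ Complex.ofRealCLM) hρ.fderiv).sub (lin_an (cmpL E4 ℝ ℂ imL) (an_bil (cmpL E4 E4 ℝ) hρ.fderiv hJ))

theorem th_re (q : E4) : Complex.reCLM.comp (th J ρ q) = fderiv ℝ ρ q := by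
  refine ContinuousLinearMap.ext fun v => ?_
  rw [ContinuousLinearMap.comp_apply, th_a]; simp

theorem th_J {q : E4} (hJ : (J q).comp (J q) = - ContinuousLinearMap.id ℝ E4) (v : E4) : th J ρ q (J q v) = Complex.I * th J ρ q v := by
  have : J q (J q v) = -v := DFunLike.congr_fun hJ v
  rw [th_a, th_a, this, map_neg, Complex.ofReal_neg]
  linear_combination ((fderiv ℝ ρ q (J q v) : ℂ)) * Complex.I_mul_I

theorem th_s {q : E4} (hJ : (J q).comp (J q) = - ContinuousLinearMap.id ℝ E4) (h : fderiv ℝ ρ q ≠ 0) : Function.Surjective (th J ρ q) := by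
  obtain ⟨v, hv⟩ := DFunLike.ne_iff.1 h
  have hn : th J ρ q v ≠ 0 := fun h0 => hv (by
    have := DFunLike.congr_fun (th_re (J := J) (ρ := ρ) q) v
    rw [← this, ContinuousLinearMap.comp_apply, h0]; simp)
  intro c
  refine ⟨(c / th J ρ q v).re • v + (c / th J ρ q v).im • J q v, ?_⟩
  rw [map_add, map_smul, map_smul, th_J hJ, Complex.real_smul, Complex.real_smul]
  calc _ = ((c / th J ρ q v).re + (c / th J ρ q v).im * Complex.I) * th J ρ q v := by ring
    _ = c := by rw [Complex.re_add_im, div_mul_cancel₀ _ hn]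

theorem pk_disk (hM : IsHypersurface ρ Ω) {V : Set E2} {γ : E2 → E4} (hd : IsJHolDisk J V γ) (hr : IsRegularOn γ V) (h0 : γ 0 ∈ Ω)
    {k : ℕ} (hv : VanishesToOrder (fun z => ρ (γ z)) (k + 1)) : PK (th J ρ) k (γ 0) := by
  obtain ⟨hVo, h0V, hs, hh⟩ := hd
  have hV := hVo.mem_nhds h0V
  have hγ : Sm γ 0 := by
    filter_upwards [hV] with z hz using hs.contDiffAt (hVo.mem_nhds hz)
  refine ⟨γ, hγ, rfl, ?_, ?_⟩
  · rw [injective_iff_map_eq_zero]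
    intro u hu
    by_contra hne
    apply hr 0 h0V
    have h2 : fderiv ℝ γ 0 (J0 u) = 0 := by
      have := DFunLike.congr_fun (hh 0 h0V) u
      rw [ContinuousLinearMap.comp_apply, ContinuousLinearMap.comp_apply, hu, map_zero] at this
      exact this
    have hn : u.1 ^ 2 + u.2 ^ 2 ≠ 0 := fun h => hne (by
      have h1 : u.1 = 0 := by nlinarith [sq_nonneg u.1, sq_nonneg u.2]
      have h2 : u.2 = 0 := by nlinarith [sq_nonneg u.1, sq_nonneg u.2]
      exact Prod.ext h1 h2)
    refine ContinuousLinearMap.ext fun x => ?_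
    have hx : x = ((x.1 * u.1 + x.2 * u.2) / (u.1 ^ 2 + u.2 ^ 2)) • u + ((x.2 * u.1 - x.1 * u.2) / (u.1 ^ 2 + u.2 ^ 2)) • J0 u := by
      have hJ : J0 u = (-u.2, u.1) := rfl
      rw [hJ]
      apply Prod.ext
      · simp; field_simp; ring
      · simp; field_simp; ring
    rw [hx, map_add, map_smul, map_smul, hu, h2]; simp
  · have hg : Flat (k + 1) (fun z => ρ (γ z)) := ⟨hγ.an (hM.2.1 _ h0), hv⟩
    refine Flat.congr ((hg.fderiv.lin (cmpL E2 ℝ ℂ Complex.ofRealCLM)).sub ((hg.fderiv.lin ((cmpL E2 E2 ℝ).flip J0)).lin (cmpL E2 ℝ ℂ imL))) ?_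
    filter_upwards [hV, hγ, hγ.self_of_nhds.continuousAt.eventually (hM.1.mem_nhds h0)] with y h1 h2 h3
    have hc : fderiv ℝ (fun z => ρ (γ z)) y = (fderiv ℝ ρ (γ y)).comp (fderiv ℝ γ y) :=
      fderiv_comp (g := ρ) y (hM.2.1 _ h3).differentiableAt (h2.differentiableAt (by simp))
    refine ContinuousLinearMap.ext fun u => ?_
    rw [hc]
    have h4 : J (γ y) (fderiv ℝ γ y u) = fderiv ℝ γ y (J0 u) := (DFunLike.congr_fun (hh y h1) u).symm
    show th J ρ (γ y) (fderiv ℝ γ y u) = _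
    rw [th_a, h4]
    rfl

def TE : E4 ≃L[ℝ] EuclideanSpace ℂ (Fin 2) := LinearEquiv.toContinuousLinearEquiv
  { toFun := fun v => !₂[(⟨v 0, v 1⟩ : ℂ), ⟨v 2, v 3⟩]
    invFun := fun z => !₂[(z 0).re, (z 0).im, (z 1).re, (z 1).im]
    map_add' := fun v w => by ext i; fin_cases i <;> apply Complex.ext <;> simp
    map_smul' := fun c v => by ext i; fin_cases i <;> apply Complex.ext <;> simp
    left_inv := fun v => by ext i; fin_cases i <;> simp
    right_inv := fun v => by ext i; fin_cases i <;> simp }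

theorem TE_om (v w : E4) : (inner ℂ (TE v) (TE w)).im = omega0 v w := by
  have h : ∀ v : E4, TE v = !₂[(⟨v 0, v 1⟩ : ℂ), ⟨v 2, v 3⟩] := fun v => rfl
  rw [PiLp.inner_apply, Fin.sum_univ_two, h, h, omega0]
  simp; ring

theorem fin (hJ : IsAlmostComplex J) (hAd : IsAdapted J) {K : Set E4} (hK : IsCompact K) (hne : K.Nonempty)
    (hloc : ∀ p ∈ K, ∃ (w : E4 → ℂ) (C : ℝ), 0 ≤ C ∧ w p = 0 ∧ ∀ᶠ q in 𝓝 p, ContDiffAt ℝ 2 w q ∧ Metric.infDist q K ≤ C * ‖w q‖ ∧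
      ∀ v, ‖fderiv ℝ w q v - th J ρ q v‖ ≤ C * ‖w q‖ * ‖v‖) : False := by
  refine core2 (V := EuclideanSpace ℂ (Fin 2)) (e := EuclideanSpace.single 0 1) (e2 := EuclideanSpace.single 1 1) (by rw [EuclideanSpace.norm_single, norm_one]) (by rw [EuclideanSpace.norm_single, norm_one]) (by rw [EuclideanSpace.inner_single_left]; simp)
    (j := fun x => (TE : E4 →L[ℝ] EuclideanSpace ℂ (Fin 2)).comp ((J (TE.symm x)).comp (TE.symm : EuclideanSpace ℂ (Fin 2) →L[ℝ] E4)))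
    (fun x => ?_) (fun x v hv => ?_) (A := TE '' K) (hne.image _) (hK.image TE.continuous) ?_
  · have h1 : AnalyticAt ℝ (fun x => J (TE.symm x)) x := (hJ.1 _).comp ((TE.symm : EuclideanSpace ℂ (Fin 2) →L[ℝ] E4).analyticAt x)
    exact lin_an (cmpL _ E4 _ (TE : E4 →L[ℝ] EuclideanSpace ℂ (Fin 2))) (lin_an ((cmpL _ E4 E4).flip (TE.symm : EuclideanSpace ℂ (Fin 2) →L[ℝ] E4)) h1)
  · have := hAd.2 (TE.symm x) (TE.symm v) (by simpa using hv)
    rw [← TE_om, TE.apply_symm_apply] at this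
    exact this
  · rintro _ ⟨p, hp, rfl⟩
    obtain ⟨w, C, hC, hw0, hw⟩ := hloc p hp
    obtain ⟨c, hc, hb⟩ := bdd_ev (hJ.1 p).continuousAt
    obtain ⟨a, ha⟩ : ∃ a, a = ‖(TE : E4 →L[ℝ] EuclideanSpace ℂ (Fin 2))‖ := ⟨_, rfl⟩
    obtain ⟨b, hb'⟩ : ∃ b, b = ‖(TE.symm : EuclideanSpace ℂ (Fin 2) →L[ℝ] E4)‖ := ⟨_, rfl⟩
    have ha0 : 0 ≤ a := by rw [ha]; positivity
    have hb0 : 0 ≤ b := by rw [hb']; positivity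
    have hT : Tendsto TE.symm (𝓝 (TE p)) (𝓝 p) := by
      have := TE.symm.continuous.tendsto (TE p)
      rwa [TE.symm_apply_apply] at this
    refine ⟨fun x => w (TE.symm x), C * a + C * (1 + c) * b, by positivity, by simpa using hw0, ?_⟩
    filter_upwards [hT.eventually hw, hT.eventually hb] with x ⟨h1, h2, h3⟩ h4
    have hd : HasFDerivAt (fun x => w (TE.symm x)) ((fderiv ℝ w (TE.symm x)).comp (TE.symm : EuclideanSpace ℂ (Fin 2) →L[ℝ] E4)) x :=
      (h1.differentiableAt (by norm_num)).hasFDerivAt.comp x (TE.symm : EuclideanSpace ℂ (Fin 2) →L[ℝ] E4).hasFDerivAt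
    refine ⟨h1.comp x TE.symm.contDiff.contDiffAt, ?_, fun v => ?_⟩
    · obtain ⟨y, hy, hxy⟩ := hK.exists_infDist_eq_dist hne (TE.symm x)
      have h5 : Metric.infDist x (TE '' K) ≤ dist x (TE y) := Metric.infDist_le_dist_of_mem ⟨y, hy, rfl⟩
      have h6 : dist x (TE y) ≤ a * dist (TE.symm x) y := by
        rw [dist_eq_norm, dist_eq_norm, ha]
        have := (TE : E4 →L[ℝ] EuclideanSpace ℂ (Fin 2)).le_opNorm (TE.symm x - y)
        simpa using this
      rw [← hxy] at h6
      have h7 : a * Metric.infDist (TE.symm x) K ≤ a * (C * ‖w (TE.symm x)‖) := by gcongr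
      have h8 : 0 ≤ C * (1 + c) * b * ‖w (TE.symm x)‖ := by positivity
      linarith
    · rw [hd.fderiv]
      show ‖fderiv ℝ w (TE.symm x) (TE.symm v) + Complex.I * fderiv ℝ w (TE.symm x) (TE.symm (TE (J (TE.symm x) (TE.symm v))))‖ ≤ _
      rw [TE.symm_apply_apply]
      have hu : ‖TE.symm v‖ ≤ b * ‖v‖ := by rw [hb']; exact (TE.symm : EuclideanSpace ℂ (Fin 2) →L[ℝ] E4).le_opNorm v
      generalize TE.symm v = u at *
      generalize TE.symm x = q at *
      have e1 := h3 u
      have e2 := h3 (J q u)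
      have e3 : ‖J q u‖ ≤ c * ‖u‖ := (J q).le_of_opNorm_le h4 u
      rw [show fderiv ℝ w q u + Complex.I * fderiv ℝ w q (J q u) = (fderiv ℝ w q u - th J ρ q u) + Complex.I * (fderiv ℝ w q (J q u) - th J ρ q (J q u)) by
        rw [th_J (hJ.2 q)]; linear_combination (th J ρ q u) * Complex.I_mul_I]
      refine (norm_add_le _ _).trans ?_
      rw [norm_mul, Complex.norm_I, one_mul]
      calc _ ≤ C * ‖w q‖ * (b * ‖v‖) + C * ‖w q‖ * (c * (b * ‖v‖)) :=
            add_le_add (e1.trans (by gcongr)) (e2.trans (by gcongr; exact e3.trans (by gcongr)))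
        _ = (0 + C * (1 + c) * b) * ‖w q‖ * ‖v‖ := by ring
        _ ≤ _ := by gcongr; positivity

theorem main_thm (hJ : IsAlmostComplex J) (hAd : IsAdapted J) (hM : IsHypersurface ρ Ω)
    (hcompact : IsCompact {x | x ∈ Ω ∧ ρ x = 0}) :
    ∃ k : ℕ, ∀ p ∈ {x | x ∈ Ω ∧ ρ x = 0},
      ∀ V γ, IsJHolDisk J V γ → IsRegularOn γ V → γ 0 = p →
        ¬ VanishesToOrder (fun z => ρ (γ z)) (k + 1) := by
  by_contra! hcon
  let M : Set E4 := {x | x ∈ Ω ∧ ρ x = 0}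
  let Kk : ℕ → Set E4 := fun k => {q | q ∈ M ∧ PK (th J ρ) k q}
  have hsub : ∀ k, closure (Kk k) ⊆ M := fun k => closure_minimal (fun q hq => hq.1) hcompact.isClosed
  have hne : ∀ k, (Kk k).Nonempty := fun k => by
    obtain ⟨p, hp, V, γ, h1, h2, rfl, h4⟩ := hcon k
    exact ⟨γ 0, hp, pk_disk hM h1 h2 hp.1 h4⟩
  have hcp : ∀ k, IsCompact (closure (Kk k)) := fun k => hcompact.of_isClosed_subset isClosed_closure (hsub k)
  have hKne : (⋂ k, closure (Kk k)).Nonempty := by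
    refine IsCompact.nonempty_iInter_of_sequence_nonempty_isCompact_isClosed _ (fun k => closure_mono ?_) (fun k => (hne k).closure) (hcp 0) fun k => isClosed_closure
    rintro q ⟨h1, γ, h2, h3, h4, h5⟩
    exact ⟨h1, γ, h2, h3, h4, h5.mono (by omega)⟩
  refine fin (ρ := ρ) hJ hAd ((hcp 0).of_isClosed_subset (isClosed_iInter fun k => isClosed_closure) (iInter_subset _ 0)) hKne fun p hp => ?_
  rw [mem_iInter] at hp
  obtain ⟨hpΩ, hp0⟩ : p ∈ M := hsub 0 (hp 0)
  refine geo (by simp) (th_an (hJ.1 p) (hM.2.1 p hpΩ)) (th_s (hJ.2 p) (hM.2.2 p hpΩ hp0)) ?_ hp0 ?_ fun k => ?_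
  · filter_upwards [hM.1.mem_nhds hpΩ] with q hq
    rw [th_re]; exact (hM.2.1 q hq).differentiableAt.hasFDerivAt
  · filter_upwards [hM.1.mem_nhds hpΩ] with q hq h1 h2
    exact mem_iInter.2 fun k => subset_closure ⟨⟨hq, h1⟩, h2 k⟩
  · exact (mem_closure_iff_frequently.1 (hp k)).mono fun q hq => hq.2
end

/-- **Théorème 0-9.** If `J` is a real-analytic almost complex structure on `ℝ⁴` adapted to
the standard symplectic form `ω₀`, then every compact real-analytic hypersurface is of
finite type for `J`. -/
theorem compact_hypersurface_finite_type
    (J : E4 → E4 →L[ℝ] E4) (ρ : E4 → ℝ) (Ω : Set E4)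
    (hJ : IsAlmostComplex J) (hAd : IsAdapted J) (hM : IsHypersurface ρ Ω)
    (hcompact : IsCompact {x | x ∈ Ω ∧ ρ x = 0}) :
    ∃ k : ℕ, ∀ p ∈ {x | x ∈ Ω ∧ ρ x = 0},
      ∀ V γ, IsJHolDisk J V γ → IsRegularOn γ V → γ 0 = p →
        ¬ VanishesToOrder (fun z => ρ (γ z)) (k + 1) := by
  exact main_thm hJ hAd hM hcompact
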